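/- There exists a constant c ≥ 1 such that for every 2-TVASS V = (Q, Σ, Δ), every state q ∈ Q, and all x, y ∈ ℕ with q(0, x) →* q(0, y), there exists a linear path scheme L with |L| ≤ (|Q| + ‖Σ‖)^c and |L|_* ≤ c·|Q|² such that q(0, x) →^L q(0, y). -/

import Mathlib

namespace TVASSpaper

/-- Actions of a `d`-TVASS: `some a` is an addition of the vector `a ∈ ℤ^d`,
    `none` is the zero-test action `tst` (on the first counter). -/
abbrev Act (d : ℕ) := Option (Fin d → ℤ)

/-- Transitions. -/
abbrev Trans (d : ℕ) (Q : Type) := Q × Act d × Q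

/-- Configurations: a state together with a vector of `d` counters. -/
abbrev Config (d : ℕ) (Q : Type) := Q × (Fin d → ℕ)

/-- A `d`-TVASS: a finite set `acts` of actions and a finite set of transitions
    `trans ⊆ Q × acts × Q`. The state set `Q` is a (finite, nonempty) type. -/
structure TVASS (d : ℕ) (Q : Type) where
  acts : Finset (Act d)
  trans : Finset (Trans d Q)
  mem_acts : ∀ t ∈ trans, t.2.1 ∈ acts

variable {d : ℕ} {Q : Type}

/-- The step induced by a single transition: an addition transition `(p, a, q)`
    induces `p(x) → q(x + a)` whenever `x + a ∈ ℕ^d`; a zero-test transition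
    `(p, tst, q)` induces `p(x) → q(x)` whenever the first counter is `0`. -/
def StepBy [NeZero d] (t : Trans d Q) (c c' : Config d Q) : Prop :=
  t.1 = c.1 ∧ t.2.2 = c'.1 ∧
    match t.2.1 with
    | some a => ∀ i, (c'.2 i : ℤ) = (c.2 i : ℤ) + a i
    | none => c.2 0 = 0 ∧ c'.2 = c.2

/-- `Run V c π c'` : there is a run from `c` to `c'` taking the steps of the
    word of transitions `π` in order. -/
inductive Run [NeZero d] (V : TVASS d Q) :
    Config d Q → List (Trans d Q) → Config d Q → Prop
  | nil (c : Config d Q) : Run V c [] c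
  | cons {t : Trans d Q} {c c' c'' : Config d Q} {π : List (Trans d Q)} :
      t ∈ V.trans → StepBy t c c' → Run V c' π c'' → Run V c (t :: π) c''

/-- One step of the TVASS. -/
def Step [NeZero d] (V : TVASS d Q) (c c' : Config d Q) : Prop :=
  ∃ t ∈ V.trans, StepBy t c c'

/-- Reachability `c →* c'`. -/
def Reach [NeZero d] (V : TVASS d Q) (c c' : Config d Q) : Prop :=
  ∃ π, Run V c π c'

/-- `IsPathFrom V p π q` : `π` is a path (word of transitions of `V` with
    matching endpoints) from state `p` to state `q`. -/
inductive IsPathFrom (V : TVASS d Q) : Q → List (Trans d Q) → Q → Prop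
  | nil (p : Q) : IsPathFrom V p [] p
  | cons {t : Trans d Q} {π : List (Trans d Q)} {q : Q} :
      t ∈ V.trans → IsPathFrom V t.2.2 π q → IsPathFrom V t.1 (t :: π) q

/-- `n`-fold concatenation of a word. -/
def pw {α : Type*} (l : List α) (n : ℕ) : List α := (List.replicate n l).flatten

/-- A linear path scheme `α₀ β₁* α₁ ⋯ β_k* α_k`, given by the head path `α₀`
    and the list of pairs `(β₁, α₁), …, (β_k, α_k)`. -/
structure LPS (d : ℕ) (Q : Type) where
  head : List (Trans d Q)
  rest : List (List (Trans d Q) × List (Trans d Q))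

/-- Length `|L|` of a linear path scheme. -/
def LPS.len (L : LPS d Q) : ℕ :=
  L.head.length + (L.rest.map fun p => p.1.length + p.2.length).sum

/-- Number of stars `|L|_*` of a linear path scheme. -/
def LPS.stars (L : LPS d Q) : ℕ := L.rest.length

def wordRest : List (List (Trans d Q) × List (Trans d Q)) → List ℕ → List (Trans d Q)
  | [], _ => []
  | p :: rest, ns => pw p.1 (ns.headD 0) ++ p.2 ++ wordRest rest ns.tail

/-- The word `α₀ β₁^{n₁} α₁ ⋯ β_k^{n_k} α_k` of `L` for exponents `ns`. -/
def LPS.word (L : LPS d Q) (ns : List ℕ) : List (Trans d Q) :=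
  L.head ++ wordRest L.rest ns

/-- Well-formedness of the tail of a linear path scheme starting in state `s`:
    the `βᵢ` are cycles and the `αᵢ` are paths, with matching endpoints. -/
inductive ChainLPS (V : TVASS d Q) :
    Q → List (List (Trans d Q) × List (Trans d Q)) → Q → Prop
  | nil (q : Q) : ChainLPS V q [] q
  | cons {s s' q : Q} {β α : List (Trans d Q)}
      {rest : List (List (Trans d Q) × List (Trans d Q))} :
      IsPathFrom V s β s → IsPathFrom V s α s' → ChainLPS V s' rest q →
      ChainLPS V s ((β, α) :: rest) q

/-- `L` is a genuine linear path scheme from `p` to `q` in `V`. -/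
def IsLPS (V : TVASS d Q) (p : Q) (L : LPS d Q) (q : Q) : Prop :=
  ∃ s, IsPathFrom V p L.head s ∧ ChainLPS V s L.rest q

/-- `c →^L c'` : reachability along the linear path scheme `L`. -/
def ReachLPS [NeZero d] (V : TVASS d Q) (L : LPS d Q) (c c' : Config d Q) : Prop :=
  ∃ ns, Run V c (L.word ns) c'

/-- `‖x⃗‖`: maximum component of a vector of naturals. -/
def vnorm {d : ℕ} (v : Fin d → ℕ) : ℕ := Finset.univ.sup v

/-- Maximum absolute value of a component of an integer vector. -/
def vnormZ {d : ℕ} (v : Fin d → ℤ) : ℕ := Finset.univ.sup fun i => (v i).natAbs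

/-- `‖Σ‖`: maximum absolute value of a component of a vector in `Σ ∖ {tst}`
    (0 if `Σ ⊆ {tst}`). -/
def TVASS.actNorm (V : TVASS d Q) : ℕ :=
  V.acts.sup fun a => a.elim 0 vnormZ

/-- Displacement of a word of transitions (zero-tests contribute `0`). -/
def disp (π : List (Trans d Q)) : Fin d → ℤ :=
  fun i => (π.map fun t => (t.2.1.elim 0 id : Fin d → ℤ) i).sum

/-- `m_π(i)`: max over prefixes `α` of `π` (including the empty prefix) of `-Δ(α)(i)`. -/
def mpre (π : List (Trans d Q)) (i : Fin d) : ℤ :=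
  (π.inits.map fun α => -(disp α i)).foldr max 0

/-- `m_π̄(i)`: max over suffixes `σ` of `π` (including the empty suffix) of `Δ(σ)(i)`. -/
def msuf (π : List (Trans d Q)) (i : Fin d) : ℤ :=
  (π.tails.map fun σ => disp σ i).foldr max 0

/-- `π` contains no zero-test transition. -/
def noTst (π : List (Trans d Q)) : Prop := ∀ t ∈ π, t.2.1 ≠ none

/-- `x⃗ ≥₁ m⃗` : `x⃗(1) = m⃗(1)` and `x⃗(i) ≥ m⃗(i)` for all other `i`. -/
def ge1 [NeZero d] (x : Fin d → ℕ) (m : Fin d → ℤ) : Prop :=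
  (x 0 : ℤ) = m 0 ∧ ∀ i : Fin d, i ≠ 0 → m i ≤ (x i : ℤ)

/-- A path from `p` to `q` is feasible if some run takes it. -/
def Feasible [NeZero d] (V : TVASS d Q) (p : Q) (π : List (Trans d Q)) (q : Q) : Prop :=
  ∃ x y, Run V (p, x) π (q, y)

/-- `c →^{A* ∪ T} c'` : there is a run from `c` to `c'` whose path either
    contains no zero-test transition, or is a single zero-test transition. -/
def ReachAT [NeZero d] (V : TVASS d Q) (c c' : Config d Q) : Prop :=
  ∃ π, Run V c π c' ∧ (noTst π ∨ ∃ t : Trans d Q, π = [t] ∧ t.2.1 = none)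

/-- `p ⇝ q` for a 2-TVASS: `p(0, x) →* q(0, y)` for some `x, y ∈ ℕ`. -/
def Leads (V : TVASS 2 Q) (p q : Q) : Prop :=
  ∃ x y : ℕ, Reach V (p, ![0, x]) (q, ![0, y])

/-- The linear path scheme `L` is bounded from the configuration `c`: the set of
    configurations reachable from `c` along a prefix of a path in `L` is finite. -/
def BoundedLPS [NeZero d] (V : TVASS d Q) (L : LPS d Q) (c : Config d Q) : Prop :=
  {c' : Config d Q | ∃ ns ρ, ρ <+: L.word ns ∧ Run V c ρ c'}.Finite

section OneCounter

/-- Runs of a one-counter system with step relation `R`, of a given length, all of whose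
counter values lie in `I`. -/
inductive CR {S : Type*} (R : S → ℤ → S → Prop) (I : Set ℤ) : ℕ → S → ℤ → S → ℤ → Prop
  | nil {s : S} {v : ℤ} : v ∈ I → CR R I 0 s v s v
  | cons {s s' t : S} {v w δ : ℤ} {n : ℕ} :
      v ∈ I → R s δ s' → CR R I n s' (v + δ) t w → CR R I (n + 1) s v t w

/-- A one-counter run presented by the sequences of its states and counter values. -/
def FR {S : Type*} (R : S → ℤ → S → Prop) (l : ℕ) (st : ℕ → S) (val : ℕ → ℤ) : Prop :=
  ∀ i < l, R (st i) (val (i + 1) - val i) (st (i + 1))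

variable {S : Type*} {R : S → ℤ → S → Prop} {I : Set ℤ}

theorem CR.append {n m : ℕ} {s t r : S} {v w x : ℤ} (h : CR R I n s v t w)
    (h' : CR R I m t w r x) : CR R I (n + m) s v r x := by
  induction h with
  | nil _ => simpa using h'
  | cons hv hr _ ih =>
    have := CR.cons hv hr (ih h')
    rwa [show ∀ a : ℕ, a + 1 + m = a + m + 1 by intro a; omega]

theorem CR.left_mem {n : ℕ} {s t : S} {v w : ℤ} (h : CR R I n s v t w) : v ∈ I := by
  cases h <;> assumption

/-- Negating the counter. -/
theorem CR.neg {n : ℕ} {s t : S} {v w : ℤ} (h : CR R I n s v t w) :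
    CR (fun s δ t => R s (-δ) t) {x | -x ∈ I} n s (-v) t (-w) := by
  induction h with
  | nil hv => exact .nil (by simpa using hv)
  | @cons s s' t v w δ n hv hr _ ih =>
    refine .cons (δ := -δ) (by simpa using hv) (by simpa using hr) ?_
    convert ih using 1; ring

theorem CR.of_neg {n : ℕ} {s t : S} {v w : ℤ}
    (h : CR (fun s δ t => R s (-δ) t) {x | -x ∈ I} n s (-v) t (-w)) : CR R I n s v t w := by
  have := h.neg
  simpa using this

theorem CR.rev {n : ℕ} {s t : S} {v w : ℤ} (h : CR R I n s v t w) :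
    CR (fun s δ t => R t (-δ) s) I n t w s v := by
  induction h with
  | nil hv => exact .nil hv
  | @cons s s' t v w δ n hv hr hc ih =>
    refine ih.append (m := 1) (.cons (δ := -δ) hc.left_mem (by simpa using hr) ?_)
    rw [show v + δ + -δ = v by ring]
    exact .nil hv

theorem CR.of_rev {n : ℕ} {s t : S} {v w : ℤ}
    (h : CR (fun s δ t => R t (-δ) s) I n t w s v) : CR R I n s v t w := by
  simpa using h.rev

theorem CR.exists_seq {n : ℕ} {s t : S} {v w : ℤ} (h : CR R I n s v t w) :
    ∃ st val, FR R n st val ∧ st 0 = s ∧ val 0 = v ∧ st n = t ∧ val n = w ∧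
      ∀ i ≤ n, val i ∈ I := by
  induction h with
  | @nil s v hv =>
    exact ⟨fun _ => s, fun _ => v, fun i hi => by omega, rfl, rfl, rfl, rfl, fun _ _ => hv⟩
  | @cons s s' t v w δ n hv hr _ ih =>
    obtain ⟨st, val, hf, h1, h2, h3, h4, h5⟩ := ih
    refine ⟨fun i => i.casesOn s st, fun i => i.casesOn v val, ?_, rfl, rfl, h3, h4, ?_⟩
    · intro i hi
      cases i with
      | zero => simpa [h1, h2] using hr
      | succ i => exact hf i (by omega)
    · intro i hi
      cases i with
      | zero => exact hv
      | succ i => exact h5 i (by omega)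

theorem FR.seg {l : ℕ} {st : ℕ → S} {val : ℕ → ℤ} (h : FR R l st val) (k : ℤ) {i j : ℕ}
    (hij : i ≤ j) (hj : j ≤ l) (hI : ∀ t, i ≤ t → t ≤ j → val t + k ∈ I) :
    CR R I (j - i) (st i) (val i + k) (st j) (val j + k) := by
  induction j, hij using Nat.le_induction with
  | base => simpa using CR.nil (hI i le_rfl le_rfl)
  | succ j hij ih =>
    rw [show j + 1 - i = (j - i) + 1 by omega]
    refine (ih (by omega) fun t h1 h2 => hI t h1 (by omega)).append
      (.cons (hI j hij (by omega)) (h j (by omega)) ?_)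
    rw [show val j + k + (val (j + 1) - val j) = val (j + 1) + k by ring]
    exact .nil (hI _ (by omega) le_rfl)

theorem FR.seg' {l : ℕ} {st : ℕ → S} {val : ℕ → ℤ} (h : FR R l st val) {i j : ℕ}
    (hij : i ≤ j) (hj : j ≤ l) (hI : ∀ t, i ≤ t → t ≤ j → val t ∈ I) :
    CR R I (j - i) (st i) (val i) (st j) (val j) := by
  simpa using h.seg 0 hij hj (by simpa using hI)

/-- The last time up to `b` at which the value is at most `h`. -/
theorem exists_last_le (val : ℕ → ℤ) {h : ℤ} {a b : ℕ} (hab : a ≤ b) (ha : val a ≤ h)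
    (hb : h < val b) : ∃ u, a ≤ u ∧ u < b ∧ val u ≤ h ∧ ∀ t, u < t → t ≤ b → h < val t := by
  induction b, hab using Nat.le_induction with
  | base => omega
  | succ b hab ih =>
    by_cases hc : h < val b
    · obtain ⟨u, h1, h2, h3, h4⟩ := ih hc
      refine ⟨u, h1, by omega, h3, fun t h5 h6 => ?_⟩
      rcases Nat.lt_or_ge b t with h7 | h7
      · rwa [show t = b + 1 by omega]
      · exact h4 t h5 h7
    · refine ⟨b, hab, by omega, by omega, fun t h5 h6 => ?_⟩
      rwa [show t = b + 1 by omega]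

/-- The first time from `a` on at which the value is at most `h`. -/
theorem exists_first_le (val : ℕ → ℤ) {h : ℤ} {a b : ℕ} (hab : a ≤ b) (ha : h < val a)
    (hb : val b ≤ h) : ∃ u, a < u ∧ u ≤ b ∧ val u ≤ h ∧ ∀ t, a ≤ t → t < u → h < val t := by
  have hex : ∃ t, a ≤ t ∧ val t ≤ h := ⟨b, hab, hb⟩
  classical
  refine ⟨Nat.find hex, ?_, Nat.find_min' hex ⟨hab, hb⟩, (Nat.find_spec hex).2, ?_⟩
  · rcases (Nat.find_spec hex).1.lt_or_eq with h1 | h1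
    · exact h1
    · have := (Nat.find_spec hex).2
      rw [← h1] at this; omega
  · intro t h1 h2
    have := Nat.find_min hex h2
    by_contra h3
    exact this ⟨h1, by omega⟩

theorem FR.peak_cut [Fintype S] [hI : I.OrdConnected] {X : ℕ}
    (hR : ∀ s δ t, R s δ t → |δ| ≤ X) {l : ℕ} {st : ℕ → S} {val : ℕ → ℤ} (h : FR R l st val)
    (hv : ∀ i ≤ l, val i ∈ I) {B : ℤ} (h0 : val 0 ≤ B) (hl : val l ≤ B) {τ : ℕ} (hτ : τ ≤ l)
    (hpk : B + ((Fintype.card S * X) ^ 2 : ℕ) < val τ) :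
    ∃ l' < l, CR R I l' (st 0) (val 0) (st l) (val l) := by
  classical
  set H := (Fintype.card S * X) ^ 2 with hH
  have hstep : ∀ i < l, |val (i + 1) - val i| ≤ X := fun i hi => hR _ _ _ (h i hi)
  have hup : ∀ k : Fin (H + 1), ∃ u, 0 ≤ u ∧ u < τ ∧ val u ≤ B + k.1 ∧
      ∀ t, u < t → t ≤ τ → B + k.1 < val t := fun k =>
    exists_last_le val (Nat.zero_le _) (by omega) (by have := k.2; omega)
  have hdn : ∀ k : Fin (H + 1), ∃ u, τ < u ∧ u ≤ l ∧ val u ≤ B + k.1 ∧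
      ∀ t, τ ≤ t → t < u → B + k.1 < val t := fun k =>
    exists_first_le val hτ (by have := k.2; omega) (by omega)
  choose u _ hu1 hu2 hu3 using hup
  choose d hd1 hd0 hd2 hd3 using hdn
  have hou : ∀ k, (B + k.1 - val (u k)).toNat < X := fun k => by
    have h1 := hu3 k (u k + 1) (by omega) (hu1 k)
    have h2 := abs_le.1 (hstep (u k) (by have := hu1 k; omega))
    have h3 := hu2 k
    omega
  have hod : ∀ k, (B + k.1 - val (d k)).toNat < X := fun k => by
    have h1 := hd3 k (d k - 1) (by have := hd1 k; omega) (by have := hd1 k; omega)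
    have h2 := abs_le.1 (hstep (d k - 1) (by have := hd0 k; have := hd1 k; omega))
    rw [show d k - 1 + 1 = d k by have := hd1 k; omega] at h2
    have h3 := hd2 k
    omega
  let F : Fin (H + 1) → (S × Fin X) × (S × Fin X) := fun k =>
    ((st (u k), ⟨_, hou k⟩), (st (d k), ⟨_, hod k⟩))
  obtain ⟨a, b, hab, hF⟩ : ∃ a b, a < b ∧ F a = F b := by
    obtain ⟨a, b, hne, hF⟩ := Fintype.exists_ne_map_eq_of_card_lt F (by
      simp only [Fintype.card_prod, Fintype.card_fin]; rw [hH]; ring_nf; omega)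
    rcases lt_or_gt_of_ne hne with h1 | h1
    · exact ⟨a, b, h1, hF⟩
    · exact ⟨b, a, h1, hF.symm⟩
  simp only [F, Prod.mk.injEq, Fin.mk.injEq] at hF
  obtain ⟨⟨e1, e2⟩, e3, e4⟩ := hF
  have hab' : (a.1 : ℤ) < b.1 := by exact_mod_cast hab
  have e2' : val (u a) = val (u b) + (a.1 - b.1 : ℤ) := by
    have := hu2 a; have := hu2 b; omega
  have e4' : val (d a) = val (d b) + (a.1 - b.1 : ℤ) := by
    have := hd2 a; have := hd2 b; omega
  have hlt : u a < u b := by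
    by_contra hc
    rcases (not_lt.1 hc).lt_or_eq with h1 | h1
    · have := hu3 b (u a) h1 (hu1 a).le
      have := hu2 a; omega
    · rw [h1] at e2'; omega
  have hlt' : d b < d a := by
    by_contra hc
    rcases (not_lt.1 hc).lt_or_eq with h1 | h1
    · have := hd3 b (d a) (hd1 a).le h1
      have := hd2 a; omega
    · rw [h1] at e4'; omega
  have c1 : CR R I (u a - 0) (st 0) (val 0) (st (u a)) (val (u a)) :=
    h.seg' (Nat.zero_le _) (by have := hu1 a; omega) fun t _ h2 => hv t (by have := hu1 a; omega)
  have c3 : CR R I (l - d a) (st (d a)) (val (d a)) (st l) (val l) :=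
    h.seg' (hd0 a) le_rfl fun t _ h2 => hv t h2
  have c2 : CR R I (d b - u b) (st (u b)) (val (u b) + (a.1 - b.1 : ℤ)) (st (d b))
      (val (d b) + (a.1 - b.1 : ℤ)) := by
    refine h.seg _ (by have := hu1 b; have := hd1 b; omega) (hd0 b) fun t h1 h2 => ?_
    rcases h1.lt_or_eq with h3 | h3
    · rcases h2.lt_or_eq with h4 | h4
      · have h5 : B + b.1 < val t := by
          rcases le_total t τ with h6 | h6
          · exact hu3 b t h3 h6
          · exact hd3 b t h6 h4
        refine hI.out (hv (u a) (by have := hu1 a; omega)) (hv t (by have := hd0 b; omega)) ⟨?_, ?_⟩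
        · have := hu2 a; omega
        · omega
      · rw [h4, ← e4']; exact hv _ (hd0 a)
    · rw [← h3, ← e2']; exact hv _ (by have := hu1 a; omega)
  rw [← e2', ← e4', ← e1, ← e3] at c2
  refine ⟨_, ?_, (c1.append c2).append c3⟩
  have := hu1 b; have := hd1 b; have := hd0 a
  omega

end OneCounter

section OneCounterShort

variable {S : Type*} {R : S → ℤ → S → Prop} {I : Set ℤ}

/-- A one-counter run with close endpoints can be replaced by a short one. -/
theorem CR.short [Fintype S] [hI : I.OrdConnected] {X : ℕ}
    (hR : ∀ s δ t, R s δ t → |δ| ≤ X) {n : ℕ} {s t : S} {a b : ℤ} (h : CR R I n s a t b)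
    {A : ℕ} (hab : |a - b| ≤ A) :
    ∃ m ≤ Fintype.card S * (A + 2 * (Fintype.card S * X) ^ 2 + 1), CR R I m s a t b := by
  classical
  have hex : ∃ m, CR R I m s a t b := ⟨n, h⟩
  refine ⟨Nat.find hex, ?_, Nat.find_spec hex⟩
  have hmin : ∀ m < Nat.find hex, ¬ CR R I m s a t b := fun m hm => Nat.find_min hex hm
  have hr := Nat.find_spec hex
  generalize Nat.find hex = m at *
  obtain ⟨st, val, hf, rfl, rfl, rfl, rfl, hv⟩ := hr.exists_seq
  set H := (Fintype.card S * X) ^ 2 with hH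
  obtain ⟨hab1, hab2⟩ := abs_le.1 hab
  have hhi : ∀ i ≤ m, val i ≤ max (val 0) (val m) + H := by
    intro i hi
    by_contra hc
    obtain ⟨l', hl', hcr⟩ := hf.peak_cut hR hv (le_max_left _ _) (le_max_right _ _) hi
      (by omega)
    exact hmin l' hl' hcr
  have hlo : ∀ i ≤ m, min (val 0) (val m) - H ≤ val i := by
    intro i hi
    by_contra hc
    have hf' : FR (fun s δ t => R s (-δ) t) m st (fun i => - val i) := by
      intro j hj
      have := hf j hj
      simpa [neg_add_eq_sub] using this
    have : Set.OrdConnected {x : ℤ | -x ∈ I} := ⟨fun x hx y hy z hz =>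
      hI.out hy hx ⟨by linarith [hz.2], by linarith [hz.1]⟩⟩
    obtain ⟨l', hl', hcr⟩ := hf'.peak_cut (I := {x : ℤ | -x ∈ I}) (X := X)
      (fun s δ t h => by simpa using hR _ _ _ h) (by simpa using hv)
      (B := max (-val 0) (-val m)) (le_max_left _ _) (le_max_right _ _) hi (by
        have : max (-val 0) (-val m) = - min (val 0) (val m) := by omega
        omega)
    exact hmin l' hl' hcr.of_neg
  by_contra hc
  let F : Fin (m + 1) → S × Fin (A + 2 * H + 1) := fun i =>
    (st i, ⟨(val i - (min (val 0) (val m) - H)).toNat, by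
      have h1 := hhi i (by have := i.2; omega)
      have h2 := hlo i (by have := i.2; omega)
      omega⟩)
  obtain ⟨i, j, hij, hF⟩ : ∃ i j, i < j ∧ F i = F j := by
    obtain ⟨a, b, hne, hF⟩ := Fintype.exists_ne_map_eq_of_card_lt F (by
      simp only [Fintype.card_prod, Fintype.card_fin]; omega)
    rcases lt_or_gt_of_ne hne with h1 | h1
    · exact ⟨a, b, h1, hF⟩
    · exact ⟨b, a, h1, hF.symm⟩
  simp only [F, Prod.mk.injEq, Fin.mk.injEq] at hF
  have hij' : i.1 < j.1 := hij
  have hj := j.2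
  have e : val i = val j := by
    have h2 := hlo i (by omega)
    have h3 := hlo j (by omega)
    omega
  have c1 : CR R I (i - 0) (st 0) (val 0) (st i) (val i) :=
    hf.seg' (Nat.zero_le _) (by omega) fun t _ h2 => hv t (by omega)
  have c2 : CR R I (m - j) (st j) (val j) (st m) (val m) :=
    hf.seg' (by omega) le_rfl fun t _ h2 => hv t (by omega)
  rw [← hF.1, ← e] at c2
  exact hmin _ (by omega) (c1.append c2)

end OneCounterShort

section OneCounterStar

variable {S : Type*} {R : S → ℤ → S → Prop} {I : Set ℤ}

/-- The start of a descending run can be lowered towards a given level, modulo `g`. -/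
theorem CR.lower [Fintype S] [hI : I.OrdConnected] {X : ℕ}
    (hR : ∀ s δ t, R s δ t → |δ| ≤ X) {g : ℕ} (hg : 0 < g) {b c : ℤ} (hbc : b ≤ c) {s t : S}
    {n : ℕ} {a : ℤ} (h : CR R I n s a t b) (hca : c ≤ a) :
    ∃ a' m, (g : ℤ) ∣ a - a' ∧ c ≤ a' ∧ a' ≤ a ∧ a' ≤ c + (Fintype.card S * X * g : ℕ) ∧
      CR R I m s a' t b := by
  classical
  obtain ⟨k, hk⟩ : ∃ k : ℕ, k = (a - c).toNat := ⟨_, rfl⟩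
  induction k using Nat.strong_induction_on generalizing n a with
  | _ k IH =>
  by_cases hac : a ≤ c + (Fintype.card S * X * g : ℕ)
  · exact ⟨a, n, by simp, hca, le_rfl, hac, h⟩
  set P := Fintype.card S * X * g with hP
  obtain ⟨st, val, hf, rfl, rfl, rfl, rfl, hv⟩ := h.exists_seq
  have hdn : ∀ k : Fin (P + 1), ∃ u, 0 < u ∧ u ≤ n ∧ val u ≤ c + k.1 ∧
      ∀ t, 0 ≤ t → t < u → c + k.1 < val t := fun k =>
    exists_first_le val (Nat.zero_le _) (by have := k.2; omega) (by omega)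
  choose d hd1 hd0 hd2 hd3 using hdn
  have hod : ∀ k, (c + k.1 - val (d k)).toNat < X := fun k => by
    have h1 := hd3 k (d k - 1) (by omega) (by have := hd1 k; omega)
    have h2 := abs_le.1 (hR _ _ _ (hf (d k - 1) (by have := hd0 k; have := hd1 k; omega)))
    rw [show d k - 1 + 1 = d k by have := hd1 k; omega] at h2
    have h3 := hd2 k
    omega
  let F : Fin (P + 1) → (S × Fin X) × Fin g := fun k =>
    ((st (d k), ⟨_, hod k⟩), ⟨k.1 % g, Nat.mod_lt _ hg⟩)
  obtain ⟨i, j, hij, hF⟩ : ∃ a b, a < b ∧ F a = F b := by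
    obtain ⟨a, b, hne, hF⟩ := Fintype.exists_ne_map_eq_of_card_lt F (by
      simp only [Fintype.card_prod, Fintype.card_fin]; omega)
    rcases lt_or_gt_of_ne hne with h1 | h1
    · exact ⟨a, b, h1, hF⟩
    · exact ⟨b, a, h1, hF.symm⟩
  simp only [F, Prod.mk.injEq, Fin.mk.injEq] at hF
  obtain ⟨⟨e1, e2⟩, e3⟩ := hF
  have hij' : i.1 < j.1 := hij
  have hj := j.2
  have e2' : val (d i) = val (d j) + (i.1 - j.1 : ℤ) := by
    have := hd2 i; have := hd2 j; omega
  have hm0 := hv 0 (Nat.zero_le _)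
  have hmn := hv n le_rfl
  have c1 : CR R I (d j - 0) (st 0) (val 0 + (i.1 - j.1 : ℤ)) (st (d j))
      (val (d j) + (i.1 - j.1 : ℤ)) := by
    refine hf.seg _ (Nat.zero_le _) (hd0 j) fun t _ h2 => ?_
    rcases h2.lt_or_eq with h4 | h4
    · have h5 := hd3 j t (Nat.zero_le _) h4
      exact hI.out hmn (hv t (by have := hd0 j; omega)) ⟨by omega, by omega⟩
    · rw [h4, ← e2']; exact hv _ (hd0 i)
  have c2 : CR R I (n - d i) (st (d i)) (val (d i)) (st n) (val n) :=
    hf.seg' (hd0 i) le_rfl fun t _ h2 => hv t h2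
  rw [← e2', ← e1] at c1
  have hle : c ≤ val 0 + (i.1 - j.1 : ℤ) := by omega
  obtain ⟨a', m, h1, h2, h3, h4, h5⟩ := IH _ (by omega) (c1.append c2) hle rfl
  refine ⟨a', m, ?_, h2, by omega, h4, h5⟩
  have h6 : (g : ℤ) ∣ (j.1 : ℤ) - i.1 := (Nat.modEq_iff_dvd).1 e3
  have := dvd_add h1 h6
  rwa [show val 0 + ((i.1 : ℤ) - j.1) - a' + (j.1 - i.1) = val 0 - a' by ring] at this

theorem ordConnected_neg {I : Set ℤ} (hI : I.OrdConnected) : {x : ℤ | -x ∈ I}.OrdConnected :=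
  ⟨fun _ hx _ hy z hz => hI.out hy hx ⟨by linarith [hz.2], by linarith [hz.1]⟩⟩

/-- The start of an ascending run can be raised towards a given level, modulo `g`. -/
theorem CR.raise [Fintype S] [hI : I.OrdConnected] {X : ℕ}
    (hR : ∀ s δ t, R s δ t → |δ| ≤ X) {g : ℕ} (hg : 0 < g) {b c : ℤ} (hcb : c ≤ b) {s t : S}
    {n : ℕ} {a : ℤ} (h : CR R I n s a t b) (hac : a ≤ c) :
    ∃ a' m, (g : ℤ) ∣ a' - a ∧ a' ≤ c ∧ a ≤ a' ∧ c ≤ a' + (Fintype.card S * X * g : ℕ) ∧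
      CR R I m s a' t b := by
  have := ordConnected_neg hI
  obtain ⟨a', m, h1, h2, h3, h4, h5⟩ := h.neg.lower (X := X)
    (fun s δ t h => by simpa using hR _ _ _ h) hg (neg_le_neg hcb) (neg_le_neg hac)
  refine ⟨-a', m, ?_, by omega, by omega, by omega, CR.of_neg (by simpa using h5)⟩
  rwa [show -a' - a = -a - a' by ring]

/-- An ascending run in a half-line can be replaced by one with a single short iterated cycle. -/
theorem CR.oneStar_up [Fintype S] [hI : I.OrdConnected] {X : ℕ}
    (hR : ∀ s δ t, R s δ t → |δ| ≤ X) {n : ℕ} {s t : S} {a b : ℤ} (h : CR R I n s a t b)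
    (hab : a ≤ b) {N : ℕ} (hN : N = Fintype.card S *
      (Fintype.card S * X * (Fintype.card S * X) + 2 * (Fintype.card S * X) + X +
        2 * (Fintype.card S * X) ^ 2 + 1)) :
    ∃ (r : S) (v : ℤ) (g k m₁ m₂ m₃ : ℕ), m₁ ≤ N ∧ m₂ ≤ N ∧ m₃ ≤ N ∧ CR R I m₁ s a r v ∧
      CR R I m₂ r v r (v + g) ∧ CR R I m₃ r (v + k * g) t b := by
  classical
  set P := Fintype.card S * X with hP
  obtain ⟨PP, hPP⟩ : ∃ PP, PP = P * P := ⟨_, rfl⟩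
  rw [← hPP] at hN
  have key : ∀ {n' : ℕ} {s' t' : S} {a' b' : ℤ}, CR R I n' s' a' t' b' →
      a' - b' ≤ (PP + 2 * P + X : ℕ) → b' - a' ≤ (PP + 2 * P + X : ℕ) →
      ∃ m ≤ N, CR R I m s' a' t' b' := by
    intro n' s' t' a' b' h' hA hB
    obtain ⟨m, hm, hcr⟩ := h'.short hR (abs_le.2 ⟨by omega, hA⟩)
    exact ⟨m, hm.trans (by rw [hN]), hcr⟩
  have ha := h.left_mem
  by_cases hc : b ≤ a + P
  · obtain ⟨m, hm, hcr⟩ := key h (by omega) (by omega)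
    exact ⟨s, a, 0, 0, 0, 0, m, by omega, by omega, hm, .nil ha, by simpa using .nil ha,
      by simpa using hcr⟩
  obtain ⟨st, val, hf, rfl, rfl, rfl, rfl, hv⟩ := h.exists_seq
  have hup : ∀ k : Fin (P + 1), ∃ u, 0 ≤ u ∧ u < n ∧ val u ≤ val 0 + k.1 ∧
      ∀ t, u < t → t ≤ n → val 0 + k.1 < val t := fun k =>
    exists_last_le val (Nat.zero_le _) (by omega) (by have := k.2; omega)
  choose u _ hu1 hu2 hu3 using hup
  have hou : ∀ k, (val 0 + k.1 - val (u k)).toNat < X := fun k => by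
    have h1 := hu3 k (u k + 1) (by omega) (hu1 k)
    have h2 := abs_le.1 (hR _ _ _ (hf (u k) (by have := hu1 k; omega)))
    have h3 := hu2 k
    omega
  let F : Fin (P + 1) → S × Fin X := fun k => (st (u k), ⟨_, hou k⟩)
  obtain ⟨i, j, hij, hF⟩ : ∃ a b, a < b ∧ F a = F b := by
    obtain ⟨a, b, hne, hF⟩ := Fintype.exists_ne_map_eq_of_card_lt F (by
      simp only [Fintype.card_prod, Fintype.card_fin]; omega)
    rcases lt_or_gt_of_ne hne with h1 | h1
    · exact ⟨a, b, h1, hF⟩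
    · exact ⟨b, a, h1, hF.symm⟩
  simp only [F, Prod.mk.injEq, Fin.mk.injEq] at hF
  obtain ⟨e1, e2⟩ := hF
  have hij' : i.1 < j.1 := hij
  have hj := j.2
  have hoi := hou i
  have e2' : val (u j) = val (u i) + (j.1 - i.1 : ℕ) := by
    have := hu2 i; have := hu2 j; omega
  have hlt : u i < u j := by
    by_contra hc
    rcases (not_lt.1 hc).lt_or_eq with h1 | h1
    · have := hu3 j (u i) h1 (hu1 i).le
      have := hu2 i; omega
    · rw [h1] at e2'; omega
  have hi2 := hu2 i
  have hi1 := hu1 i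
  have hj1 := hu1 j
  obtain ⟨m₁, hm₁, c1⟩ := key (hf.seg' (I := I) (Nat.zero_le (u i)) hi1.le
    fun t _ h2 => hv t (by omega)) (by omega) (by omega)
  obtain ⟨m₂, hm₂, c2⟩ := key (hf.seg' (I := I) hlt.le hj1.le
    fun t _ h2 => hv t (by omega)) (by omega) (by omega)
  rw [← e1, e2'] at c2
  obtain ⟨a', m, h1, h2, h3, h4, h5⟩ := (hf.seg' (I := I) hi1.le le_rfl
    fun t _ h2 => hv t (by omega)).raise hR (g := j.1 - i.1) (by omega) (le_refl (val n))
    (by omega)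
  have h6 : Fintype.card S * X * (j.1 - i.1) ≤ PP := by
    rw [hPP]; exact Nat.mul_le_mul_left _ (by omega)
  obtain ⟨m₃, hm₃, c3⟩ := key h5 (by omega) (by omega)
  obtain ⟨k, hk⟩ := h1
  have hk0 : 0 ≤ k := by
    by_contra hneg
    have : (0 : ℤ) < (j.1 - i.1 : ℕ) := by omega
    nlinarith
  refine ⟨st (u i), val (u i), j.1 - i.1, k.toNat, m₁, m₂, m₃, hm₁, hm₂, hm₃, c1, c2, ?_⟩
  have : val (u i) + (k.toNat : ℤ) * (j.1 - i.1 : ℕ) = a' := by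
    rw [Int.toNat_of_nonneg hk0]; linarith
  rwa [this]

theorem CR.oneStar_down [Fintype S] [hI : I.OrdConnected] {X : ℕ}

    (hR : ∀ s δ t, R s δ t → |δ| ≤ X) {n : ℕ} {s t : S} {a b : ℤ} (h : CR R I n s a t b)
    (hab : b ≤ a) {N : ℕ} (hN : N = Fintype.card S *
      (Fintype.card S * X * (Fintype.card S * X) + 2 * (Fintype.card S * X) + X +
        2 * (Fintype.card S * X) ^ 2 + 1)) :
    ∃ (r : S) (v : ℤ) (g k m₁ m₂ m₃ : ℕ), m₁ ≤ N ∧ m₂ ≤ N ∧ m₃ ≤ N ∧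
      CR R I m₃ s a r (v + k * g) ∧ CR R I m₂ r (v + g) r v ∧ CR R I m₁ r v t b := by
  obtain ⟨r, v, g, k, m₁, m₂, m₃, h1, h2, h3, h4, h5, h6⟩ := h.rev.oneStar_up (X := X)
    (fun s δ t h => by simpa using hR _ _ _ h) hab hN
  exact ⟨r, v, g, k, m₁, m₂, m₃, h1, h2, h3, h6.of_rev, h5.of_rev, h4.of_rev⟩

end OneCounterStar

section Compositional

variable {C : Type*}

/-- A relation between configurations indexed by a cost bound, closed under composition. -/
structure Comp (W : C → ℕ → C → Prop) : Prop where
  nil : ∀ a, W a 0 a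
  trans : ∀ {a b c m n}, W a m b → W b n c → W a (m + n) c
  mono : ∀ {a b m n}, W a m b → m ≤ n → W a n b

variable {W : C → ℕ → C → Prop}

theorem reflTransGen_last_leave {E : C → C → Prop} {a b : C} (h : Relation.ReflTransGen E a b) :
    a = b ∨ ∃ c, c ≠ a ∧ E a c ∧ Relation.ReflTransGen (fun x y => E x y ∧ y ≠ a) c b := by
  induction h with
  | refl => exact .inl rfl
  | @tail b b' _ hbb ih =>
    by_cases hb : b' = a
    · exact .inl hb.symm
    · rcases ih with rfl | ⟨c, h1, h2, h3⟩
      · exact .inr ⟨b', hb, hbb, .refl⟩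
      · exact .inr ⟨c, h1, h2, h3.tail ⟨hbb, hb⟩⟩

/-- Paths in a finite graph whose edges have bounded cost have bounded cost. -/
theorem Comp.fin (hW : Comp W) {P : ℕ} (N : Finset C) {E : C → C → Prop}
    (hE : ∀ a b, E a b → b ∈ N ∧ W a P b) {a b : C} (ha : a ∈ N)
    (h : Relation.ReflTransGen E a b) : W a (N.card * P) b := by
  classical
  obtain ⟨k, hk⟩ : ∃ k, k = N.card := ⟨_, rfl⟩
  induction k generalizing N E a with
  | zero => simp [Finset.card_eq_zero.1 hk.symm] at ha
  | succ k ih =>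
    rcases reflTransGen_last_leave h with rfl | ⟨c, h1, h2, h3⟩
    · exact hW.mono (hW.nil _) (Nat.zero_le _)
    · have hc := hE _ _ h2
      have hcard : (N.erase a).card = k := by rw [Finset.card_erase_of_mem ha]; omega
      have := ih (N.erase a) (E := fun x y => E x y ∧ y ≠ a)
        (fun x y hxy => ⟨Finset.mem_erase.2 ⟨hxy.2, (hE _ _ hxy.1).1⟩, (hE _ _ hxy.1).2⟩)
        (Finset.mem_erase.2 ⟨h1, hc.1⟩) h3 hcard.symm
      refine hW.mono (hW.trans hc.2 this) ?_
      rw [hcard, ← hk]; ring_nf; exact le_rfl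

/-- A run between near configurations is composed of excursions between near configurations. -/
theorem Comp.excursions (hW : Comp W) {P : ℕ} (N : Finset C) {near : C → Prop} {c : ℕ → C} {l : ℕ}
    (hN : ∀ i ≤ l, near (c i) → c i ∈ N)
    (hE : ∀ i j, i < j → j ≤ l → near (c i) → near (c j) →
      (∀ t, i < t → t < j → ¬ near (c t)) → W (c i) P (c j))
    (h0 : near (c 0)) (hl : near (c l)) : W (c 0) (N.card * P) (c l) := by
  classical
  let E : C → C → Prop := fun a b => b ∈ N ∧ W a P b
  refine hW.fin N (E := E) (fun a b h => h) (hN 0 (Nat.zero_le _) h0) ?_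
  suffices h : ∀ j ≤ l, near (c j) → Relation.ReflTransGen E (c 0) (c j) from h l le_rfl hl
  intro j
  induction j using Nat.strong_induction_on with
  | _ j ih =>
  intro hj hn
  rcases Nat.eq_zero_or_pos j with rfl | hpos
  · exact .refl
  have hex : ∃ k, k < j ∧ near (c (j - 1 - k)) := ⟨j - 1, by omega, by simpa using h0⟩
  have hs := Nat.find_spec hex
  refine (ih (j - 1 - Nat.find hex) (by omega) (by omega) hs.2).tail ⟨hN j hj hn, ?_⟩
  refine hE _ _ (by omega) hj hs.2 hn fun t h1 h2 h3 => ?_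
  refine Nat.find_min hex (m := j - 1 - t) (by omega) ⟨by omega, ?_⟩
  rwa [show j - 1 - (j - 1 - t) = t by omega]

theorem CR.cost {S : Type*} {R : S → ℤ → S → Prop} {I : Set ℤ} (hW : Comp W) {P : ℕ}
    {enc : S → ℤ → C} (hR : ∀ s δ t v, R s δ t → v ∈ I → v + δ ∈ I → W (enc s v) P (enc t (v + δ)))
    {n : ℕ} {s t : S} {a b : ℤ} (h : CR R I n s a t b) : W (enc s a) (n * P) (enc t b) := by
  induction h with
  | nil _ => exact hW.mono (hW.nil _) (Nat.zero_le _)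
  | cons hv hr hc ih =>
    exact hW.mono (hW.trans (hR _ _ _ _ hr hv hc.left_mem) ih) (by ring_nf; exact le_rfl)

end Compositional

section PolyBound

/-- Polynomially bounded functions. -/
@[fun_prop]
def PB (F : ℕ → ℕ) : Prop := ∃ C, ∀ X, 2 ≤ X → F X ≤ X ^ C

@[fun_prop]
theorem PB.const (c : ℕ) : PB fun _ => c :=
  ⟨c, fun _ hX => (Nat.lt_two_pow_self (n := c)).le.trans (Nat.pow_le_pow_left hX c)⟩

@[fun_prop]
theorem PB.id : PB fun X => X := ⟨1, fun X _ => by simp⟩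

@[fun_prop]
theorem PB.add {F G : ℕ → ℕ} (hF : PB F) (hG : PB G) : PB fun X => F X + G X := by
  obtain ⟨C, hC⟩ := hF
  obtain ⟨D, hD⟩ := hG
  refine ⟨max C D + 1, fun X hX => ?_⟩
  have h1 := (hC X hX).trans (Nat.pow_le_pow_right (by omega) (le_max_left C D))
  have h2 := (hD X hX).trans (Nat.pow_le_pow_right (by omega) (le_max_right C D))
  rw [pow_succ]
  nlinarith

@[fun_prop]
theorem PB.mul {F G : ℕ → ℕ} (hF : PB F) (hG : PB G) : PB fun X => F X * G X := by
  obtain ⟨C, hC⟩ := hF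
  obtain ⟨D, hD⟩ := hG
  exact ⟨C + D, fun X hX => by rw [pow_add]; exact Nat.mul_le_mul (hC X hX) (hD X hX)⟩

@[fun_prop]
theorem PB.pow {F : ℕ → ℕ} (hF : PB F) (k : ℕ) : PB fun X => F X ^ k := by
  obtain ⟨C, hC⟩ := hF
  exact ⟨C * k, fun X hX => by rw [pow_mul]; exact Nat.pow_le_pow_left (hC X hX) k⟩

@[fun_prop]
theorem PB.comp {F G : ℕ → ℕ} (hF : PB F) (hG : PB G) : PB fun X => F (G X) := by
  obtain ⟨C, hC⟩ := hF
  obtain ⟨D, hD⟩ := hG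
  obtain ⟨K, hK⟩ := PB.const (max (F 0) (F 1))
  refine ⟨max K (D * C), fun X hX => ?_⟩
  by_cases h : 2 ≤ G X
  · refine (hC _ h).trans ((Nat.pow_le_pow_left (hD X hX) C).trans ?_)
    rw [← pow_mul]
    exact Nat.pow_le_pow_right (by omega) (le_max_right _ _)
  · refine le_trans ?_ ((hK X hX).trans (Nat.pow_le_pow_right (by omega) (le_max_left _ _)))
    rcases (by omega : G X = 0 ∨ G X = 1) with h | h <;> simp [h]

end PolyBound

section Words

variable {E : Type}

/-- Sum of a weight over a word. -/
def sm (f : E → ℤ) (l : List E) : ℤ := (l.map f).sum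

@[simp] theorem sm_nil (f : E → ℤ) : sm f [] = 0 := rfl
@[simp] theorem sm_cons (f : E → ℤ) (e : E) (l : List E) : sm f (e :: l) = f e + sm f l := by
  simp [sm]
@[simp] theorem sm_append (f : E → ℤ) (l l' : List E) : sm f (l ++ l') = sm f l + sm f l' := by
  simp [sm]
@[simp] theorem sm_reverse (f : E → ℤ) (l : List E) : sm f l.reverse = sm f l := by
  simp [sm]
@[simp] theorem sm_neg (f : E → ℤ) (l : List E) : sm (fun e => -f e) l = - sm f l := by
  induction l with
  | nil => rfl
  | cons e l ih => simp [ih]; ring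

theorem pw_zero (l : List E) : pw l 0 = [] := rfl
theorem pw_succ (l : List E) (n : ℕ) : pw l (n + 1) = l ++ pw l n := by
  simp [pw, List.replicate_succ]
@[simp] theorem pw_one (l : List E) : pw l 1 = l := by simp [pw]
theorem pw_succ' (l : List E) (n : ℕ) : pw l (n + 1) = pw l n ++ l := by
  simp [pw, List.replicate_succ']
@[simp] theorem sm_pw (f : E → ℤ) (l : List E) (n : ℕ) : sm f (pw l n) = n * sm f l := by
  induction n with
  | zero => simp [pw_zero]
  | succ n ih => rw [pw_succ, sm_append, ih]; push_cast; ring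

theorem pw_reverse (l : List E) (n : ℕ) : (pw l n).reverse = pw l.reverse n := by
  induction n with
  | zero => rfl
  | succ n ih => rw [pw_succ, List.reverse_append, ih, pw_succ']

theorem abs_sm_le {f : E → ℤ} {X : ℕ} {l : List E} (h : ∀ e ∈ l, |f e| ≤ X) :
    |sm f l| ≤ l.length * X := by
  induction l with
  | nil => simp
  | cons e l ih =>
    simp only [sm_cons, List.length_cons]
    have h1 := ih fun e he => h e (List.mem_cons_of_mem _ he)
    have h2 := h e List.mem_cons_self
    have h3 := abs_add_le (f e) (sm f l)
    push_cast; linarith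

/-- All counter values after a step of the word are nonnegative. -/
def Nn (f : E → ℤ) : ℤ → List E → Prop
  | _, [] => True
  | v, e :: l => 0 ≤ v + f e ∧ Nn f (v + f e) l

@[simp] theorem Nn_nil (f : E → ℤ) (v : ℤ) : Nn f v [] := trivial
@[simp] theorem Nn_cons (f : E → ℤ) (v : ℤ) (e : E) (l : List E) :
    Nn f v (e :: l) ↔ 0 ≤ v + f e ∧ Nn f (v + f e) l := Iff.rfl

@[simp] theorem Nn_append (f : E → ℤ) (v : ℤ) (l l' : List E) :
    Nn f v (l ++ l') ↔ Nn f v l ∧ Nn f (v + sm f l) l' := by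
  induction l generalizing v with
  | nil => simp
  | cons e l ih => simp [ih, and_assoc, add_assoc]

theorem Nn.mono {f : E → ℤ} {v v' : ℤ} {l : List E} (h : Nn f v l) (hv : v ≤ v') : Nn f v' l := by
  induction l generalizing v v' with
  | nil => trivial
  | cons e l ih => exact ⟨by have := h.1; omega, ih h.2 (by omega)⟩

theorem Nn.right {f : E → ℤ} {v : ℤ} {l : List E} (h : Nn f v l) (hv : 0 ≤ v) :
    0 ≤ v + sm f l := by
  induction l generalizing v with
  | nil => simpa
  | cons e l ih => have := ih h.2 h.1; simp only [sm_cons]; linarith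

theorem Nn_of_len {f : E → ℤ} {X : ℕ} {l : List E} (h : ∀ e ∈ l, |f e| ≤ X) {v : ℤ}
    (hv : (l.length * X : ℕ) ≤ v) : Nn f v l := by
  induction l generalizing v with
  | nil => trivial
  | cons e l ih =>
    have h1 := abs_le.1 (h e List.mem_cons_self)
    simp only [List.length_cons] at hv
    push_cast at hv
    refine ⟨?_, ih (fun e he => h e (List.mem_cons_of_mem _ he)) ?_⟩
    · have : (0 : ℤ) ≤ l.length * X := by positivity
      linarith
    · push_cast; linarith

theorem Nn_pw {f : E → ℤ} {v : ℤ} {l : List E} {n : ℕ}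
    (h : 0 < n → Nn f v l ∧ Nn f (v + (n - 1 : ℤ) * sm f l) l) : Nn f v (pw l n) := by
  induction n generalizing v with
  | zero => trivial
  | succ n ih =>
    rw [pw_succ, Nn_append]
    obtain ⟨h1, h2⟩ := h (Nat.succ_pos _)
    refine ⟨h1, ih fun hn => ?_⟩
    have hn' : (1 : ℤ) ≤ n := by exact_mod_cast hn
    push_cast at h2
    constructor
    · rcases le_total 0 (sm f l) with h3 | h3
      · exact h1.mono (by linarith)
      · exact h2.mono (by nlinarith)
    · convert h2 using 1; ring

theorem Nn_reverse {f : E → ℤ} {v : ℤ} {l : List E} (h : Nn f v l) (hv : 0 ≤ v) :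
    Nn (fun e => -f e) (v + sm f l) l.reverse := by
  induction l generalizing v with
  | nil => trivial
  | cons e l ih =>
    have := ih h.2 h.1
    simp only [List.reverse_cons, Nn_append, sm_reverse, sm_cons, sm_neg, Nn_cons, Nn_nil,
      and_true]
    constructor
    · rwa [← add_assoc]
    · linarith

end Words

section Systems

/-- Configurations with integer counters. -/
abbrev Cfg (Q : Type) := Q × ℤ × ℤ

/-- A two-counter system without zero-tests, with edges in `T` and counter weights `f`, `g`. -/
structure Sys (Q E : Type) where
  src : E → Q
  tgt : E → Q
  T : Set E
  f : E → ℤ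
  g : E → ℤ

variable {Q E : Type}

/-- The reversed system. -/
def Sys.rev (A : Sys Q E) : Sys Q E := ⟨A.tgt, A.src, A.T, fun e => -A.f e, fun e => -A.g e⟩

/-- The system with exchanged counters. -/
def Sys.swap (A : Sys Q E) : Sys Q E := ⟨A.src, A.tgt, A.T, A.g, A.f⟩

variable {A : Sys Q E}

def Sys.Walk (A : Sys Q E) : Q → List E → Q → Prop
  | p, [], q => p = q
  | p, e :: l, q => e ∈ A.T ∧ A.src e = p ∧ A.Walk (A.tgt e) l q

@[simp] theorem Sys.walk_nil (p q : Q) : A.Walk p [] q ↔ p = q := Iff.rfl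
@[simp] theorem Sys.walk_cons (p q : Q) (e : E) (l : List E) :
    A.Walk p (e :: l) q ↔ e ∈ A.T ∧ A.src e = p ∧ A.Walk (A.tgt e) l q := Iff.rfl

theorem Sys.walk_append {p q : Q} {l l' : List E} :
    A.Walk p (l ++ l') q ↔ ∃ r, A.Walk p l r ∧ A.Walk r l' q := by
  induction l generalizing p with
  | nil => simp
  | cons e l ih => simp [ih, and_assoc]

theorem Sys.Walk.append {p q r : Q} {l l' : List E} (h : A.Walk p l r) (h' : A.Walk r l' q) :
    A.Walk p (l ++ l') q := Sys.walk_append.2 ⟨r, h, h'⟩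

theorem Sys.Walk.mem {p q : Q} {l : List E} (h : A.Walk p l q) : ∀ e ∈ l, e ∈ A.T := by
  induction l generalizing p with
  | nil => simp
  | cons e l ih => simpa using ⟨h.1, ih h.2.2⟩

theorem Sys.Walk.right_unique {p q q' : Q} {l : List E} (h : A.Walk p l q) (h' : A.Walk p l q') :
    q = q' := by
  induction l generalizing p with
  | nil => exact h.symm.trans h'
  | cons e l ih => exact ih h.2.2 h'.2.2

theorem Sys.Walk.pw {p : Q} {l : List E} (h : A.Walk p l p) (n : ℕ) : A.Walk p (pw l n) p := by
  induction n with
  | zero => rfl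
  | succ n ih => rw [pw_succ]; exact h.append ih

theorem Sys.Walk.reverse {p q : Q} {l : List E} (h : A.Walk p l q) :
    A.rev.Walk q l.reverse p := by
  induction l generalizing p with
  | nil => exact h.symm
  | cons e l ih =>
    rw [List.reverse_cons]
    exact (ih h.2.2).append ⟨h.1, rfl, h.2.1⟩

theorem Sys.walk_swap {p q : Q} {l : List E} : A.swap.Walk p l q ↔ A.Walk p l q := by
  induction l generalizing p with
  | nil => rfl
  | cons e l ih => simp [ih]; rfl

/-- `l` is a run from `c` to `c'`. -/
def Sys.Run (A : Sys Q E) (c : Cfg Q) (l : List E) (c' : Cfg Q) : Prop :=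
  A.Walk c.1 l c'.1 ∧ Nn A.f c.2.1 l ∧ Nn A.g c.2.2 l ∧ c'.2.1 = c.2.1 + sm A.f l ∧
    c'.2.2 = c.2.2 + sm A.g l

theorem Sys.Run.append {a b c : Cfg Q} {l l' : List E} (h : A.Run a l b) (h' : A.Run b l' c) :
    A.Run a (l ++ l') c := by
  obtain ⟨h1, h2, h3, h4, h5⟩ := h
  obtain ⟨k1, k2, k3, k4, k5⟩ := h'
  rw [h4] at k2
  rw [h5] at k3
  exact ⟨h1.append k1, by simp [h2, k2], by simp [h3, k3], by simp [k4, h4, add_assoc],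
    by simp [k5, h5, add_assoc]⟩

theorem Sys.run_nil (a : Cfg Q) : A.Run a [] a := ⟨rfl, trivial, trivial, by simp, by simp⟩

/-- Nonnegative configurations. -/
def Pos (c : Cfg Q) : Prop := 0 ≤ c.2.1 ∧ 0 ≤ c.2.2

theorem Sys.Run.pos {a b : Cfg Q} {l : List E} (h : A.Run a l b) (ha : Pos a) : Pos b :=
  ⟨by rw [h.2.2.2.1]; exact h.2.1.right ha.1, by rw [h.2.2.2.2]; exact h.2.2.1.right ha.2⟩

theorem Sys.Run.reverse {a b : Cfg Q} {l : List E} (h : A.Run a l b) (ha : Pos a) :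
    A.rev.Run b l.reverse a := by
  obtain ⟨h1, h2, h3, h4, h5⟩ := h
  refine ⟨h1.reverse, ?_, ?_, ?_, ?_⟩
  · rw [h4]; exact Nn_reverse h2 ha.1
  · rw [h5]; exact Nn_reverse h3 ha.2
  · simp [Sys.rev, h4]
  · simp [Sys.rev, h5]

/-- Exchange the counters of a configuration. -/
def sw (c : Cfg Q) : Cfg Q := (c.1, c.2.2, c.2.1)

theorem Sys.run_swap {a b : Cfg Q} {l : List E} : A.swap.Run (sw a) l (sw b) ↔ A.Run a l b := by
  simp only [Sys.Run, Sys.walk_swap, sw]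
  constructor <;> rintro ⟨h1, h2, h3, h4, h5⟩ <;> exact ⟨h1, h3, h2, h5, h4⟩

/-- There is a run of bounded length. -/
def Sys.SF (A : Sys Q E) (c : Cfg Q) (m : ℕ) (c' : Cfg Q) : Prop :=
  ∃ l, l.length ≤ m ∧ A.Run c l c'

theorem Sys.SF.comp : Comp A.SF where
  nil a := ⟨[], le_rfl, Sys.run_nil a⟩
  trans := fun ⟨l, h1, h2⟩ ⟨l', h3, h4⟩ => ⟨l ++ l', by simp; omega, h2.append h4⟩
  mono := fun ⟨l, h1, h2⟩ h => ⟨l, h1.trans h, h2⟩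

theorem Sys.SF.swap {a b : Cfg Q} {m : ℕ} (h : A.swap.SF (sw a) m (sw b)) : A.SF a m b :=
  let ⟨l, h1, h2⟩ := h; ⟨l, h1, Sys.run_swap.1 h2⟩

/-- The word of a list of powers. -/
def flat (bs : List (List E × ℕ)) : List E := bs.flatMap fun b => pw b.1 b.2

/-- Every block is a single word or a power of a cycle. -/
def Sys.Blk (A : Sys Q E) (bs : List (List E × ℕ)) : Prop :=
  ∀ b ∈ bs, b.2 = 1 ∨ ∃ s, A.Walk s b.1 s

/-- Total length of the words of the blocks. -/
def bsz (bs : List (List E × ℕ)) : ℕ := (bs.map fun b => b.1.length).sum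

/-- There is a run along at most `k` blocks of total length at most `N`. -/
def Sys.LP (A : Sys Q E) (k : ℕ) (c : Cfg Q) (N : ℕ) (c' : Cfg Q) : Prop :=
  ∃ bs, A.Blk bs ∧ bs.length ≤ k ∧ bsz bs ≤ N ∧ A.Run c (flat bs) c'

theorem Sys.LP.trans {k k' m n : ℕ} {a b c : Cfg Q} (h : A.LP k a m b) (h' : A.LP k' b n c) :
    A.LP (k + k') a (m + n) c := by
  obtain ⟨bs, h1, h2, h3, h4⟩ := h
  obtain ⟨bs', k1, k2, k3, k4⟩ := h'
  refine ⟨bs ++ bs', ?_, by simp; omega, by simp [bsz] at *; omega, ?_⟩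
  · intro b hb
    rcases List.mem_append.1 hb with hb | hb
    · exact h1 b hb
    · exact k1 b hb
  · simpa [flat] using h4.append k4

theorem Sys.LP.mono {k k' m n : ℕ} {a b : Cfg Q} (h : A.LP k a m b) (hk : k ≤ k') (hm : m ≤ n) :
    A.LP k' a n b :=
  let ⟨bs, h1, h2, h3, h4⟩ := h; ⟨bs, h1, h2.trans hk, h3.trans hm, h4⟩

theorem Sys.SF.lp {m : ℕ} {a b : Cfg Q} (h : A.SF a m b) : A.LP 1 a m b := by
  obtain ⟨l, h1, h2⟩ := h
  exact ⟨[(l, 1)], by simp [Sys.Blk], by simp, by simpa [bsz] using h1, by simpa [flat] using h2⟩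

theorem Sys.LP.nil (a : Cfg Q) : A.LP 0 a 0 a :=
  ⟨[], by simp [Sys.Blk], by simp, by simp [bsz], Sys.run_nil a⟩

theorem Sys.lp_pw {a b : Cfg Q} {l : List E} {n : ℕ} (hl : A.Walk a.1 l a.1)
    (h : A.Run a (pw l n) b) : A.LP 1 a l.length b :=
  ⟨[(l, n)], by simpa [Sys.Blk] using .inr ⟨_, hl⟩, by simp, by simp [bsz], by simpa [flat] using h⟩

theorem Sys.LP.swap {k m : ℕ} {a b : Cfg Q} (h : A.swap.LP k (sw a) m (sw b)) : A.LP k a m b := by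
  obtain ⟨bs, h1, h2, h3, h4⟩ := h
  refine ⟨bs, fun b hb => (h1 b hb).imp id fun ⟨s, hs⟩ => ⟨s, Sys.walk_swap.1 hs⟩, h2, h3,
    Sys.run_swap.1 h4⟩

theorem flat_reverse (bs : List (List E × ℕ)) :
    (flat bs).reverse = flat (bs.map fun b => (b.1.reverse, b.2)).reverse := by
  induction bs with
  | nil => rfl
  | cons b bs ih =>
    simp only [flat, List.flatMap_cons, List.reverse_append, List.map_cons, List.reverse_cons,
      List.flatMap_append, List.flatMap_nil, List.append_nil] at *
    rw [ih, pw_reverse]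

/-- A single step, ignoring the sign of the counters. -/
def Sys.Step (A : Sys Q E) (c c' : Cfg Q) : Prop :=
  ∃ e ∈ A.T, A.src e = c.1 ∧ A.tgt e = c'.1 ∧ c'.2.1 = c.2.1 + A.f e ∧ c'.2.2 = c.2.2 + A.g e

/-- A run presented as a sequence of configurations. -/
def Sys.Seq (A : Sys Q E) (l : ℕ) (c : ℕ → Cfg Q) : Prop :=
  (∀ i < l, A.Step (c i) (c (i + 1))) ∧ ∀ i ≤ l, Pos (c i)

theorem Sys.Seq.sub {l : ℕ} {c : ℕ → Cfg Q} (h : A.Seq l c) {i j : ℕ} (hj : i + j ≤ l) :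
    A.Seq j fun t => c (i + t) :=
  ⟨fun t ht => h.1 (i + t) (by omega), fun t ht => h.2 (i + t) (by omega)⟩

theorem Sys.Seq.swap {l : ℕ} {c : ℕ → Cfg Q} (h : A.Seq l c) : A.swap.Seq l fun t => sw (c t) :=
  ⟨fun t ht => let ⟨e, h1, h2, h3, h4, h5⟩ := h.1 t ht; ⟨e, h1, h2, h3, h5, h4⟩,
    fun t ht => ⟨(h.2 t ht).2, (h.2 t ht).1⟩⟩

theorem Sys.Step.sf {a b : Cfg Q} (h : A.Step a b) (hb : Pos b) : A.SF a 1 b := by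
  obtain ⟨e, h1, h2, h3, h4, h5⟩ := h
  exact ⟨[e], le_rfl, ⟨h1, h2, h3⟩, ⟨h4 ▸ hb.1, trivial⟩, ⟨h5 ▸ hb.2, trivial⟩, by simpa, by simpa⟩

theorem Sys.Seq.sf {l : ℕ} {c : ℕ → Cfg Q} (h : A.Seq l c) : A.SF (c 0) l (c l) := by
  induction l with
  | zero => exact Sys.SF.comp.nil _
  | succ l ih =>
    exact Sys.SF.comp.trans (ih ⟨fun i hi => h.1 i (by omega), fun i hi => h.2 i (by omega)⟩)
      ((h.1 l (by omega)).sf (h.2 _ le_rfl))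

theorem Sys.Run.exists_seq {l : List E} {a b : Cfg Q} (h : A.Run a l b) (ha : Pos a) :
    ∃ c, A.Seq l.length c ∧ c 0 = a ∧ c l.length = b := by
  induction l generalizing a with
  | nil =>
    obtain ⟨h1, _, _, h4, h5⟩ := h
    have : a = b := Prod.ext h1 (Prod.ext (by simpa using h4.symm) (by simpa using h5.symm))
    exact ⟨fun _ => a, ⟨by simp, fun _ _ => ha⟩, rfl, this⟩
  | cons e l ih =>
    obtain ⟨⟨h1, h1', h1''⟩, h2, h3, h4, h5⟩ := h
    obtain ⟨c, hc, hc0, hcl⟩ := ih (a := (A.tgt e, a.2.1 + A.f e, a.2.2 + A.g e))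
      ⟨h1'', h2.2, h3.2, by simp [h4, add_assoc], by simp [h5, add_assoc]⟩ ⟨h2.1, h3.1⟩
    refine ⟨fun i => i.casesOn a c, ⟨?_, ?_⟩, rfl, hcl⟩
    · intro i hi
      cases i with
      | zero => exact ⟨e, h1, h1', by simp [hc0], by simp [hc0], by simp [hc0]⟩
      | succ i => exact hc.1 i (by simpa using hi)
    · intro i hi
      cases i with
      | zero => exact ha
      | succ i => exact hc.2 i (by simpa using hi)

end Systems

section Belts

variable {Q E : Type}

/-- Bounds on the number of states and the weights of a system. -/
structure Sys.Bdd [Fintype Q] (A : Sys Q E) (X : ℕ) : Prop where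
  two : 2 ≤ X
  card : Fintype.card Q ≤ X
  f : ∀ e ∈ A.T, |A.f e| ≤ X
  g : ∀ e ∈ A.T, |A.g e| ≤ X

theorem Sys.Bdd.swap [Fintype Q] {A : Sys Q E} {X : ℕ} (h : A.Bdd X) : A.swap.Bdd X :=
  ⟨h.two, h.card, h.g, h.f⟩

theorem Sys.Bdd.rev [Fintype Q] {A : Sys Q E} {X : ℕ} (h : A.Bdd X) : A.rev.Bdd X :=
  ⟨h.two, h.card, fun e he => by simpa [Sys.rev] using h.f e he,
    fun e he => by simpa [Sys.rev] using h.g e he⟩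

theorem Sys.Bdd.mono [Fintype Q] {A : Sys Q E} {X Y : ℕ} (h : A.Bdd X) (hXY : X ≤ Y) : A.Bdd Y :=
  ⟨h.two.trans hXY, h.card.trans hXY, fun e he => (h.f e he).trans (by exact_mod_cast hXY),
    fun e he => (h.g e he).trans (by exact_mod_cast hXY)⟩

/-- The one-counter system obtained by storing the first counter, below `W`, in the state. -/
def beltR (A : Sys Q E) (W : ℕ) (s : Q × Fin W) (δ : ℤ) (t : Q × Fin W) : Prop :=
  ∃ e ∈ A.T, A.src e = s.1 ∧ A.tgt e = t.1 ∧ (t.2.1 : ℤ) = s.2.1 + A.f e ∧ δ = A.g e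

def beltEnc (W : ℕ) (s : Q × Fin W) (y : ℤ) : Cfg Q := (s.1, (s.2.1 : ℤ), y)

variable {A : Sys Q E}

theorem belt_sf {W n : ℕ} {s t : Q × Fin W} {a b : ℤ}
    (h : CR (beltR A W) {v | 0 ≤ v} n s a t b) : A.SF (beltEnc W s a) n (beltEnc W t b) := by
  have := h.cost (Sys.SF.comp (A := A)) (P := 1) (enc := beltEnc W) ?_
  · simpa using this
  · rintro s δ t v ⟨e, h1, h2, h3, h4, rfl⟩ - hv
    exact Sys.Step.sf ⟨e, h1, h2, h3, h4, rfl⟩ ⟨by simp [beltEnc], hv⟩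

theorem Sys.Seq.belt {l : ℕ} {c : ℕ → Cfg Q} (h : A.Seq l c) {W : ℕ}
    (hW : ∀ i ≤ l, (c i).2.1 < W) : ∃ s t : Q × Fin W, beltEnc W s (c 0).2.2 = c 0 ∧
      beltEnc W t (c l).2.2 = c l ∧ CR (beltR A W) {v | 0 ≤ v} l s (c 0).2.2 t (c l).2.2 := by
  have hW0 : 0 < W := by have := hW 0 (Nat.zero_le _); have := (h.2 0 (Nat.zero_le _)).1; omega
  let st : ℕ → Q × Fin W := fun i => ((c i).1, ⟨(c i).2.1.toNat % W, Nat.mod_lt _ hW0⟩)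
  have hst : ∀ i ≤ l, ((st i).2.1 : ℤ) = (c i).2.1 := fun i hi => by
    have h1 := hW i hi
    have h2 := (h.2 i hi).1
    simp only [st]
    rw [Nat.mod_eq_of_lt (by omega)]; omega
  have hf : FR (beltR A W) l st fun i => (c i).2.2 := by
    intro i hi
    obtain ⟨e, h1, h2, h3, h4, h5⟩ := h.1 i hi
    exact ⟨e, h1, h2, h3, by rw [hst _ hi, hst _ hi.le, h4], by simp [h5]⟩
  refine ⟨st 0, st l, ?_, ?_, ?_⟩
  · rw [beltEnc, hst 0 (Nat.zero_le _)]
  · rw [beltEnc, hst l le_rfl]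
  · exact hf.seg' (Nat.zero_le _) le_rfl fun t _ ht => (h.2 t ht).2

theorem beltR_bound [Fintype Q] {X : ℕ} (hA : A.Bdd X) (W : ℕ) :
    ∀ s δ t, beltR A W s δ t → |δ| ≤ X := by
  rintro s δ t ⟨e, h1, _, _, _, rfl⟩
  exact hA.g e h1

instance : Set.OrdConnected {v : ℤ | 0 ≤ v} := ⟨fun _ hx _ _ _ hz => le_trans hx hz.1⟩

theorem belt_short : ∃ F, PB F ∧ ∀ {Q E : Type} [Fintype Q] (A : Sys Q E) {X Z : ℕ}, A.Bdd X →
    X ≤ Z → ∀ {l : ℕ} {c : ℕ → Cfg Q}, A.Seq l c → (∀ i ≤ l, (c i).2.1 < Z) →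
    |(c 0).2.2 - (c l).2.2| ≤ Z → A.SF (c 0) (F Z) (c l) := by
  refine ⟨fun Z => Z * Z * (Z + 2 * (Z * Z * Z) ^ 2 + 1), by fun_prop, ?_⟩
  intro Q E _ A X Z hA hX l c hc hW hd
  obtain ⟨s, t, hs, ht, hcr⟩ := hc.belt hW
  obtain ⟨m, hm, hcr'⟩ := hcr.short (beltR_bound hA Z) hd
  have := belt_sf hcr'
  rw [hs, ht] at this
  refine Sys.SF.comp.mono this (hm.trans ?_)
  have := hA.card.trans hX
  simp only [Fintype.card_prod, Fintype.card_fin]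
  gcongr

theorem run_pw_up {W : ℕ} {s : Q × Fin W} {v g : ℤ} {l : List E} (hg : 0 ≤ g)
    (hl : A.Run (beltEnc W s v) l (beltEnc W s (v + g))) (k : ℕ) :
    A.Run (beltEnc W s v) (pw l k) (beltEnc W s (v + k * g)) := by
  obtain ⟨h1, h2, h3, h4, h5⟩ := hl
  simp only [beltEnc] at *
  have h4' : sm A.f l = 0 := by linarith
  have h5' : sm A.g l = g := by linarith
  refine ⟨h1.pw k, Nn_pw fun _ => ⟨h2, by simpa [h4'] using h2⟩,
    Nn_pw fun hk => ⟨h3, h3.mono ?_⟩, by simp [h4'], by simp [h5']⟩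
  have : (1 : ℤ) ≤ k := by exact_mod_cast hk
  rw [h5']; nlinarith

theorem run_pw_down {W : ℕ} {s : Q × Fin W} {v g : ℤ} {l : List E} (hg : 0 ≤ g)
    (hl : A.Run (beltEnc W s (v + g)) l (beltEnc W s v)) (k : ℕ) :
    A.Run (beltEnc W s (v + k * g)) (pw l k) (beltEnc W s v) := by
  obtain ⟨h1, h2, h3, h4, h5⟩ := hl
  simp only [beltEnc] at *
  have h4' : sm A.f l = 0 := by linarith
  have h5' : sm A.g l = -g := by linarith
  refine ⟨h1.pw k, Nn_pw fun _ => ⟨h2, by simpa [h4'] using h2⟩,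
    Nn_pw fun hk => ⟨h3.mono ?_, h3.mono ?_⟩, by simp [h4'], by simp [h5']⟩
  · have : (1 : ℤ) ≤ k := by exact_mod_cast hk
    nlinarith
  · rw [h5']; linarith

theorem belt_star : ∃ F, PB F ∧ ∀ {Q E : Type} [Fintype Q] (A : Sys Q E) {X Z : ℕ}, A.Bdd X →
    X ≤ Z → ∀ {l : ℕ} {c : ℕ → Cfg Q}, A.Seq l c → (∀ i ≤ l, (c i).2.1 < Z) →
    A.LP 3 (c 0) (F Z) (c l) := by
  refine ⟨fun Z => 3 * (Z * Z * (Z * Z * Z * (Z * Z * Z) + 2 * (Z * Z * Z) + Z +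
        2 * (Z * Z * Z) ^ 2 + 1)), by fun_prop, ?_⟩
  intro Q E _ A X Z hA hX l c hc hW
  obtain ⟨s, t, hs, ht, hcr⟩ := hc.belt hW
  have hcard := hA.card.trans hX
  obtain ⟨N, hN⟩ : ∃ N, N = Fintype.card (Q × Fin Z) *
      (Fintype.card (Q × Fin Z) * X * (Fintype.card (Q × Fin Z) * X) +
      2 * (Fintype.card (Q × Fin Z) * X) + X + 2 * (Fintype.card (Q × Fin Z) * X) ^ 2 + 1) :=
    ⟨_, rfl⟩
  have hNle : 3 * N ≤ 3 * (Z * Z * (Z * Z * Z * (Z * Z * Z) + 2 * (Z * Z * Z) + Z +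
        2 * (Z * Z * Z) ^ 2 + 1)) := by
    rw [hN]
    simp only [Fintype.card_prod, Fintype.card_fin]
    gcongr
  rw [← hs, ← ht]
  rcases le_total (c 0).2.2 (c l).2.2 with h | h
  · obtain ⟨r, v, g, k, m₁, m₂, m₃, h1, h2, h3, c1, c2, c3⟩ :=
      hcr.oneStar_up (beltR_bound hA Z) h hN
    obtain ⟨w, hw, hr⟩ := belt_sf c2
    refine ((((belt_sf c1).lp.trans (Sys.lp_pw hr.1 (run_pw_up (by positivity) hr k))).trans
      (belt_sf c3).lp)).mono le_rfl ?_
    beta_reduce; omega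
  · obtain ⟨r, v, g, k, m₁, m₂, m₃, h1, h2, h3, c1, c2, c3⟩ :=
      hcr.oneStar_down (beltR_bound hA Z) h hN
    obtain ⟨w, hw, hr⟩ := belt_sf c2
    refine ((((belt_sf c1).lp.trans (Sys.lp_pw hr.1 (run_pw_down (by positivity) hr k))).trans
      (belt_sf c3).lp)).mono le_rfl ?_
    beta_reduce; omega

end Belts

section Low

/-- All nonnegative configurations with both counters below `W`. -/
noncomputable def box (Q : Type) [Fintype Q] (W : ℕ) : Finset (Cfg Q) := by
  classical
  exact Finset.univ ×ˢ (Finset.Ico 0 (W : ℤ) ×ˢ Finset.Ico 0 (W : ℤ))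

theorem card_box (Q : Type) [Fintype Q] (W : ℕ) : (box Q W).card = Fintype.card Q * (W * W) := by
  simp [box]

theorem mem_box {Q : Type} [Fintype Q] {W : ℕ} {c : Cfg Q} :
    c ∈ box Q W ↔ Pos c ∧ c.2.1 < W ∧ c.2.2 < W := by
  simp only [box, Pos, Finset.mem_product, Finset.mem_univ, Finset.mem_Ico, true_and]
  tauto

/-- Runs avoiding the region in which both counters are large. -/
theorem low_lp : ∃ F, PB F ∧ ∀ {Q E : Type} [Fintype Q] (A : Sys Q E) {X D : ℕ}, A.Bdd X →
    X ≤ D → ∀ {l : ℕ} {c : ℕ → Cfg Q}, A.Seq l c →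
    (∀ i ≤ l, (c i).2.1 < D ∨ (c i).2.2 < D) → A.LP 7 (c 0) (F D) (c l) := by
  obtain ⟨F₁, hF₁, H₁⟩ := belt_short
  obtain ⟨F₂, hF₂, H₂⟩ := belt_star
  refine ⟨fun D => 2 * F₂ (2 * D) + D * (2 * D * (2 * D)) * F₁ (2 * D), by fun_prop, ?_⟩
  intro Q E _ A X D hA hX l c hc hlow
  have hX0 := hA.two
  -- segments without near inner configurations stay in one of the two belts
  have hbelt : ∀ i j, i + j ≤ l → (∀ t, i < t → t < i + j → ¬ ((c t).2.1 < 2 * D ∧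
      (c t).2.2 < 2 * D)) → (∀ t, i ≤ t → t ≤ i + j → (c t).2.1 < (2 * D : ℕ)) ∨
      (∀ t, i ≤ t → t ≤ i + j → (c t).2.2 < (2 * D : ℕ)) := by
    intro i j hij hfar
    have hadj : ∀ t < l, |(c (t + 1)).2.1 - (c t).2.1| ≤ X ∧
        |(c (t + 1)).2.2 - (c t).2.2| ≤ X := by
      intro t ht
      obtain ⟨e, h1, _, _, h4, h5⟩ := hc.1 t ht
      rw [h4, h5]
      simpa using ⟨hA.f e h1, hA.g e h1⟩
    have hadj' : ∀ t < l, -(X : ℤ) ≤ (c (t + 1)).2.1 - (c t).2.1 ∧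
        (c (t + 1)).2.1 - (c t).2.1 ≤ X ∧ -(X : ℤ) ≤ (c (t + 1)).2.2 - (c t).2.2 ∧
        (c (t + 1)).2.2 - (c t).2.2 ≤ X := by
      intro t ht
      have := hadj t ht
      rw [abs_le, abs_le] at this
      tauto
    rcases Nat.lt_or_ge j 2 with hj | hj
    · have hl := hlow i (by omega)
      rcases (by omega : j = 0 ∨ j = 1) with rfl | rfl
      · rcases hl with hl | hl
        · left; intro t h1 h2; rw [show t = i by omega]; omega
        · right; intro t h1 h2; rw [show t = i by omega]; omega
      · have ha := hadj' i (by omega)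
        rcases hl with hl | hl
        · left; intro t h1 h2
          rcases (by omega : t = i ∨ t = i + 1) with rfl | rfl <;> omega
        · right; intro t h1 h2
          rcases (by omega : t = i ∨ t = i + 1) with rfl | rfl <;> omega
    · rcases hlow (i + 1) (by omega) with h0 | h0
      · left
        have key : ∀ k, i + 1 + k < i + j → (c (i + 1 + k)).2.1 < D := by
          intro k
          induction k with
          | zero => intro _; exact h0
          | succ k ih =>
            intro hk
            have h1 := ih (by omega)
            have h2 := hfar (i + 1 + k) (by omega) (by omega)
            have h3 := hlow (i + 1 + (k + 1)) (by omega)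
            have h4 := hadj' (i + 1 + k) (by omega)
            rw [← add_assoc] at h3 ⊢
            omega
        intro t h1 h2
        rcases h1.eq_or_lt with rfl | h1
        · have := hadj' i (by omega)
          have := key 0 (by omega)
          simp only [add_zero] at this
          omega
        · rcases h2.eq_or_lt with rfl | h2
          · have h3 := hadj' (i + j - 1) (by omega)
            have h4 := key (j - 2) (by omega)
            rw [show i + 1 + (j - 2) = i + j - 1 by omega] at h4
            rw [show i + j - 1 + 1 = i + j by omega] at h3
            omega
          · have := key (t - (i + 1)) (by omega)
            rw [show i + 1 + (t - (i + 1)) = t by omega] at this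
            omega
      · right
        have key : ∀ k, i + 1 + k < i + j → (c (i + 1 + k)).2.2 < D := by
          intro k
          induction k with
          | zero => intro _; exact h0
          | succ k ih =>
            intro hk
            have h1 := ih (by omega)
            have h2 := hfar (i + 1 + k) (by omega) (by omega)
            have h3 := hlow (i + 1 + (k + 1)) (by omega)
            have h4 := hadj' (i + 1 + k) (by omega)
            rw [← add_assoc] at h3 ⊢
            omega
        intro t h1 h2
        rcases h1.eq_or_lt with rfl | h1
        · have := hadj' i (by omega)
          have := key 0 (by omega)
          simp only [add_zero] at this
          omega
        · rcases h2.eq_or_lt with rfl | h2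
          · have h3 := hadj' (i + j - 1) (by omega)
            have h4 := key (j - 2) (by omega)
            rw [show i + 1 + (j - 2) = i + j - 1 by omega] at h4
            rw [show i + j - 1 + 1 = i + j by omega] at h3
            omega
          · have := key (t - (i + 1)) (by omega)
            rw [show i + 1 + (t - (i + 1)) = t by omega] at this
            omega
  have hstar : ∀ i j, i + j ≤ l → (∀ t, i < t → t < i + j → ¬ ((c t).2.1 < 2 * D ∧
      (c t).2.2 < 2 * D)) → A.LP 3 (c i) (F₂ (2 * D)) (c (i + j)) := by
    intro i j hij hfar
    rcases hbelt i j hij hfar with h | h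
    · exact H₂ A hA (by omega) (hc.sub hij) fun t ht => h (i + t) (by omega) (by omega)
    · refine Sys.LP.swap ?_
      exact H₂ A.swap hA.swap (by omega) (hc.sub hij).swap
        fun t ht => h (i + t) (by omega) (by omega)
  classical
  by_cases hnear : ∃ i ≤ l, (c i).2.1 < 2 * D ∧ (c i).2.2 < 2 * D
  swap
  · push Not at hnear
    have := hstar 0 l (by omega) fun t h1 h2 h3 => by
      have := hnear t (by omega) h3.1; omega
    simp only [zero_add] at this
    exact this.mono (by omega) (by ring_nf; omega)
  have hex1 : ∃ i, i ≤ l ∧ (c i).2.1 < 2 * D ∧ (c i).2.2 < 2 * D := hnear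
  have hex2 : ∃ k, k ≤ l ∧ (c (l - k)).2.1 < 2 * D ∧ (c (l - k)).2.2 < 2 * D := by
    obtain ⟨i, hi, h⟩ := hnear
    exact ⟨l - i, by omega, by rwa [show l - (l - i) = i by omega]⟩
  have hi := Nat.find_spec hex1
  have hk := Nat.find_spec hex2
  have hi' := fun m (hm : m < Nat.find hex1) => Nat.find_min hex1 hm
  have hk' := fun m (hm : m < Nat.find hex2) => Nat.find_min hex2 hm
  generalize Nat.find hex1 = i at *
  generalize Nat.find hex2 = k at *
  have hik : i ≤ l - k := by
    by_contra h
    exact hi' (l - k) (by omega) ⟨by omega, hk.2⟩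
  have p1 := hstar 0 i (by omega) fun t h1 h2 h3 => hi' t (by omega) ⟨by omega, h3⟩
  have p3 := hstar (l - k) k (by omega) fun t h1 h2 h3 => hk' (l - t) (by omega) ⟨by omega, by
    rwa [show l - (l - t) = t by omega]⟩
  have p2 : A.SF (c (i + 0)) ((box Q (2 * D)).card * F₁ (2 * D)) (c (i + (l - k - i))) := by
    refine Sys.SF.comp.excursions (near := fun a => a.2.1 < 2 * D ∧ a.2.2 < 2 * D)
      (c := fun t => c (i + t)) (box Q (2 * D)) ?_ ?_ ?_ ?_
    · intro t ht h
      exact mem_box.2 ⟨hc.2 _ (by omega), by push_cast; exact h⟩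
    · intro a b hab hb ha' hb' hf
      have hpa := hc.2 (i + a) (by omega)
      have hpb := hc.2 (i + b) (by omega)
      simp only [Pos] at hpa hpb
      rcases hbelt (i + a) (b - a) (by omega) (fun t h1 h2 h3 => by
        refine hf (t - i) (by omega) (by omega) ?_
        rwa [show i + (t - i) = t by omega]) with h | h
      · have := H₁ A hA (Z := 2 * D) (by omega) (hc.sub (i := i + a) (j := b - a) (by omega))
          (fun t ht => h _ (by omega) (by omega))
          (by
            rw [show i + a + (b - a) = i + b by omega, add_zero, abs_le]
            push_cast; omega)
        rwa [show i + a + (b - a) = i + b by omega] at this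
      · have := H₁ A.swap hA.swap (Z := 2 * D) (by omega)
          (hc.sub (i := i + a) (j := b - a) (by omega)).swap
          (fun t ht => h _ (by omega) (by omega))
          (by
            rw [show i + a + (b - a) = i + b by omega, add_zero, abs_le]
            push_cast
            simp only [sw]
            omega)
        rw [show i + a + (b - a) = i + b by omega] at this
        exact this.swap
    · simpa using hi.2
    · simpa [show i + (l - k - i) = l - k by omega] using hk.2
  rw [card_box, show i + (l - k - i) = l - k by omega, add_zero] at p2
  rw [zero_add] at p1
  rw [show l - k + k = l by omega] at p3
  refine ((p1.trans p2.lp).trans p3).mono (by omega) ?_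
  have : Fintype.card Q * (2 * D * (2 * D)) * F₁ (2 * D) ≤ D * (2 * D * (2 * D)) * F₁ (2 * D) := by
    have := hA.card.trans hX
    gcongr
  beta_reduce; omega

end Low

section Euler

variable {Q E : Type} {A : Sys Q E}

/-- `l` can be split at the state `a`. -/
def Sys.Vis (A : Sys Q E) (p : Q) (l : List E) (a : Q) : Prop := a = p ∨ ∃ e ∈ l, A.tgt e = a

theorem Sys.vis_append {p q a : Q} {l l' : List E} (h : A.Walk p l q) :
    A.Vis p (l ++ l') a ↔ A.Vis p l a ∨ A.Vis q l' a := by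
  have hq : A.Vis p l q := by
    clear a
    induction l generalizing p with
    | nil => exact .inl h.symm
    | cons e l ih =>
      rcases ih h.2.2 with h1 | ⟨e', h1, h2⟩
      · exact .inr ⟨e, by simp, h1.symm⟩
      · exact .inr ⟨e', by simp [h1], h2⟩
  simp only [Vis, List.mem_append] at *
  constructor
  · rintro (h | ⟨e, he | he, h⟩)
    · exact .inl (.inl h)
    · exact .inl (.inr ⟨e, he, h⟩)
    · exact .inr (.inr ⟨e, he, h⟩)
  · rintro ((h | ⟨e, he, h⟩) | (rfl | ⟨e, he, h⟩))
    · exact .inl h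
    · exact .inr ⟨e, .inl he, h⟩
    · rcases hq with h | ⟨e, he, h⟩
      · exact .inl h
      · exact .inr ⟨e, .inl he, h⟩
    · exact .inr ⟨e, .inr he, h⟩

theorem Sys.Walk.split {p q a : Q} {l : List E} (h : A.Walk p l q) (ha : A.Vis p l a) :
    ∃ l₁ l₂, l = l₁ ++ l₂ ∧ A.Walk p l₁ a ∧ A.Walk a l₂ q := by
  induction l generalizing p with
  | nil =>
    rcases ha with rfl | ⟨e, he, -⟩
    · exact ⟨[], [], rfl, rfl, h⟩
    · simp at he
  | cons e l ih =>
    rcases ha with rfl | ⟨e', he, ha⟩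
    · exact ⟨[], e :: l, rfl, rfl, h⟩
    · obtain ⟨l₁, l₂, h1, h2, h3⟩ := ih h.2.2 (by
        rcases List.mem_cons.1 he with rfl | he
        · exact .inl ha.symm
        · exact .inr ⟨e', he, ha⟩)
      exact ⟨e :: l₁, l₂, by simp [h1], ⟨h.1, h.2.1, h2⟩, h3⟩

theorem Sys.Walk.split_at {p q : Q} {l : List E} (h : A.Walk p l q) (i : ℕ) :
    ∃ s, A.Walk p (l.take i) s ∧ A.Walk s (l.drop i) q := by
  rw [← List.take_append_drop i l] at h
  exact Sys.walk_append.1 h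

theorem Sys.Walk.exists_cycle [Fintype Q] {p q : Q} {l : List E} (h : A.Walk p l q)
    (hl : Fintype.card Q ≤ l.length) : ∃ l₁ γ l₂ s, l = l₁ ++ γ ++ l₂ ∧ γ ≠ [] ∧
      γ.length ≤ Fintype.card Q ∧ A.Walk p l₁ s ∧ A.Walk s γ s ∧ A.Walk s l₂ q := by
  classical
  choose st h1 h2 using h.split_at
  obtain ⟨a, b, hne, hF⟩ := Fintype.exists_ne_map_eq_of_card_lt
    (fun i : Fin (Fintype.card Q + 1) => st i) (by simp)
  wlog hab : a < b generalizing a b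
  · exact this b a hne.symm hF.symm (lt_of_le_of_ne (not_lt.1 hab) hne.symm)
  have hab' : a.1 < b.1 := hab
  have hb := b.2
  have e1 : l.take b = l.take a ++ (l.drop a).take (b - a) := by
    rw [← List.take_add]; congr 1; omega
  have hlen : ((l.drop a).take (b - a)).length = b - a := by simp; omega
  have h3 := h1 b
  rw [e1] at h3
  obtain ⟨r, h4, h5⟩ := Sys.walk_append.1 h3
  obtain rfl := h4.right_unique (h1 a)
  replace hF : st a = st b := hF
  refine ⟨l.take a, (l.drop a).take (b - a), l.drop b, st a, ?_, ?_, ?_, h1 a, ?_, ?_⟩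
  · rw [← e1, List.take_append_drop]
  · intro h; rw [h] at hlen; simp at hlen; omega
  · omega
  · rw [← hF] at h5; exact h5
  · rw [hF]; exact h2 b

/-- A long walk has a short cycle that can be removed while still visiting given states. -/
theorem Sys.Walk.exists_removable [Fintype Q] (S : Finset Q) {p q : Q} {l : List E}
    (h : A.Walk p l q) (hl : (S.card + 1) * Fintype.card Q ≤ l.length) :
    ∃ l₁ γ l₂ s, l = l₁ ++ γ ++ l₂ ∧ γ ≠ [] ∧ γ.length ≤ Fintype.card Q ∧ A.Walk p l₁ s ∧
      A.Walk s γ s ∧ A.Walk s l₂ q ∧ ∀ a ∈ S, A.Vis p l a → A.Vis p (l₁ ++ l₂) a := by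
  classical
  obtain ⟨k, hk⟩ : ∃ k, k = S.card := ⟨_, rfl⟩
  induction k using Nat.strong_induction_on generalizing S p l with
  | _ k ih =>
  set n := Fintype.card Q with hn
  have hnl : n ≤ l.length := by nlinarith
  obtain ⟨t, h1, h2⟩ := h.split_at n
  have hlen : (l.take n).length = n := by simp [hnl]
  obtain ⟨l₁, γ, l₂, s, e, hγ, hγl, c1, c2, c3⟩ := h1.exists_cycle (by omega)
  by_cases hall : ∀ a ∈ S, A.Vis p l a → A.Vis p (l₁ ++ (l₂ ++ l.drop n)) a
  · refine ⟨l₁, γ, l₂ ++ l.drop n, s, ?_, hγ, hγl, c1, c2, c3.append h2, hall⟩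
    conv_lhs => rw [← List.take_append_drop n l, e]
    simp
  push Not at hall
  obtain ⟨a, haS, ha1, ha2⟩ := hall
  rw [← List.take_append_drop n l, Sys.vis_append h1] at ha1
  have ha3 : A.Vis p (l.take n) a := by
    rcases ha1 with h3 | h3
    · exact h3
    · refine absurd ?_ ha2
      rw [← List.append_assoc, Sys.vis_append (c1.append c3)]
      exact .inr h3
  let S' := S.filter fun b => ¬ A.Vis p (l.take n) b
  have hS' : S'.card < S.card := by
    refine Finset.card_lt_card ⟨Finset.filter_subset _ _, fun hsub => ?_⟩
    exact (Finset.mem_filter.1 (hsub haS)).2 ha3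
  obtain ⟨l₁', γ', l₂', s', e', hγ', hγl', d1, d2, d3, d4⟩ := ih _ (hk ▸ hS') S' h2 (by
    rw [List.length_drop]
    have : (S'.card + 1) * n + n ≤ (S.card + 1) * n := by nlinarith
    omega) rfl
  refine ⟨l.take n ++ l₁', γ', l₂', s', ?_, hγ', hγl', h1.append d1, d2, d3, ?_⟩
  · conv_lhs => rw [← List.take_append_drop n l, e']
    simp
  · intro b hb hv
    rw [List.append_assoc, Sys.vis_append h1]
    by_cases hb' : A.Vis p (l.take n) b
    · exact .inl hb'
    · rw [← List.take_append_drop n l, Sys.vis_append h1] at hv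
      exact .inr (d4 b (Finset.mem_filter.2 ⟨hb, hb'⟩) (hv.resolve_left hb'))

/-- Short cycles based at states visited by a walk. -/
def Sys.Cyc [Fintype Q] (A : Sys Q E) (p : Q) (l : List E) (c : Q × List E) : Prop :=
  A.Walk c.1 c.2 c.1 ∧ c.2.length ≤ Fintype.card Q ∧ A.Vis p l c.1

/-- Decomposition of a walk into a short walk visiting the same states and short cycles. -/
theorem Sys.Walk.euler [Fintype Q] {p q : Q} {l : List E} (h : A.Walk p l q) :
    ∃ σ, A.Walk p σ q ∧ σ.length ≤ (Fintype.card Q + 1) * Fintype.card Q ∧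
      (∀ a, A.Vis p l a → A.Vis p σ a) ∧ ∃ cs : List (Q × List E), (∀ c ∈ cs, A.Cyc p σ c) ∧
        ∀ f : E → ℤ, sm f l = sm f σ + (cs.map fun c => sm f c.2).sum := by
  obtain ⟨k, hk⟩ : ∃ k, k = l.length := ⟨_, rfl⟩
  induction k using Nat.strong_induction_on generalizing l with
  | _ k ih =>
  by_cases hl : l.length ≤ (Fintype.card Q + 1) * Fintype.card Q
  · exact ⟨l, h, hl, fun _ => id, [], by simp, by simp⟩
  obtain ⟨l₁, γ, l₂, s, e, hγ, hγl, c1, c2, c3, c4⟩ := h.exists_removable Finset.univ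
    (by rw [Finset.card_univ]; omega)
  have hlen : 0 < γ.length := List.length_pos_iff.2 hγ
  obtain ⟨σ, h1, h2, h5, cs, h3, h4⟩ := ih (l₁ ++ l₂).length
    (by rw [hk, e]; simp; omega) (c1.append c3) rfl
  have hs : A.Vis p (l₁ ++ l₂) s := (Sys.vis_append c1).2 (.inr (.inl rfl))
  refine ⟨σ, h1, h2, fun a ha => h5 a (c4 a (Finset.mem_univ a) ha), (s, γ) :: cs, ?_, ?_⟩
  · rintro c hc
    rcases List.mem_cons.1 hc with rfl | hc
    · exact ⟨c2, hγl, h5 s hs⟩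
    · exact h3 c hc
  · intro f
    have := h4 f
    rw [e]
    simp only [sm_append, List.map_cons, List.sum_cons] at this ⊢
    linarith

end Euler

section Caratheodory

/-- The determinant of two vectors. -/
def dt (u v : ℤ × ℤ) : ℤ := u.1 * v.2 - u.2 * v.1

/-- Subtracting a relation until one of the big coefficients becomes small. -/
theorem car_step {K : Finset (ℤ × ℤ)} {B : ℤ} {m a : ℤ × ℤ → ℤ} (hm : ∀ v, 0 ≤ m v)
    (ha : ∀ v, a v ≠ 0 → v ∈ K ∧ B ≤ m v) (hB : ∀ v, |a v| ≤ B)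
    (h0 : ∑ v ∈ K, a v • v = 0) (hne : ∃ v, a v ≠ 0) :
    ∃ m' : ℤ × ℤ → ℤ, (∀ v, 0 ≤ m' v) ∧ (∀ v, m v = 0 → m' v = 0) ∧
      ∑ v ∈ K, m' v • v = ∑ v ∈ K, m v • v ∧
      (K.filter fun v => B ≤ m' v) ⊂ K.filter fun v => B ≤ m v := by
  wlog hpos : ∃ v, 0 < a v generalizing a
  · obtain ⟨v, hv⟩ := hne
    have hv' : 0 < -a v := by
      have := not_exists.1 hpos v
      omega
    exact this (a := fun v => -a v) (fun v hv => ha v (by omega)) (fun v => by rw [abs_neg]; exact hB v)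
      (by simp only [neg_smul, Finset.sum_neg_distrib, h0, neg_zero]) ⟨v, by omega⟩ ⟨v, hv'⟩
  obtain ⟨v₀, hv₀⟩ := hpos
  obtain ⟨k, hk⟩ : ∃ k, k = (m v₀).toNat := ⟨_, rfl⟩
  induction k using Nat.strong_induction_on generalizing m with
  | _ k ih =>
  have hle : ∀ v, |a v| ≤ m v := by
    intro v
    by_cases h : a v = 0
    · rw [h]; simpa using hm v
    · exact (hB v).trans (ha v h).2
  have h1 : ∀ v, 0 ≤ m v - a v := fun v => by have := le_abs_self (a v); have := hle v; omega
  have h2 : ∀ v, m v = 0 → m v - a v = 0 := by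
    intro v hv
    have := hle v
    rw [hv] at this
    have := abs_nonpos_iff.1 this
    omega
  have h3 : ∑ v ∈ K, (m v - a v) • v = ∑ v ∈ K, m v • v := by
    simp only [sub_smul, Finset.sum_sub_distrib, h0, sub_zero]
  have hsub : (K.filter fun v => B ≤ m v - a v) ⊆ K.filter fun v => B ≤ m v := by
    intro v hv
    rw [Finset.mem_filter] at hv ⊢
    refine ⟨hv.1, ?_⟩
    by_cases h : a v = 0
    · simpa [h] using hv.2
    · exact (ha v h).2
  by_cases heq : (K.filter fun v => B ≤ m v) ⊆ K.filter fun v => B ≤ m v - a v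
  · have hlt : (m v₀ - a v₀).toNat < (m v₀).toNat := by have := h1 v₀; omega
    obtain ⟨m', g1, g2, g3, g4⟩ := @ih _ (hk ▸ hlt) (fun v => m v - a v) h1
      (fun v hv => ⟨(ha v hv).1, by
        have := heq (Finset.mem_filter.2 (ha v hv))
        exact (Finset.mem_filter.1 this).2⟩) rfl
    exact ⟨m', g1, fun v hv => g2 v (h2 v hv), g3.trans h3, g4.trans_subset hsub⟩
  · exact ⟨fun v => m v - a v, h1, h2, h3, hsub, heq⟩

/-- The combination of `K` with coefficients `m` is bounded up to multiples of at most two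
linearly independent vectors. -/
def Reduced (K : Finset (ℤ × ℤ)) (B : ℤ) (m : ℤ × ℤ → ℤ) : Prop :=
  ∃ ρ : ℤ × ℤ → ℤ, ∃ v₁ v₂ : ℤ × ℤ, ∃ k₁ k₂ : ℤ,
      (∀ v, 0 ≤ ρ v) ∧ (∀ v ∈ K, ρ v ≤ B) ∧ (∀ v, m v = 0 → ρ v = 0) ∧ 0 ≤ k₁ ∧
      0 ≤ k₂ ∧ (k₁ ≠ 0 → v₁ ∈ K ∧ m v₁ ≠ 0) ∧ (k₂ ≠ 0 → v₂ ∈ K ∧ m v₂ ≠ 0) ∧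
      (k₂ = 0 ∨ dt v₁ v₂ ≠ 0) ∧
      ∑ v ∈ K, m v • v = ∑ v ∈ K, ρ v • v + k₁ • v₁ + k₂ • v₂

/-- Integer Carathéodory theorem in the plane, with a bounded remainder. -/
theorem car {K : Finset (ℤ × ℤ)} {Y : ℤ} (hK : ∀ v ∈ K, |v.1| ≤ Y ∧ |v.2| ≤ Y)
    {m : ℤ × ℤ → ℤ} (hm : ∀ v, 0 ≤ m v) : Reduced K (2 * Y ^ 2 + Y + 1) m := by
  classical
  set B := 2 * Y ^ 2 + Y + 1 with hB
  obtain ⟨k, hk⟩ : ∃ k, k = (K.filter fun v => B ≤ m v).card := ⟨_, rfl⟩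
  induction k using Nat.strong_induction_on generalizing m with
  | _ k ih =>
  set G := K.filter fun v => B ≤ m v with hG
  have red : ∀ a : ℤ × ℤ → ℤ, (∀ v, a v ≠ 0 → v ∈ G) → (∀ v, |a v| ≤ B) →
      ∑ v ∈ K, a v • v = 0 → (∃ v, a v ≠ 0) → Reduced K B m := by
    intro a a1 a2 a3 a4
    obtain ⟨m', g1, g2, g3, g4⟩ := car_step hm (fun v hv => Finset.mem_filter.1 (a1 v hv)) a2 a3 a4
    obtain ⟨ρ, v₁, v₂, k₁, k₂, e1, e2, e3, e4, e5, e6, e7, e8, e9⟩ :=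
      ih _ (hk ▸ Finset.card_lt_card g4) g1 rfl
    exact ⟨ρ, v₁, v₂, k₁, k₂, e1, e2, fun v hv => e3 v (g2 v hv), e4, e5,
      fun h => ⟨(e6 h).1, fun h' => (e6 h).2 (g2 _ h')⟩,
      fun h => ⟨(e7 h).1, fun h' => (e7 h).2 (g2 _ h')⟩, e8, g3 ▸ e9⟩
  have hY : K.Nonempty → 0 ≤ Y := fun ⟨v, hv⟩ => (abs_nonneg _).trans (hK v hv).1
  have hGK : G ⊆ K := Finset.filter_subset _ _
  have hpos : ∀ v ∈ G, m v ≠ 0 := by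
    intro v hv
    have h1 := (Finset.mem_filter.1 hv).2
    have h2 := hY ⟨v, hGK hv⟩
    have : 0 < B := by rw [hB]; positivity
    omega
  have fin : ∀ v₁ v₂ : ℤ × ℤ, ∀ k₁ k₂ : ℤ, 0 ≤ k₁ → 0 ≤ k₂ → (k₁ ≠ 0 → v₁ ∈ G) → (k₂ ≠ 0 → v₂ ∈ G) →
      (k₂ = 0 ∨ dt v₁ v₂ ≠ 0) → ∑ v ∈ G, m v • v = k₁ • v₁ + k₂ • v₂ →
      Reduced K B m := by
    intro v₁ v₂ k₁ k₂ h1 h2 h3 h4 h5 h6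
    refine ⟨fun v => if v ∈ G then 0 else m v, v₁, v₂, k₁, k₂, fun v => ?_, fun v hv => ?_,
      fun v hv => ?_, h1, h2, fun h => ⟨hGK (h3 h), hpos _ (h3 h)⟩,
      fun h => ⟨hGK (h4 h), hpos _ (h4 h)⟩, h5, ?_⟩
    · dsimp only; split_ifs
      · exact le_rfl
      · exact hm v
    · dsimp only; split_ifs with h
      · have := hY ⟨v, hv⟩
        rw [hB]; positivity
      · rw [hG, Finset.mem_filter] at h
        push Not at h
        exact (h hv).le
    · dsimp only; split_ifs
      · rfl
      · exact hv
    · rw [add_assoc, ← h6, ← Finset.sum_sdiff hGK]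
      congr 1
      rw [← Finset.sum_sdiff hGK, Finset.sum_eq_zero (s := G), add_zero]
      · refine Finset.sum_congr rfl fun v hv => ?_
        simp only [if_neg (Finset.mem_sdiff.1 hv).2]
      · intro v hv
        simp only [if_pos hv, zero_smul]
  have sum2 : ∀ v₁ ∈ K, ∀ v₂ ∈ K, v₁ ≠ v₂ → ∀ x y : ℤ,
      ∑ v ∈ K, (if v = v₁ then x else if v = v₂ then y else 0) • v = x • v₁ + y • v₂ := by
    intro v₁ h1 v₂ h2 h x y
    rw [← Finset.add_sum_erase _ _ h1, ← Finset.add_sum_erase _ _ (Finset.mem_erase.2 ⟨h.symm, h2⟩)]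
    rw [Finset.sum_eq_zero]
    · simp [h.symm]
    · intro v hv
      simp only [Finset.mem_erase] at hv
      simp [hv.1, hv.2.1]
  have dep : ∀ v₁ ∈ G, ∀ v₂ ∈ G, v₁ ≠ v₂ → dt v₁ v₂ = 0 → Reduced K B m := by
    intro v₁ h1 v₂ h2 hne hd
    have hY0 := hY ⟨v₁, hGK h1⟩
    obtain ⟨x, y, hx, hy, hxy, hr⟩ : ∃ x y : ℤ, |x| ≤ Y ∧ |y| ≤ Y ∧ (x ≠ 0 ∨ y ≠ 0) ∧
        x • v₁ + y • v₂ = 0 := by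
      obtain ⟨a, b⟩ := v₁
      obtain ⟨c, d⟩ := v₂
      have k1 := hK _ (hGK h1)
      have k2 := hK _ (hGK h2)
      simp only [dt] at hd k1 k2
      by_cases h : c ≠ 0 ∨ a ≠ 0
      · exact ⟨c, -a, k2.1, by rw [abs_neg]; exact k1.1, by simpa using h,
          Prod.ext (by simp; ring) (by simp; linarith)⟩
      · push Not at h
        obtain ⟨rfl, rfl⟩ := h
        refine ⟨d, -b, k2.2, by rw [abs_neg]; exact k1.2, ?_, Prod.ext (by simp) (by simp; ring)⟩
        by_contra! h
        refine hne (Prod.ext rfl ?_)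
        have := h.1; have := h.2
        simp only; omega
    refine red (fun v => if v = v₁ then x else if v = v₂ then y else 0) ?_ ?_ ?_ ?_
    · intro v hv
      split_ifs at hv with e1 e2
      · exact e1 ▸ h1
      · exact e2 ▸ h2
      · exact absurd rfl hv
    · intro v
      have : Y ≤ B := by rw [hB]; nlinarith [sq_nonneg Y]
      split_ifs
      · exact hx.trans this
      · exact hy.trans this
      · simpa using hY0.trans this
    · rw [sum2 v₁ (hGK h1) v₂ (hGK h2) hne, hr]
    · rcases hxy with h | h
      · exact ⟨v₁, by simpa using h⟩
      · exact ⟨v₂, by simpa [hne.symm] using h⟩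
  rcases Nat.lt_or_ge G.card 3 with hc | hc
  · interval_cases hcc : G.card
    · have : G = ∅ := Finset.card_eq_zero.1 hcc
      exact fin 0 0 0 0 le_rfl le_rfl (by simp) (by simp) (.inl rfl) (by rw [this]; simp)
    · obtain ⟨v, hv⟩ := Finset.card_eq_one.1 hcc
      exact fin v 0 (m v) 0 (hm v) le_rfl (by simp [hv]) (by simp) (.inl rfl) (by simp [hv])
    · obtain ⟨v₁, v₂, hne, hv⟩ := Finset.card_eq_two.1 hcc
      by_cases hd : dt v₁ v₂ = 0
      · exact dep v₁ (by simp [hv]) v₂ (by simp [hv]) hne hd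
      · exact fin v₁ v₂ (m v₁) (m v₂) (hm _) (hm _) (by simp [hv]) (by simp [hv]) (.inr hd)
          (by rw [hv, Finset.sum_pair hne])
  · obtain ⟨v₁, h1, v₂, h2, v₃, h3, h12, h13, h23⟩ := Finset.two_lt_card.1 hc
    by_cases hd : dt v₁ v₂ = 0
    · exact dep v₁ h1 v₂ h2 h12 hd
    have hY0 := hY ⟨v₁, hGK h1⟩
    have hdt : ∀ u ∈ G, ∀ v ∈ G, |dt u v| ≤ B := by
      intro u hu v hv
      obtain ⟨u1, u2⟩ := hK u (hGK hu)
      obtain ⟨w1, w2⟩ := hK v (hGK hv)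
      calc |dt u v| ≤ |u.1 * v.2| + |u.2 * v.1| := abs_sub _ _
        _ = |u.1| * |v.2| + |u.2| * |v.1| := by rw [abs_mul, abs_mul]
        _ ≤ Y * Y + Y * Y := by gcongr
        _ ≤ B := by rw [hB]; nlinarith
    refine red (fun v => if v = v₁ then dt v₂ v₃ else if v = v₂ then dt v₃ v₁ else
      if v = v₃ then dt v₁ v₂ else 0) ?_ ?_ ?_ ?_
    · intro v hv
      split_ifs at hv with e1 e2 e3
      · exact e1 ▸ h1
      · exact e2 ▸ h2
      · exact e3 ▸ h3
      · exact absurd rfl hv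
    · intro v
      split_ifs
      · exact hdt _ h2 _ h3
      · exact hdt _ h3 _ h1
      · exact hdt _ h1 _ h2
      · have : 0 ≤ B := by rw [hB]; positivity
        simpa using this
    · rw [← Finset.add_sum_erase _ _ (hGK h1),
        ← Finset.add_sum_erase _ _ (Finset.mem_erase.2 ⟨h12.symm, hGK h2⟩),
        ← Finset.add_sum_erase _ _ (Finset.mem_erase.2 ⟨h23.symm,
          Finset.mem_erase.2 ⟨h13.symm, hGK h3⟩⟩), Finset.sum_eq_zero]
      · simp only [if_true, h12.symm, h13.symm, h23.symm, if_false, add_zero]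
        exact Prod.ext (by simp [dt]; ring) (by simp [dt]; ring)
      · intro v hv
        simp only [Finset.mem_erase] at hv
        simp [hv.1, hv.2.1, hv.2.2.1]
    · exact ⟨v₃, by simpa [h13.symm, h23.symm] using hd⟩

end Caratheodory

section EulerCaratheodory

variable {Q E : Type} {A : Sys Q E}

/-- Displacement of a word. -/
def Sys.dp (A : Sys Q E) (l : List E) : ℤ × ℤ := (sm A.f l, sm A.g l)

@[simp] theorem Sys.dp_append (l l' : List E) : A.dp (l ++ l') = A.dp l + A.dp l' := by
  simp [Sys.dp]

@[simp] theorem Sys.dp_pw (l : List E) (n : ℕ) : A.dp (pw l n) = (n : ℤ) • A.dp l := by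
  ext <;> simp [Sys.dp]

@[simp] theorem Sys.dp_nil : A.dp [] = 0 := rfl

theorem Sys.Bdd.dp [Fintype Q] {X : ℕ} (hA : A.Bdd X) {p q : Q} {l : List E} (h : A.Walk p l q) {n : ℕ}
    (hl : l.length ≤ n) : |(A.dp l).1| ≤ (n * X : ℕ) ∧ |(A.dp l).2| ≤ (n * X : ℕ) := by
  have : l.length * X ≤ n * X := by gcongr
  constructor
  · exact (abs_sm_le fun e he => hA.f e (h.mem e he)).trans (by exact_mod_cast this)
  · exact (abs_sm_le fun e he => hA.g e (h.mem e he)).trans (by exact_mod_cast this)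

/-- Insertion of powers of a cycle into a walk. -/
theorem Sys.Walk.insert {p q s : Q} {w c : List E} (h : A.Walk p w q) (hs : A.Vis p w s)
    (hc : A.Walk s c s) (k : ℕ) : ∃ w', A.Walk p w' q ∧ w'.length = w.length + k * c.length ∧
      (∀ a, A.Vis p w a → A.Vis p w' a) ∧ A.dp w' = A.dp w + (k : ℤ) • A.dp c := by
  obtain ⟨l₁, l₂, rfl, h1, h2⟩ := h.split hs
  refine ⟨l₁ ++ (TVASSpaper.pw c k ++ l₂), h1.append ((hc.pw k).append h2), ?_, ?_, ?_⟩
  · have : (TVASSpaper.pw c k).length = k * c.length := by simp [TVASSpaper.pw]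
    simp [this]; ring
  · intro a ha
    rw [Sys.vis_append h1] at ha ⊢
    rw [Sys.vis_append (hc.pw k)]
    tauto
  · simp only [Sys.dp_append, Sys.dp_pw]; abel

/-- A walk has the displacement of a short walk visiting the same states, up to multiples of at
most two small cycles. -/
theorem eulcar : ∃ F, PB F ∧ ∀ {Q E : Type} [Fintype Q] (A : Sys Q E) {X : ℕ}, A.Bdd X →
    ∀ {p q : Q} {l : List E}, A.Walk p l q → ∃ w, A.Walk p w q ∧ w.length ≤ F X ∧
      (∀ a, A.Vis p l a → A.Vis p w a) ∧ ∃ (c₁ c₂ : Q × List E) (k₁ k₂ : ℕ), A.Cyc p w c₁ ∧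
      A.Cyc p w c₂ ∧ A.dp l = A.dp w + (k₁ : ℤ) • A.dp c₁.2 + (k₂ : ℤ) • A.dp c₂.2 ∧
      (k₂ = 0 ∧ (k₁ = 0 ∨ A.dp c₁.2 ≠ 0) ∨ dt (A.dp c₁.2) (A.dp c₂.2) ≠ 0) := by
  classical
  refine ⟨fun X => (X + 1) * X + (2 * X ^ 2 + 1) ^ 2 * ((2 * (X ^ 2) ^ 2 + X ^ 2 + 1) * X),
    by fun_prop, ?_⟩
  intro Q E _ A X hA p q l hl
  obtain ⟨σ, h1, h2, h3, cs, h4, h5⟩ := hl.euler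
  set V := cs.map fun c => A.dp c.2 with hV
  set K := V.toFinset with hK
  have hKc : ∀ v ∈ K, ∃ c, A.Cyc p σ c ∧ A.dp c.2 = v := by
    intro v hv
    rw [hK, List.mem_toFinset, hV, List.mem_map] at hv
    obtain ⟨c, hc, rfl⟩ := hv
    exact ⟨c, h4 c hc, rfl⟩
  have hKY : ∀ v ∈ K, |v.1| ≤ ((X ^ 2 : ℕ) : ℤ) ∧ |v.2| ≤ ((X ^ 2 : ℕ) : ℤ) := by
    intro v hv
    obtain ⟨c, hc, rfl⟩ := hKc v hv
    have := hA.dp hc.1 (hc.2.1.trans hA.card)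
    rwa [← pow_two] at this
  have hdl : A.dp l = A.dp σ + ∑ v ∈ K, (V.count v : ℤ) • v := by
    have e1 : A.dp l = A.dp σ + V.sum := by
      have key : V.sum = ((cs.map fun c => sm A.f c.2).sum, (cs.map fun c => sm A.g c.2).sum) := by
        rw [hV]
        clear_value K
        clear hV h4 h5 hK hKc hKY
        clear V
        induction cs with
        | nil => rfl
        | cons c cs ih => simp only [List.map_cons, List.sum_cons, ih]; rfl
      rw [key]
      exact Prod.ext (h5 A.f) (h5 A.g)
    rw [e1, Finset.sum_list_count]
    congr 1
    exact Finset.sum_congr (by rw [hK]) fun v _ => by rw [← natCast_zsmul]; congr!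
  obtain ⟨ρ, v₁, v₂, k₁, k₂, e1, e2, -, e4, e5, e6, e7, e8, e9⟩ :=
    car hKY (m := fun v => (V.count v : ℤ)) (fun v => by positivity)
  -- insert the remainder
  have hins : ∀ G ⊆ K, ∃ w, A.Walk p w q ∧
      w.length ≤ σ.length + G.card * ((2 * (X ^ 2) ^ 2 + X ^ 2 + 1) * X) ∧
      (∀ a, A.Vis p σ a → A.Vis p w a) ∧ A.dp w = A.dp σ + ∑ v ∈ G, ρ v • v := by
    intro G
    induction G using Finset.induction_on with
    | empty => intro _; exact ⟨σ, h1, by simp, fun _ => id, by simp⟩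
    | insert v G hv ih =>
      intro hG
      obtain ⟨w, g1, g2, g3, g4⟩ := ih ((Finset.subset_insert _ _).trans hG)
      have hvK := hG (Finset.mem_insert_self _ _)
      obtain ⟨c, hc, hcv⟩ := hKc v hvK
      obtain ⟨w', j1, j2, j3, j4⟩ := g1.insert (g3 _ hc.2.2) hc.1 (ρ v).toNat
      refine ⟨w', j1, ?_, fun a ha => j3 a (g3 a ha), ?_⟩
      · rw [j2, Finset.card_insert_of_notMem hv]
        have : (ρ v).toNat * c.2.length ≤ (2 * (X ^ 2) ^ 2 + X ^ 2 + 1) * X := by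
          have := e2 v hvK
          refine Nat.mul_le_mul ?_ (hc.2.1.trans hA.card)
          push_cast at this
          zify
          rw [Int.toNat_of_nonneg (e1 v)]
          exact this
        have e : (G.card + 1) * ((2 * (X ^ 2) ^ 2 + X ^ 2 + 1) * X) =
          G.card * ((2 * (X ^ 2) ^ 2 + X ^ 2 + 1) * X) + (2 * (X ^ 2) ^ 2 + X ^ 2 + 1) * X := by ring
        rw [e]
        omega
      · rw [j4, g4, Finset.sum_insert hv, hcv, Int.toNat_of_nonneg (e1 v)]
        abel
  obtain ⟨w, g1, g2, g3, g4⟩ := hins K subset_rfl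
  have hcard : K.card ≤ (2 * X ^ 2 + 1) ^ 2 := by
    have : K ⊆ Finset.Icc (-((X ^ 2 : ℕ) : ℤ)) ((X ^ 2 : ℕ) : ℤ) ×ˢ
        Finset.Icc (-((X ^ 2 : ℕ) : ℤ)) ((X ^ 2 : ℕ) : ℤ) := by
      intro v hv
      have := hKY v hv
      rw [abs_le, abs_le] at this
      simp only [Finset.mem_product, Finset.mem_Icc]
      exact this
    refine (Finset.card_le_card this).trans ?_
    rw [Finset.card_product, Int.card_Icc, ← pow_two]
    refine Nat.pow_le_pow_left ?_ 2
    omega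
  have hw : w.length ≤ (X + 1) * X +
      (2 * X ^ 2 + 1) ^ 2 * ((2 * (X ^ 2) ^ 2 + X ^ 2 + 1) * X) := by
    refine g2.trans (Nat.add_le_add (h2.trans ?_) (Nat.mul_le_mul_right _ hcard))
    have := hA.card
    gcongr
  have hrep : ∀ (v : ℤ × ℤ) (k : ℤ), (k ≠ 0 → v ∈ K ∧ (V.count v : ℤ) ≠ 0) → ∃ c, A.Cyc p w c ∧
      (k ≠ 0 → A.dp c.2 = v) := by
    intro v k h
    by_cases hk : k = 0
    · exact ⟨(p, []), ⟨rfl, by simp, .inl rfl⟩, by simp [hk]⟩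
    · obtain ⟨c, hc, hcv⟩ := hKc v (h hk).1
      exact ⟨c, ⟨hc.1, hc.2.1, g3 _ hc.2.2⟩, fun _ => hcv⟩
  obtain ⟨c₁, r1, r2⟩ := hrep v₁ k₁ e6
  obtain ⟨c₂, r3, r4⟩ := hrep v₂ k₂ e7
  have hsum : A.dp l = A.dp w + k₁ • A.dp c₁.2 + k₂ • A.dp c₂.2 := by
    have hs : ∀ (k : ℤ) (v u : ℤ × ℤ), (k ≠ 0 → u = v) → k • v = k • u := by
      intro k v u h
      by_cases hk : k = 0
      · simp [hk]
      · rw [h hk]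
    rw [hdl, e9, g4, hs k₁ v₁ _ r2, hs k₂ v₂ _ r4]
    abel
  by_cases hk1 : k₁ = 0 ∨ A.dp c₁.2 = 0
  · -- only the second cycle matters
    have h0 : k₁ • A.dp c₁.2 = 0 := by rcases hk1 with h | h <;> simp [h]
    by_cases hk2 : k₂ = 0 ∨ A.dp c₂.2 = 0
    · have h0' : k₂ • A.dp c₂.2 = 0 := by rcases hk2 with h | h <;> simp [h]
      exact ⟨w, g1, hw, fun a ha => g3 a (h3 a ha), c₁, c₂, 0, 0, r1, r3,
        by rw [hsum, h0, h0']; simp, .inl ⟨rfl, .inl rfl⟩⟩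
    · refine ⟨w, g1, hw, fun a ha => g3 a (h3 a ha), c₂, c₁, k₂.toNat, 0, r3, r1, ?_,
        .inl ⟨rfl, .inr (not_or.1 hk2).2⟩⟩
      rw [hsum, h0, Int.toNat_of_nonneg e5]; simp
  · refine ⟨w, g1, hw, fun a ha => g3 a (h3 a ha), c₁, c₂, k₁.toNat, k₂.toNat, r1, r3, ?_, ?_⟩
    · rw [hsum, Int.toNat_of_nonneg e4, Int.toNat_of_nonneg e5]
    · by_cases hk2 : k₂ = 0
      · exact .inl ⟨by simp [hk2], .inr (not_or.1 hk1).2⟩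
      · rw [r2 (not_or.1 hk1).1, r4 hk2]
        exact .inr (e8.resolve_left hk2)

end EulerCaratheodory

section Cone

/-- Decomposition of a pair of multiplicities along generators on which a linear form has constant
sign. -/
theorem cone_one {Y : ℕ} (hY : 1 ≤ Y) {α β : ℤ} (hα : |α| ≤ Y) (hβ : |β| ≤ Y) (k₁ k₂ : ℕ) :
    ∃ p₁ q₁ p₂ q₂ e₁ e₂ K₁ K₂ : ℕ, p₁ ≤ Y ∧ q₁ ≤ Y ∧ p₂ ≤ Y ∧ q₂ ≤ Y ∧ e₁ ≤ Y ∧ e₂ ≤ Y ∧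
      k₁ = e₁ + K₁ * p₁ + K₂ * p₂ ∧ k₂ = e₂ + K₁ * q₁ + K₂ * q₂ ∧
      (0 ≤ α * p₁ + β * q₁ ∧ 0 ≤ α * p₂ + β * q₂ ∨ α * p₁ + β * q₁ ≤ 0 ∧ α * p₂ + β * q₂ ≤ 0) := by
  wlog hpos : 0 ≤ α * k₁ + β * k₂ generalizing α β
  · obtain ⟨p₁, q₁, p₂, q₂, e₁, e₂, K₁, K₂, h1, h2, h3, h4, h5, h6, h7, h8, h9⟩ :=
      this (α := -α) (β := -β) (by rwa [abs_neg]) (by rwa [abs_neg]) (by linarith)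
    refine ⟨p₁, q₁, p₂, q₂, e₁, e₂, K₁, K₂, h1, h2, h3, h4, h5, h6, h7, h8, ?_⟩
    rcases h9 with h | h
    · right; constructor <;> linarith [h.1, h.2]
    · left; constructor <;> linarith [h.1, h.2]
  rw [abs_le] at hα hβ
  by_cases ha : 0 ≤ α
  · by_cases hb : 0 ≤ β
    · exact ⟨1, 0, 0, 1, 0, 0, k₁, k₂, hY, by omega, by omega, hY, by omega, by omega, by simp,
        by simp, .inl ⟨by simpa, by simpa⟩⟩
    · -- `0 ≤ α`, `β < 0`
      rcases ha.eq_or_lt with rfl | ha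
      · have : k₂ = 0 := by
          by_contra h
          have : (1 : ℤ) ≤ k₂ := by omega
          nlinarith
        exact ⟨1, 0, 0, 0, 0, 0, k₁, 0, hY, by omega, by omega, by omega, by omega, by omega,
          by simp, by simp [this], .inl ⟨by simp, by simp⟩⟩
      · obtain ⟨a, rfl⟩ := Int.eq_ofNat_of_zero_le ha.le
        obtain ⟨b, hb'⟩ := Int.eq_ofNat_of_zero_le (by omega : 0 ≤ -β)
        obtain rfl : β = -b := by omega
        have ha0 : 0 < a := by omega
        have hdm := Nat.div_add_mod k₂ a
        have hle : k₂ / a * b ≤ k₁ := by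
          have h1 : b * k₂ ≤ a * k₁ := by zify; linarith
          have h2 : b * (a * (k₂ / a)) ≤ a * k₁ := le_trans (Nat.mul_le_mul_left _ (by omega)) h1
          have h3 : a * (k₂ / a * b) ≤ a * k₁ := by rw [show a * (k₂ / a * b) = b * (a * (k₂ / a)) by ring]; exact h2
          exact Nat.le_of_mul_le_mul_left h3 ha0
        refine ⟨1, 0, b, a, 0, k₂ % a, k₁ - k₂ / a * b, k₂ / a, hY, by omega, by omega, by omega,
          by omega, ?_, by omega, ?_, .inl ⟨by simp, ?_⟩⟩
        · have := Nat.mod_lt k₂ ha0; omega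
        · rw [mul_comm a] at hdm; omega
        · rw [mul_comm]; simp
  · by_cases hb : 0 ≤ β
    · rcases hb.eq_or_lt with rfl | hb
      · have : k₁ = 0 := by
          by_contra h
          have : (1 : ℤ) ≤ k₁ := by omega
          nlinarith
        exact ⟨0, 0, 0, 1, 0, 0, 0, k₂, by omega, by omega, by omega, hY, by omega, by omega,
          by simp [this], by simp, .inl ⟨by simp, by simp⟩⟩
      · obtain ⟨b, rfl⟩ := Int.eq_ofNat_of_zero_le hb.le
        obtain ⟨a, ha'⟩ := Int.eq_ofNat_of_zero_le (by omega : 0 ≤ -α)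
        obtain rfl : α = -a := by omega
        have hb0 : 0 < b := by omega
        have hdm := Nat.div_add_mod k₁ b
        have hle : k₁ / b * a ≤ k₂ := by
          have h1 : a * k₁ ≤ b * k₂ := by zify; linarith
          have h2 : a * (b * (k₁ / b)) ≤ b * k₂ := le_trans (Nat.mul_le_mul_left _ (by omega)) h1
          have h3 : b * (k₁ / b * a) ≤ b * k₂ := by rw [show b * (k₁ / b * a) = a * (b * (k₁ / b)) by ring]; exact h2
          exact Nat.le_of_mul_le_mul_left h3 hb0
        refine ⟨b, a, 0, 1, k₁ % b, 0, k₁ / b, k₂ - k₁ / b * a, by omega, by omega, by omega, hY,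
          ?_, by omega, ?_, by omega, .inl ⟨?_, by simp⟩⟩
        · have := Nat.mod_lt k₁ hb0; omega
        · rw [mul_comm b] at hdm; omega
        · rw [neg_mul, mul_comm]; simp
    · have h1 : k₁ = 0 ∧ k₂ = 0 := by
        by_contra h
        have : (1 : ℤ) ≤ k₁ + k₂ := by omega
        nlinarith
      exact ⟨0, 0, 0, 0, 0, 0, 0, 0, by omega, by omega, by omega, by omega, by omega, by omega,
        by simp [h1], by simp [h1], .inl ⟨by simp, by simp⟩⟩

/-- Decomposition of a nonnegative combination of two vectors along two generators lying in the
same quadrant. -/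
theorem cone_two {Y : ℕ} (hY : 1 ≤ Y) {v₁ v₂ : ℤ × ℤ} (h₁ : |v₁.1| ≤ Y ∧ |v₁.2| ≤ Y)
    (h₂ : |v₂.1| ≤ Y ∧ |v₂.2| ≤ Y) (k₁ k₂ : ℕ) :
    ∃ p₁ q₁ p₂ q₂ e₁ e₂ K₁ K₂ : ℕ, p₁ ≤ 5 * Y ^ 3 ∧ q₁ ≤ 5 * Y ^ 3 ∧ p₂ ≤ 5 * Y ^ 3 ∧
      q₂ ≤ 5 * Y ^ 3 ∧ e₁ ≤ 5 * Y ^ 3 ∧ e₂ ≤ 5 * Y ^ 3 ∧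
      k₁ = e₁ + K₁ * p₁ + K₂ * p₂ ∧ k₂ = e₂ + K₁ * q₁ + K₂ * q₂ ∧
      (0 ≤ v₁.1 * p₁ + v₂.1 * q₁ ∧ 0 ≤ v₁.1 * p₂ + v₂.1 * q₂ ∨
        v₁.1 * p₁ + v₂.1 * q₁ ≤ 0 ∧ v₁.1 * p₂ + v₂.1 * q₂ ≤ 0) ∧
      (0 ≤ v₁.2 * p₁ + v₂.2 * q₁ ∧ 0 ≤ v₁.2 * p₂ + v₂.2 * q₂ ∨
        v₁.2 * p₁ + v₂.2 * q₁ ≤ 0 ∧ v₁.2 * p₂ + v₂.2 * q₂ ≤ 0) := by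
  obtain ⟨p₁, q₁, p₂, q₂, e₁, e₂, K₁, K₂, a1, a2, a3, a4, a5, a6, a7, a8, a9⟩ :=
    cone_one hY h₁.1 h₂.1 k₁ k₂
  have hb : ∀ p q : ℕ, p ≤ Y → q ≤ Y → |v₁.2 * p + v₂.2 * q| ≤ (2 * Y ^ 2 : ℕ) := by
    intro p q hp hq
    calc |v₁.2 * p + v₂.2 * q| ≤ |v₁.2 * p| + |v₂.2 * q| := abs_add_le _ _
      _ = |v₁.2| * p + |v₂.2| * q := by simp [abs_mul]
      _ ≤ Y * Y + Y * Y := by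
        have := h₁.2; have := h₂.2
        gcongr
      _ = (2 * Y ^ 2 : ℕ) := by push_cast; ring
  obtain ⟨r₁, s₁, r₂, s₂, f₁, f₂, L₁, L₂, b1, b2, b3, b4, b5, b6, b7, b8, b9⟩ :=
    cone_one (show 1 ≤ 2 * Y ^ 2 by have := Nat.one_le_pow 2 Y hY; omega) (hb _ _ a1 a2)
      (hb _ _ a3 a4) K₁ K₂
  have hc : ∀ r s p q : ℕ, r ≤ 2 * Y ^ 2 → s ≤ 2 * Y ^ 2 → p ≤ Y → q ≤ Y →
      r * p + s * q ≤ 4 * Y ^ 3 := by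
    intro r s p q hr hs hp hq
    calc r * p + s * q ≤ 2 * Y ^ 2 * Y + 2 * Y ^ 2 * Y := by gcongr
      _ = 4 * Y ^ 3 := by ring
  have hYY : Y ≤ Y ^ 3 := Nat.le_self_pow (by norm_num) Y
  refine ⟨r₁ * p₁ + s₁ * p₂, r₁ * q₁ + s₁ * q₂, r₂ * p₁ + s₂ * p₂, r₂ * q₁ + s₂ * q₂,
    e₁ + (f₁ * p₁ + f₂ * p₂), e₂ + (f₁ * q₁ + f₂ * q₂), L₁, L₂, ?_, ?_, ?_, ?_, ?_, ?_, ?_, ?_, ?_,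
    ?_⟩
  · have := hc _ _ _ _ b1 b2 a1 a3; omega
  · have := hc _ _ _ _ b1 b2 a2 a4; omega
  · have := hc _ _ _ _ b3 b4 a1 a3; omega
  · have := hc _ _ _ _ b3 b4 a2 a4; omega
  · have := hc _ _ _ _ b5 b6 a1 a3; omega
  · have := hc _ _ _ _ b5 b6 a2 a4; omega
  · rw [a7, b7, b8]; ring
  · rw [a8, b7, b8]; ring
  · push_cast
    have e : ∀ r s : ℤ, v₁.1 * (r * p₁ + s * p₂) + v₂.1 * (r * q₁ + s * q₂) =
      r * (v₁.1 * p₁ + v₂.1 * q₁) + s * (v₁.1 * p₂ + v₂.1 * q₂) := fun r s => by ring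
    rw [e, e]
    refine a9.imp (fun h => ?_) fun h => ?_
    · have := h.1; have := h.2; constructor <;> positivity
    · constructor <;> exact add_nonpos (mul_nonpos_of_nonneg_of_nonpos (by positivity) h.1)
        (mul_nonpos_of_nonneg_of_nonpos (by positivity) h.2)
  · push_cast
    have e : ∀ r s : ℤ, v₁.2 * (r * p₁ + s * p₂) + v₂.2 * (r * q₁ + s * q₂) =
      (v₁.2 * p₁ + v₂.2 * q₁) * r + (v₁.2 * p₂ + v₂.2 * q₂) * s := fun r s => by ring
    rw [e, e]
    exact b9

end Cone

section Blocks

variable {Q E : Type} {A : Sys Q E}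

@[simp] theorem flat_nil : flat ([] : List (List E × ℕ)) = [] := rfl
@[simp] theorem flat_cons (b : List E × ℕ) (bs : List (List E × ℕ)) :
    flat (b :: bs) = pw b.1 b.2 ++ flat bs := rfl
@[simp] theorem bsz_nil : bsz ([] : List (List E × ℕ)) = 0 := rfl
@[simp] theorem bsz_cons (b : List E × ℕ) (bs : List (List E × ℕ)) :
    bsz (b :: bs) = b.1.length + bsz bs := by simp [bsz]

/-- Nonnegative powers cost at most the length of their words. -/
theorem Nn_flat_up {f : E → ℤ} {X : ℕ} {bs : List (List E × ℕ)} (hf : ∀ b ∈ bs, ∀ e ∈ b.1, |f e| ≤ X)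
    (hb : ∀ b ∈ bs, b.2 = 1 ∨ 0 ≤ sm f b.1) {a : ℤ} (ha : (bsz bs * X : ℕ) ≤ a) :
    Nn f a (flat bs) := by
  induction bs generalizing a with
  | nil => trivial
  | cons b bs ih =>
    rw [flat_cons, Nn_append]
    have h1 : (b.1.length * X : ℕ) + (bsz bs * X : ℕ) ≤ a := by
      rw [bsz_cons] at ha; push_cast at *; linarith
    have hab := abs_le.1 (abs_sm_le (hf b List.mem_cons_self))
    push_cast at h1
    have hX : (0 : ℤ) ≤ bsz bs * X := by positivity
    rcases hb b List.mem_cons_self with h | h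
    · rw [h, pw_one]
      refine ⟨Nn_of_len (hf b List.mem_cons_self) (by push_cast; linarith),
        ih (fun b hb => hf b (List.mem_cons_of_mem _ hb))
          (fun b' h' => hb b' (List.mem_cons_of_mem _ h')) (by push_cast; linarith)⟩
    · refine ⟨Nn_pw fun hn => ⟨?_, ?_⟩, ih (fun b hb => hf b (List.mem_cons_of_mem _ hb))
          (fun b' h' => hb b' (List.mem_cons_of_mem _ h')) ?_⟩
      · exact Nn_of_len (hf b List.mem_cons_self) (by push_cast; linarith)
      · refine Nn_of_len (hf b List.mem_cons_self) ?_
        have : (0 : ℤ) ≤ (b.2 - 1 : ℤ) * sm f b.1 := mul_nonneg (by omega) h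
        push_cast; linarith
      · rw [sm_pw]
        have : (0 : ℤ) ≤ (b.2 : ℤ) * sm f b.1 := by positivity
        push_cast
        have : (0 : ℤ) ≤ b.1.length * X := by positivity
        linarith

theorem Nn_flat_down {f : E → ℤ} {X : ℕ} {bs : List (List E × ℕ)}
    (hf : ∀ b ∈ bs, ∀ e ∈ b.1, |f e| ≤ X) (hb : ∀ b ∈ bs, b.2 = 1 ∨ sm f b.1 ≤ 0) {a : ℤ}
    (ha : (bsz bs * X : ℕ) ≤ a + sm f (flat bs)) : Nn f a (flat bs) := by
  have hz : bsz (bs.map fun b => (b.1.reverse, b.2)).reverse = bsz bs := by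
    simp [bsz, List.sum_reverse, Function.comp_def]
  have h := Nn_flat_up (f := fun e => -f e) (X := X)
    (bs := (bs.map fun b => (b.1.reverse, b.2)).reverse) (a := a + sm f (flat bs)) ?_ ?_ ?_
  · rw [← flat_reverse] at h
    have h' := Nn_reverse h (le_trans (by positivity) ha)
    simp only [neg_neg, List.reverse_reverse, sm_neg, sm_reverse] at h'
    rwa [add_neg_cancel_right] at h'
  · intro b hb' e he
    simp only [List.mem_reverse, List.mem_map] at hb'
    obtain ⟨b', h1, rfl⟩ := hb'
    rw [abs_neg]
    exact hf b' h1 e (by simpa using he)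
  · intro b hb'
    simp only [List.mem_reverse, List.mem_map] at hb'
    obtain ⟨b', h1, rfl⟩ := hb'
    exact (hb b' h1).imp id fun h => by simpa using h
  · rw [hz]; exact ha

end Blocks

section High

variable {Q E : Type} {A : Sys Q E}

theorem Sys.Bdd.abs_dt [Fintype Q] {X : ℕ} {u v : ℤ × ℤ} (hu : |u.1| ≤ (X : ℤ) ∧ |u.2| ≤ (X : ℤ))
    (hv : |v.1| ≤ (X : ℤ) ∧ |v.2| ≤ (X : ℤ)) : |dt u v| ≤ (2 * X ^ 2 : ℕ) := by
  calc |dt u v| ≤ |u.1 * v.2| + |u.2 * v.1| := abs_sub _ _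
    _ = |u.1| * |v.2| + |u.2| * |v.1| := by rw [abs_mul, abs_mul]
    _ ≤ X * X + X * X := by
      have := hu.1; have := hu.2; have := hv.1; have := hv.2
      gcongr
    _ = (2 * X ^ 2 : ℕ) := by push_cast; ring

/-- A multiple of every nonnegative combination of two independent cycles is the displacement of
a single cycle. -/
theorem exists_gen : ∃ F, PB F ∧ ∀ {Q E : Type} [Fintype Q] (A : Sys Q E) {X : ℕ}, A.Bdd X →
    ∀ {r : Q} {w : List E} {c₁ c₂ : Q × List E}, A.Walk r w r → w.length ≤ X → A.Cyc r w c₁ →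
    A.Cyc r w c₂ → ∀ {p q : ℕ}, p ≤ X → q ≤ X → (q = 0 ∨ dt (A.dp c₁.2) (A.dp c₂.2) ≠ 0) →
    ∃ s y t, A.Vis r w s ∧ A.Walk s y s ∧ y.length ≤ F X ∧ 0 < t ∧ t ≤ F X ∧
      A.dp y = (t : ℤ) • ((p : ℤ) • A.dp c₁.2 + (q : ℤ) • A.dp c₂.2) := by
  refine ⟨fun X => X * X + (4 * X ^ 4 + 1) +
    (2 * X ^ 4 * X + 2 * (((4 * X ^ 4 + 1) * X + 2 * X ^ 4) * X)), by fun_prop, ?_⟩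
  intro Q E _ A X hA r w c₁ c₂ hw hwX hc1 hc2 p q hp hq hdt
  beta_reduce
  have hl1 := hc1.2.1.trans hA.card
  have hl2 := hc2.2.1.trans hA.card
  have hX := hA.two
  by_cases hq0 : q = 0
  · refine ⟨c₁.1, pw c₁.2 p, 1, hc1.2.2, hc1.1.pw p, ?_, one_pos, by omega, by simp [hq0]⟩
    have : (pw c₁.2 p).length = p * c₁.2.length := by simp [pw]
    have := Nat.mul_le_mul hp hl1
    omega
  have hdt := hdt.resolve_left hq0
  obtain ⟨l₁, l₂, rfl, g1, g2⟩ := hw.split hc1.2.2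
  have hz : A.Walk c₁.1 (l₂ ++ l₁) c₁.1 := g2.append g1
  have hv2 : A.Vis c₁.1 (l₂ ++ l₁) c₂.1 := by
    have := hc2.2.2
    rw [Sys.vis_append g1] at this
    rw [Sys.vis_append g2]
    exact this.symm
  set u := A.dp c₁.2 with hu
  set v := A.dp c₂.2 with hv
  set z := A.dp (l₂ ++ l₁) with hzz
  have bu : |u.1| ≤ (X ^ 2 : ℕ) ∧ |u.2| ≤ (X ^ 2 : ℕ) := by rw [pow_two]; exact hA.dp hc1.1 hl1
  have bv : |v.1| ≤ (X ^ 2 : ℕ) ∧ |v.2| ≤ (X ^ 2 : ℕ) := by rw [pow_two]; exact hA.dp hc2.1 hl2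
  have hzl : (l₂ ++ l₁).length ≤ X := by rw [List.length_append] at hwX ⊢; omega
  have bz : |z.1| ≤ (X ^ 2 : ℕ) ∧ |z.2| ≤ (X ^ 2 : ℕ) := by rw [pow_two]; exact hA.dp hz hzl
  have d0 := Sys.Bdd.abs_dt (Q := Q) bu bv
  have d1 := Sys.Bdd.abs_dt (Q := Q) bz bv
  have d2 := Sys.Bdd.abs_dt (Q := Q) bu bz
  rw [← pow_mul, show 2 * 2 = 4 by norm_num] at d0 d1 d2
  obtain ⟨n, α, β, hn, hn', hα, hβ, he⟩ : ∃ (n : ℕ) (α β : ℤ), 0 < n ∧ n ≤ 2 * X ^ 4 ∧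
      |α| ≤ (2 * X ^ 4 : ℕ) ∧ |β| ≤ (2 * X ^ 4 : ℕ) ∧ (n : ℤ) • z = α • u + β • v := by
    have key : dt u v • z = dt z v • u + dt u z • v :=
      Prod.ext (by simp [dt]; ring) (by simp [dt]; ring)
    rcases le_or_gt 0 (dt u v) with h | h
    · refine ⟨(dt u v).toNat, dt z v, dt u z, by omega, ?_, d1, d2, ?_⟩
      · rw [abs_of_nonneg h] at d0; omega
      · rw [Int.toNat_of_nonneg h]; exact key
    · refine ⟨(-dt u v).toNat, -dt z v, -dt u z, by omega, ?_, by rwa [abs_neg], by rwa [abs_neg],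
        ?_⟩
      · rw [abs_of_neg h] at d0; omega
      · rw [Int.toNat_of_nonneg (by omega), neg_smul, key, neg_smul, neg_smul]; abel
  set t := α.natAbs + β.natAbs + 1 with ht
  have htX : t ≤ 4 * X ^ 4 + 1 := by
    rw [Int.abs_eq_natAbs] at hα hβ
    omega
  have hp' : 0 ≤ (t : ℤ) * p - α ∨ p = 0 := by
    rcases Nat.eq_zero_or_pos p with h | h
    · exact .inr h
    · left
      have : (t : ℤ) * 1 ≤ t * p := by gcongr; omega
      omega
  have hcop : ∀ m : ℕ, ∀ γ : ℤ, m ≤ X → |γ| ≤ (2 * X ^ 4 : ℕ) →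
      ((t : ℤ) * m - γ).toNat ≤ (4 * X ^ 4 + 1) * X + 2 * X ^ 4 := by
    intro m γ hm hγ
    have h1 : t * m ≤ (4 * X ^ 4 + 1) * X := by gcongr
    have h2 := abs_le.1 hγ
    zify at h1
    have : (t : ℤ) * m - γ ≤ (((4 * X ^ 4 + 1) * X + 2 * X ^ 4 : ℕ) : ℤ) := by
      push_cast at *; linarith
    omega
  have hq' : 0 ≤ (t : ℤ) * q - β := by
    have : (t : ℤ) * 1 ≤ t * q := by gcongr; omega
    omega
  by_cases hp0 : p = 0
  · refine ⟨c₂.1, pw c₂.2 q, 1, hc2.2.2, hc2.1.pw q, ?_, one_pos, by omega, by simp [hp0, hv]⟩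
    have : (pw c₂.2 q).length = q * c₂.2.length := by simp [pw]
    have := Nat.mul_le_mul hq hl2
    omega
  have hp' := hp'.resolve_right hp0
  have hvp : A.Vis c₁.1 (pw (l₂ ++ l₁) n) c₂.1 := by
    obtain ⟨n, rfl⟩ : ∃ m, n = m + 1 := ⟨n - 1, by omega⟩
    rw [pw_succ, Sys.vis_append hz]
    exact .inl hv2
  obtain ⟨y₁, a1, a2, a3, a4⟩ := (hz.pw n).insert hvp hc2.1 ((t : ℤ) * q - β).toNat
  obtain ⟨y₂, b1, b2, b3, b4⟩ := a1.insert (.inl rfl) hc1.1 ((t : ℤ) * p - α).toNat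
  refine ⟨c₁.1, y₂, t, hc1.2.2, b1, ?_, by omega, by omega, ?_⟩
  · have e0 : (pw (l₂ ++ l₁) n).length = n * (l₂ ++ l₁).length := by simp [pw]
    have e1 := Nat.mul_le_mul hn' hzl
    have e2 := Nat.mul_le_mul (hcop p α hp hα) hl1
    have e3 := Nat.mul_le_mul (hcop q β hq hβ) hl2
    rw [b2, a2]
    omega
  · rw [b4, a4, Sys.dp_pw, ← hzz, he, Int.toNat_of_nonneg hp', Int.toNat_of_nonneg hq', ← hu, ← hv]
    exact Prod.ext (by simp; ring) (by simp; ring)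

/-- Insertion of two powers of cycles into a walk, as a list of blocks. -/
theorem Sys.Walk.two_stars {p q s₁ s₂ : Q} {w y₁ y₂ : List E} (h : A.Walk p w q)
    (h₁ : A.Vis p w s₁) (h₂ : A.Vis p w s₂) (hy₁ : A.Walk s₁ y₁ s₁) (hy₂ : A.Walk s₂ y₂ s₂)
    (K₁ K₂ : ℕ) : ∃ bs, A.Blk bs ∧ bs.length ≤ 5 ∧ bsz bs = w.length + y₁.length + y₂.length ∧
      A.Walk p (flat bs) q ∧ A.dp (flat bs) = A.dp w + (K₁ : ℤ) • A.dp y₁ + (K₂ : ℤ) • A.dp y₂ ∧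
      (∀ b ∈ bs, b.2 = 1 ∨ b = (y₁, K₁) ∨ b = (y₂, K₂)) ∧ ∀ b ∈ bs, ∀ e ∈ b.1, e ∈ A.T := by
  obtain ⟨l₁, l₂, rfl, g1, g2⟩ := h.split h₁
  rw [Sys.vis_append g1] at h₂
  rcases h₂ with h₂ | h₂
  · obtain ⟨m₁, m₂, rfl, f1, f2⟩ := g1.split h₂
    refine ⟨[(m₁, 1), (y₂, K₂), (m₂, 1), (y₁, K₁), (l₂, 1)], ?_, by simp, ?_, ?_, ?_, by simp, ?_⟩
    · intro b hb
      simp only [List.mem_cons, List.not_mem_nil, or_false] at hb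
      rcases hb with rfl | rfl | rfl | rfl | rfl
      · exact .inl rfl
      · exact .inr ⟨_, hy₂⟩
      · exact .inl rfl
      · exact .inr ⟨_, hy₁⟩
      · exact .inl rfl
    · simp; omega
    · simpa using f1.append ((hy₂.pw K₂).append (f2.append ((hy₁.pw K₁).append g2)))
    · simp only [flat_cons, flat_nil, pw_one, Sys.dp_append, Sys.dp_pw, Sys.dp_nil]; abel
    · intro b hb
      simp only [List.mem_cons, List.not_mem_nil, or_false] at hb
      rcases hb with rfl | rfl | rfl | rfl | rfl
      exacts [f1.mem, hy₂.mem, f2.mem, hy₁.mem, g2.mem]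
  · obtain ⟨m₁, m₂, rfl, f1, f2⟩ := g2.split h₂
    refine ⟨[(l₁, 1), (y₁, K₁), (m₁, 1), (y₂, K₂), (m₂, 1)], ?_, by simp, ?_, ?_, ?_, by simp, ?_⟩
    · intro b hb
      simp only [List.mem_cons, List.not_mem_nil, or_false] at hb
      rcases hb with rfl | rfl | rfl | rfl | rfl
      · exact .inl rfl
      · exact .inr ⟨_, hy₁⟩
      · exact .inl rfl
      · exact .inr ⟨_, hy₂⟩
      · exact .inl rfl
    · simp; omega
    · simpa using g1.append ((hy₁.pw K₁).append (f1.append ((hy₂.pw K₂).append f2)))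
    · simp only [flat_cons, flat_nil, pw_one, Sys.dp_append, Sys.dp_pw, Sys.dp_nil]; abel
    · intro b hb
      simp only [List.mem_cons, List.not_mem_nil, or_false] at hb
      rcases hb with rfl | rfl | rfl | rfl | rfl
      exacts [g1.mem, hy₁.mem, f1.mem, hy₂.mem, f2.mem]

/-- Feasibility of blocks far from the boundary. -/
theorem Nn_flat_far {f : E → ℤ} {X : ℕ} {bs : List (List E × ℕ)} {y₁ y₂ : List E × ℕ}
    (hf : ∀ b ∈ bs, ∀ e ∈ b.1, |f e| ≤ X) (hb : ∀ b ∈ bs, b.2 = 1 ∨ b = y₁ ∨ b = y₂)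
    (hs : 0 ≤ sm f y₁.1 ∧ 0 ≤ sm f y₂.1 ∨ sm f y₁.1 ≤ 0 ∧ sm f y₂.1 ≤ 0) {a : ℤ}
    (ha : (bsz bs * X : ℕ) ≤ a) (ha' : (bsz bs * X : ℕ) ≤ a + sm f (flat bs)) :
    Nn f a (flat bs) := by
  rcases hs with hs | hs
  · refine Nn_flat_up hf (fun b h => (hb b h).imp id ?_) ha
    rintro (rfl | rfl)
    exacts [hs.1, hs.2]
  · refine Nn_flat_down hf (fun b h => (hb b h).imp id ?_) ha'
    rintro (rfl | rfl)
    exacts [hs.1, hs.2]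

/-- Closed walks between configurations with large counters are captured by few blocks. -/
theorem high_lp : ∃ F, PB F ∧ ∀ {Q E : Type} [Fintype Q] (A : Sys Q E) {X : ℕ}, A.Bdd X →
    ∀ {r : Q} {l : List E}, A.Walk r l r → ∀ {u v : ℤ × ℤ}, u + A.dp l = v → (F X : ℤ) ≤ u.1 →
    (F X : ℤ) ≤ u.2 → (F X : ℤ) ≤ v.1 → (F X : ℤ) ≤ v.2 → A.LP 5 (r, u) (F X) (r, v) := by
  obtain ⟨F₁, hF₁, H₁⟩ := eulcar
  obtain ⟨F₂, hF₂, H₂⟩ := exists_gen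
  refine ⟨fun X => ((F₁ X + 2 * ((5 * (X ^ 2) ^ 3 + 2 * (F₂ (F₁ X + 5 * (X ^ 2) ^ 3 + X) *
    (5 * (X ^ 2) ^ 3))) * X)) + 2 * F₂ (F₁ X + 5 * (X ^ 2) ^ 3 + X)) * X, by fun_prop, ?_⟩
  intro Q E _ A X hA r l hl u v huv hu1 hu2 hv1 hv2
  beta_reduce at hu1 hu2 hv1 hv2 ⊢
  obtain ⟨w, a1, a2, a3, c₁, c₂, k₁, k₂, a4, a5, a6, a7⟩ := H₁ A hA hl
  set B := 5 * (X ^ 2) ^ 3 with hB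
  set Z := F₁ X + B + X with hZ
  have hX := hA.two
  have hAZ : A.Bdd Z := hA.mono (by omega)
  have hl1 := a4.2.1.trans hA.card
  have hl2 := a5.2.1.trans hA.card
  have hB1 : 1 ≤ B := by
    have : 1 ≤ (X ^ 2) ^ 3 := Nat.one_le_pow _ _ (by positivity)
    omega
  obtain ⟨p₁, q₁, p₂, q₂, e₁, e₂, K₁, K₂, b1, b2, b3, b4, b5, b6, b7, b8, b9, b10, b11⟩ :
      ∃ p₁ q₁ p₂ q₂ e₁ e₂ K₁ K₂ : ℕ, p₁ ≤ B ∧ q₁ ≤ B ∧ p₂ ≤ B ∧ q₂ ≤ B ∧ e₁ ≤ B ∧ e₂ ≤ B ∧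
      k₁ = e₁ + K₁ * p₁ + K₂ * p₂ ∧ k₂ = e₂ + K₁ * q₁ + K₂ * q₂ ∧
      (0 ≤ (A.dp c₁.2).1 * p₁ + (A.dp c₂.2).1 * q₁ ∧ 0 ≤ (A.dp c₁.2).1 * p₂ + (A.dp c₂.2).1 * q₂ ∨
        (A.dp c₁.2).1 * p₁ + (A.dp c₂.2).1 * q₁ ≤ 0 ∧
          (A.dp c₁.2).1 * p₂ + (A.dp c₂.2).1 * q₂ ≤ 0) ∧
      (0 ≤ (A.dp c₁.2).2 * p₁ + (A.dp c₂.2).2 * q₁ ∧ 0 ≤ (A.dp c₁.2).2 * p₂ + (A.dp c₂.2).2 * q₂ ∨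
        (A.dp c₁.2).2 * p₁ + (A.dp c₂.2).2 * q₁ ≤ 0 ∧
          (A.dp c₁.2).2 * p₂ + (A.dp c₂.2).2 * q₂ ≤ 0) ∧
      ((q₁ = 0 ∧ q₂ = 0) ∨ dt (A.dp c₁.2) (A.dp c₂.2) ≠ 0) := by
    rcases a7 with ⟨rfl, -⟩ | h
    · refine ⟨1, 0, 0, 0, 0, 0, k₁, 0, hB1, by omega, by omega, by omega, by omega, by omega,
        by simp, by simp, ?_, ?_, .inl ⟨rfl, rfl⟩⟩
      · rcases le_total 0 (A.dp c₁.2).1 with h | h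
        · exact .inl ⟨by simpa, by simp⟩
        · exact .inr ⟨by simpa, by simp⟩
      · rcases le_total 0 (A.dp c₁.2).2 with h | h
        · exact .inl ⟨by simpa, by simp⟩
        · exact .inr ⟨by simpa, by simp⟩
    · have bu : |(A.dp c₁.2).1| ≤ (X ^ 2 : ℕ) ∧ |(A.dp c₁.2).2| ≤ (X ^ 2 : ℕ) := by
        rw [pow_two]; exact hA.dp a4.1 hl1
      have bv : |(A.dp c₂.2).1| ≤ (X ^ 2 : ℕ) ∧ |(A.dp c₂.2).2| ≤ (X ^ 2 : ℕ) := by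
        rw [pow_two]; exact hA.dp a5.1 hl2
      obtain ⟨p₁, q₁, p₂, q₂, e₁, e₂, K₁, K₂, b⟩ :=
        cone_two (Nat.one_le_pow 2 X (by omega)) bu bv k₁ k₂
      exact ⟨p₁, q₁, p₂, q₂, e₁, e₂, K₁, K₂, b.1, b.2.1, b.2.2.1, b.2.2.2.1, b.2.2.2.2.1,
        b.2.2.2.2.2.1, b.2.2.2.2.2.2.1, b.2.2.2.2.2.2.2.1, b.2.2.2.2.2.2.2.2.1,
        b.2.2.2.2.2.2.2.2.2, .inr h⟩
  obtain ⟨s₁, y₁, t₁, d1, d2, d3, d4, d5, d6⟩ := H₂ A hAZ a1 (by omega : w.length ≤ Z) a4 a5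
    (by omega : p₁ ≤ Z) (by omega : q₁ ≤ Z) (b11.imp (·.1) id)
  obtain ⟨s₂, y₂, t₂, e1, e2, e3, e4, e5, e6⟩ := H₂ A hAZ a1 (by omega : w.length ≤ Z) a4 a5
    (by omega : p₂ ≤ Z) (by omega : q₂ ≤ Z) (b11.imp (·.2) id)
  obtain ⟨w₁, f1, f2, f3, f4⟩ := a1.insert a4.2.2 a4.1 (e₁ + (K₁ % t₁ * p₁ + K₂ % t₂ * p₂))
  obtain ⟨w₂, g1, g2, g3, g4⟩ := f1.insert (f3 _ a5.2.2) a5.1 (e₂ + (K₁ % t₁ * q₁ + K₂ % t₂ * q₂))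
  obtain ⟨bs, i1, i2, i3, i4, i5, i6, i7⟩ :=
    g1.two_stars (g3 _ (f3 _ d1)) (g3 _ (f3 _ e1)) d2 e2 (K₁ / t₁) (K₂ / t₂)
  have hcop : ∀ e p p' : ℕ, e ≤ B → p ≤ B → p' ≤ B →
      e + (K₁ % t₁ * p + K₂ % t₂ * p') ≤ B + 2 * (F₂ Z * B) := by
    intro e p p' h1 h2 h3
    have := Nat.mul_le_mul ((Nat.mod_lt K₁ d4).le.trans d5) h2
    have := Nat.mul_le_mul ((Nat.mod_lt K₂ e4).le.trans e5) h3
    omega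
  have hsz : bsz bs ≤ (F₁ X + 2 * ((B + 2 * (F₂ Z * B)) * X)) + 2 * F₂ Z := by
    rw [i3, g2, f2]
    have := Nat.mul_le_mul (hcop e₁ p₁ p₂ b5 b1 b3) hl1
    have := Nat.mul_le_mul (hcop e₂ q₁ q₂ b6 b2 b4) hl2
    omega
  set N := (F₁ X + 2 * ((B + 2 * (F₂ Z * B)) * X)) + 2 * F₂ Z with hN
  have hszX : bsz bs * X ≤ N * X := Nat.mul_le_mul_right _ hsz
  have hdp : A.dp (flat bs) = A.dp l := by
    have m1 := Nat.div_add_mod K₁ t₁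
    have m2 := Nat.div_add_mod K₂ t₂
    rw [i5, g4, f4, d6, e6, a6, b7, b8, ← m1, ← m2]
    have m1' : (t₁ * (K₁ / t₁) + K₁ % t₁) / t₁ = K₁ / t₁ := by rw [m1]
    have m2' : (t₂ * (K₂ / t₂) + K₂ % t₂) / t₂ = K₂ / t₂ := by rw [m2]
    have m3' : (t₁ * (K₁ / t₁) + K₁ % t₁) % t₁ = K₁ % t₁ := by rw [m1]
    have m4' : (t₂ * (K₂ / t₂) + K₂ % t₂) % t₂ = K₂ % t₂ := by rw [m2]
    rw [m1', m2', m3', m4']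
    generalize K₁ / t₁ = x₁
    generalize K₂ / t₂ = x₂
    generalize K₁ % t₁ = z₁
    generalize K₂ % t₂ = z₂
    push_cast
    exact Prod.ext (by simp; ring) (by simp; ring)
  have hv : v = u + A.dp (flat bs) := by rw [hdp, huv]
  have hsgn : ∀ (y : List E) (t p q : ℕ), A.dp y = (t : ℤ) • ((p : ℤ) • A.dp c₁.2 + (q : ℤ) • A.dp c₂.2) →
      sm A.f y = t * ((A.dp c₁.2).1 * p + (A.dp c₂.2).1 * q) ∧
      sm A.g y = t * ((A.dp c₁.2).2 * p + (A.dp c₂.2).2 * q) := by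
    intro y t p q h
    have h1 := congrArg Prod.fst h
    have h2 := congrArg Prod.snd h
    simp only [Prod.smul_fst, Prod.fst_add, smul_eq_mul, Prod.smul_snd, Prod.snd_add] at h1 h2
    exact ⟨by rw [mul_comm _ (p : ℤ), mul_comm _ (q : ℤ)]; exact h1,
      by rw [mul_comm _ (p : ℤ), mul_comm _ (q : ℤ)]; exact h2⟩
  obtain ⟨n1, n2⟩ := hsgn _ _ _ _ d6
  obtain ⟨n3, n4⟩ := hsgn _ _ _ _ e6
  refine ⟨bs, i1, i2, ?_, i4, ?_, ?_, ?_, ?_⟩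
  · exact hsz.trans (Nat.le_mul_of_pos_right _ (by omega))
  · refine Nn_flat_far (X := X) (fun b hb e he => hA.f e (i7 b hb e he)) i6 ?_ ?_ ?_
    · rw [n1, n3]
      refine b9.imp (fun h => ?_) fun h => ?_
      · exact ⟨mul_nonneg (by positivity) h.1, mul_nonneg (by positivity) h.2⟩
      · exact ⟨mul_nonpos_of_nonneg_of_nonpos (by positivity) h.1,
          mul_nonpos_of_nonneg_of_nonpos (by positivity) h.2⟩
    · exact le_trans (by exact_mod_cast hszX) hu1
    · have := congrArg Prod.fst hv
      simp only [Prod.fst_add, Sys.dp] at this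
      rw [← this]
      exact le_trans (by exact_mod_cast hszX) hv1
  · refine Nn_flat_far (X := X) (fun b hb e he => hA.g e (i7 b hb e he)) i6 ?_ ?_ ?_
    · rw [n2, n4]
      refine b10.imp (fun h => ?_) fun h => ?_
      · exact ⟨mul_nonneg (by positivity) h.1, mul_nonneg (by positivity) h.2⟩
      · exact ⟨mul_nonpos_of_nonneg_of_nonpos (by positivity) h.1,
          mul_nonpos_of_nonneg_of_nonpos (by positivity) h.2⟩
    · exact le_trans (by exact_mod_cast hszX) hu2
    · have := congrArg Prod.snd hv
      simp only [Prod.snd_add, Sys.dp] at this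
      rw [← this]
      exact le_trans (by exact_mod_cast hszX) hv2
  · exact congrArg Prod.fst hv
  · exact congrArg Prod.snd hv

end High

section Plain

theorem exists_last_of {P : ℕ → Prop} {l i : ℕ} (hi : i ≤ l) (h : P i) :
    ∃ j, i ≤ j ∧ j ≤ l ∧ P j ∧ ∀ k ≤ l, j < k → ¬ P k := by
  classical
  refine ⟨Nat.findGreatest P l, Nat.le_findGreatest hi h, Nat.findGreatest_le l,
    Nat.findGreatest_spec hi h, fun k hk hjk => Nat.findGreatest_is_greatest hjk hk⟩

theorem Sys.Seq.lp_step {Q E : Type} {A : Sys Q E} {l : ℕ} {c : ℕ → Cfg Q} (h : A.Seq l c) {i : ℕ}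
    (hi : i < l) : A.LP 1 (c i) 1 (c (i + 1)) :=
  ((h.1 i hi).sf (h.2 _ hi)).lp

theorem seq_lp : ∃ F, PB F ∧ ∀ {Q E : Type} [Fintype Q] (A : Sys Q E) {X : ℕ}, A.Bdd X →
    ∀ {l : ℕ} {c : ℕ → Cfg Q}, A.Seq l c →
    A.LP (14 * Fintype.card Q + 7) (c 0) (F X) (c l) := by
  obtain ⟨FL, hFL, low⟩ := low_lp
  obtain ⟨FH, hFH, high⟩ := high_lp
  refine ⟨fun X => (X + 1) * (FL (FH X + X) + FH X + 2),
    PB.mul (PB.add PB.id (PB.const 1)) (PB.add (PB.add (hFL.comp (hFH.add PB.id)) hFH) (PB.const 2)),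
    ?_⟩
  intro Q E _ A X hA
  classical
  set D := FH X + X with hD
  set B := FL D + FH X + 2 with hB
  suffices H : ∀ (S : Finset Q) {l : ℕ} {c : ℕ → Cfg Q}, A.Seq l c →
      (∀ i ≤ l, (D : ℤ) ≤ (c i).2.1 → (D : ℤ) ≤ (c i).2.2 → (c i).1 ∈ S) →
      A.LP (14 * S.card + 7) (c 0) ((S.card + 1) * B) (c l) by
    intro l c h
    refine (H Finset.univ h fun _ _ _ _ => Finset.mem_univ _).mono le_rfl ?_
    exact Nat.mul_le_mul_right _ (Nat.succ_le_succ hA.card)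
  intro S
  induction S using Finset.strongInduction with
  | _ S ih =>
  intro l c h hS
  have lowcase : ∀ {l : ℕ} {c : ℕ → Cfg Q}, A.Seq l c →
      (∀ i ≤ l, ¬ ((D : ℤ) ≤ (c i).2.1 ∧ (D : ℤ) ≤ (c i).2.2)) → A.LP 7 (c 0) (FL D) (c l) := by
    intro l c h hc
    refine low A hA (by omega) h fun i hi => ?_
    have := hc i hi
    omega
  by_cases hex : ∃ i, i ≤ l ∧ (D : ℤ) ≤ (c i).2.1 ∧ (D : ℤ) ≤ (c i).2.2
  swap
  · push Not at hex
    refine (lowcase h fun i hi h2 => ?_).mono (by omega) ?_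
    · have := hex i hi h2.1; omega
    · nlinarith
  obtain ⟨i, ⟨hil, hi1, hi2⟩, hmin⟩ : ∃ i, (i ≤ l ∧ (D : ℤ) ≤ (c i).2.1 ∧ (D : ℤ) ≤ (c i).2.2) ∧
      ∀ m < i, ¬ (m ≤ l ∧ (D : ℤ) ≤ (c m).2.1 ∧ (D : ℤ) ≤ (c m).2.2) :=
    ⟨Nat.find hex, Nat.find_spec hex, fun _ => Nat.find_min hex⟩
  obtain ⟨j, hij, hjl, ⟨hjr, hj1, hj2⟩, hlast⟩ := exists_last_of
    (P := fun j => (c j).1 = (c i).1 ∧ (D : ℤ) ≤ (c j).2.1 ∧ (D : ℤ) ≤ (c j).2.2) hil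
    ⟨rfl, hi1, hi2⟩
  have h1 : A.LP 8 (c 0) (FL D + 1) (c i) := by
    rcases Nat.eq_zero_or_pos i with h0 | h0
    · rw [h0]; exact (Sys.LP.nil _).mono (by omega) (by omega)
    · have h2 := lowcase (h.sub (i := 0) (j := i - 1) (by omega)) (fun t ht h3 => by
        simp only [Nat.zero_add] at h3
        exact hmin t (by omega) ⟨by omega, h3⟩)
      simp only [Nat.zero_add] at h2
      have h3 := h.lp_step (i := i - 1) (by omega)
      rw [Nat.sub_add_cancel h0] at h3
      exact h2.trans h3
  have h2 : A.LP 5 (c i) (FH X) (c j) := by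
    obtain ⟨p, _, hp⟩ := (h.sub (i := i) (j := j - i) (by omega)).sf
    simp only [Nat.add_zero, Nat.add_sub_cancel' hij] at hp
    obtain ⟨hw, _, _, e1, e2⟩ := hp
    rw [hjr] at hw
    have := high A hA hw (u := (c i).2) (v := (c j).2)
      (Prod.ext (by simp [Sys.dp, e1]) (by simp [Sys.dp, e2])) (by omega) (by omega) (by omega)
      (by omega)
    convert this using 1
    exact Prod.ext hjr rfl
  have h12 := h1.trans h2
  have hiS := hS i hil hi1 hi2
  have hpos : 0 < S.card := Finset.card_pos.2 ⟨_, hiS⟩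
  rcases hjl.eq_or_lt with rfl | hjl'
  · refine h12.mono (by omega) ?_
    nlinarith
  · have h3 := ih (S.erase (c i).1) (Finset.erase_ssubset hiS)
      (h.sub (i := j + 1) (j := l - (j + 1)) (by omega)) (fun t ht k1 k2 => Finset.mem_erase.2
        ⟨fun k3 => hlast (j + 1 + t) (by omega) (by omega) ⟨k3, k1, k2⟩, hS _ (by omega) k1 k2⟩)
    simp only [Nat.add_zero, Nat.add_sub_cancel' (show j + 1 ≤ l from hjl')] at h3
    rw [Finset.card_erase_of_mem hiS] at h3
    refine ((h12.trans (h.lp_step hjl')).trans h3).mono (by omega) ?_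
    rw [Nat.sub_add_cancel hpos]
    nlinarith

/-- Every run of a two-counter system without zero-tests can be replaced by one along linearly many
blocks of polynomial total size. -/
theorem plain_lp : ∃ F, PB F ∧ ∀ {Q E : Type} [Fintype Q] (A : Sys Q E) {X : ℕ}, A.Bdd X →
    ∀ {l : List E} {a b : Cfg Q}, Pos a → A.Run a l b →
    A.LP (14 * Fintype.card Q + 7) a (F X) b := by
  obtain ⟨F, hF, H⟩ := seq_lp
  refine ⟨F, hF, fun A X hA l a b ha h => ?_⟩
  obtain ⟨c, hc, rfl, rfl⟩ := h.exists_seq ha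
  exact H A hA hc

end Plain

section Exponents

open Finset

/-- A sequence of heights with a high peak crosses some long interval upwards in one step before the
peak and downwards in one step after the peak, staying above the interval in between. -/
theorem exists_crossing {h : ℕ → ℤ} {K P D : ℕ} (hP : P ≤ K) (h0 : h 0 ≤ 0)
    (hK : h K ≤ 0) (hpeak : ((K * K + 1) * D : ℕ) < h P) :
    ∃ (a : ℤ) (i j : ℕ), 0 ≤ a ∧ i < j ∧ j < K ∧ h i ≤ a ∧ h (j + 1) ≤ a ∧
      ∀ l, i < l → l ≤ j → a + D ≤ h l := by
  have key : ∀ m ∈ Finset.Icc 1 (K * K + 1), ∃ ij : ℕ × ℕ, ij.1 < P ∧ P ≤ ij.2 ∧ ij.2 < K ∧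
      h ij.1 ≤ (m * D : ℕ) ∧ h (ij.2 + 1) ≤ (m * D : ℕ) ∧
      ∀ l, ij.1 < l → l ≤ ij.2 → ((m * D : ℕ) : ℤ) < h l := by
    intro m hm
    have hm' := Finset.mem_Icc.1 hm
    have hle : ((m * D : ℕ) : ℤ) < h P :=
      lt_of_le_of_lt (by exact_mod_cast Nat.mul_le_mul_right D hm'.2) hpeak
    have hnn : (0 : ℤ) ≤ (m * D : ℕ) := by positivity
    obtain ⟨i, _, h1, h2, h3⟩ := exists_last_le h (Nat.zero_le P) (h0.trans hnn) hle
    obtain ⟨j, h4, h5, h6, h7⟩ := exists_first_le h hP hle (hK.trans hnn)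
    refine ⟨(i, j - 1), h1, by dsimp only; omega, by dsimp only; omega, h2, ?_, ?_⟩
    · rwa [show j - 1 + 1 = j by omega]
    · intro l hl hl'
      dsimp only at hl hl'
      rcases le_total l P with h8 | h8
      · exact h3 l hl h8
      · exact h7 l h8 (by omega)
  choose! F hF using key
  obtain ⟨m, hm, m', hm', hne, heq⟩ := Finset.exists_ne_map_eq_of_card_lt_of_maps_to
    (s := Finset.Icc 1 (K * K + 1)) (t := Finset.range K ×ˢ Finset.range K) (f := F)
    (by simp) (fun m hm => by
      have := hF m hm
      simp only [Finset.coe_product, Set.mem_prod, Finset.mem_coe, Finset.mem_range]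
      omega)
  wlog hlt : m < m' generalizing m m'
  · exact this m' hm' m hm hne.symm heq.symm (by omega)
  obtain ⟨h1, h2, h3, h4, h5, h6⟩ := hF m hm
  obtain ⟨k1, k2, k3, k4, k5, k6⟩ := hF m' hm'
  rw [← heq] at k1 k2 k3 k4 k5 k6
  refine ⟨(m * D : ℕ), (F m).1, (F m).2, by positivity, by omega, h3, h4, h5, fun l hl hl' => ?_⟩
  have := k6 l hl hl'
  have h7 : (m + 1) * D ≤ m' * D := Nat.mul_le_mul_right D hlt
  have h8 : m * D + D ≤ m' * D := by linarith
  have : ((m * D + D : ℕ) : ℤ) ≤ (m' * D : ℕ) := by exact_mod_cast h8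
  push_cast at *
  omega

/-- Height before block `l`, starting from `v`, with block weights `φ` and exponents `k`. -/
def hg (φ : ℕ → ℤ) (v : ℤ) (k : ℕ → ℕ) (l : ℕ) : ℤ := v + ∑ i ∈ range l, (k i : ℤ) * φ i

theorem hg_succ (φ : ℕ → ℤ) (v : ℤ) (k : ℕ → ℕ) (l : ℕ) :
    hg φ v k (l + 1) = hg φ v k l + k l * φ l := by
  simp [hg, Finset.sum_range_succ, add_assoc]

@[simp] theorem hg_zero (φ : ℕ → ℤ) (v : ℤ) (k : ℕ → ℕ) : hg φ v k 0 = v := by simp [hg]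

/-- Add `p` to exponent `i` and `q` to exponent `j`. -/
def md (k : ℕ → ℕ) (i j p q : ℕ) : ℕ → ℕ :=
  fun l => k l + (if l = i then p else 0) + (if l = j then q else 0)

theorem hg_md (φ : ℕ → ℤ) (v : ℤ) (k : ℕ → ℕ) (i j p q l : ℕ) :
    hg φ v (md k i j p q) l =
      hg φ v k l + (if i < l then p * φ i else 0) + (if j < l then q * φ j else 0) := by
  simp [hg, md, add_mul, Finset.sum_add_distrib, ite_mul, add_assoc]

theorem abs_hg_le {φ : ℕ → ℤ} {k : ℕ → ℕ} {K H N : ℕ} (hφ : ∀ l < K, |φ l| ≤ N)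
    (hk : ∀ l < K, k l ≤ H) : |hg φ 0 k K| ≤ (K * (H * N) : ℕ) := by
  rw [hg, zero_add]
  refine (Finset.abs_sum_le_sum_abs _ _).trans ?_
  refine (Finset.sum_le_card_nsmul (range K) _ ((H * N : ℕ) : ℤ) fun l hl => ?_).trans ?_
  · rw [abs_mul, Nat.abs_cast, Nat.cast_mul]
    have := Finset.mem_range.1 hl
    exact mul_le_mul (by exact_mod_cast hk l this) (hφ l this) (abs_nonneg _) (by positivity)
  · simp

/-- Feasibility of a sequence of powers of blocks, in terms of the first and last copies. -/
def Fe (K : ℕ) (ok : ℕ → ℤ → Prop) (φ : ℕ → ℤ) (v : ℤ) (k : ℕ → ℕ) : Prop :=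
  (∀ l ≤ K, 0 ≤ hg φ v k l) ∧ ∀ l < K, ok l (hg φ v k l) ∧ ok l (hg φ v k (l + 1) - φ l)

/-- Data of a sequence of `K` blocks: weights `φ` bounded by `N`, monotone feasibility conditions
`ok`, the set `act` of blocks whose exponent may be changed, and bounds `cap` for the other
exponents. -/
structure NS where
  K : ℕ
  N : ℕ
  T : ℕ
  φ : ℕ → ℤ
  ok : ℕ → ℤ → Prop
  act : ℕ → Prop
  cap : ℕ → ℕ
  one : 1 ≤ N
  cap_le : ∀ l, cap l ≤ T
  bd : ∀ l < K, |φ l| ≤ N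
  mono : ∀ l v w, ok l v → v ≤ w → ok l w
  high : ∀ l v, l < K → (N : ℤ) ≤ v → ok l v

variable (B : NS)

/-- Valid exponents: a feasible sequence from height `0` to height `0`. -/
def NS.Val (k : ℕ → ℕ) : Prop :=
  (∀ l < B.K, 1 ≤ k l ∧ (¬ B.act l → k l ≤ B.cap l)) ∧ Fe B.K B.ok B.φ 0 k ∧ hg B.φ 0 k B.K = 0

/-- Balanced changes of the exponents: a block of weight `0`, or a pair of an upward block and
a later downward block. -/
def NS.Pr (i j p q : ℕ) : Prop :=
  i < B.K ∧ j < B.K ∧ B.act i ∧ B.act j ∧ p ≤ B.N ∧ q ≤ B.N ∧ 1 ≤ p ∧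
    ((i = j ∧ B.φ i = 0 ∧ p = 1 ∧ q = 0) ∨
      (i < j ∧ 0 < B.φ i ∧ B.φ j < 0 ∧ (p : ℤ) = -B.φ j ∧ (q : ℤ) = B.φ i))

variable {B}

theorem NS.fe_of {v : ℤ} {k k' : ℕ → ℕ} (h : Fe B.K B.ok B.φ v k)
    (hk : ∀ l ≤ B.K, hg B.φ v k l ≤ hg B.φ v k' l ∨ (2 * B.N : ℕ) ≤ hg B.φ v k' l) :
    Fe B.K B.ok B.φ v k' := by
  refine ⟨fun l hl => ?_, fun l hl => ⟨?_, ?_⟩⟩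
  · have := h.1 l hl
    rcases hk l hl with h1 | h1 <;> omega
  · rcases hk l hl.le with h1 | h1
    · exact B.mono l _ _ (h.2 l hl).1 h1
    · exact B.high l _ hl (by omega)
  · have := abs_le.1 (B.bd l hl)
    rcases hk (l + 1) hl with h1 | h1
    · exact B.mono l _ _ (h.2 l hl).2 (by omega)
    · exact B.high l _ hl (by omega)

/-- Lower some exponents. -/
def lw (k : ℕ → ℕ) (i j p q : ℕ) : ℕ → ℕ :=
  fun l => k l - ((if l = i then p else 0) + (if l = j then q else 0))

theorem md_lw {k : ℕ → ℕ} {i j p q : ℕ} (hij : i ≠ j) (hi : p ≤ k i) (hj : q ≤ k j) :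
    md (lw k i j p q) i j p q = k := by
  funext l
  simp only [md, lw]
  split_ifs with h1 h2 h2
  · omega
  · subst h1; omega
  · subst h2; omega
  · omega

theorem le_lw {k : ℕ → ℕ} {i j p q l : ℕ} (hij : i ≠ j) (hl : 1 ≤ k l) (hi : p + 1 ≤ k i)
    (hj : q + 1 ≤ k j) : 1 ≤ lw k i j p q l := by
  simp only [lw]
  split_ifs with h1 h2 h2
  · omega
  · subst h1; omega
  · subst h2; omega
  · omega

theorem NS.Pr.bal {i j p q : ℕ} (h : B.Pr i j p q) : (p : ℤ) * B.φ i + q * B.φ j = 0 := by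
  obtain ⟨_, _, _, _, _, _, _, ⟨rfl, h1, rfl, rfl⟩ | ⟨_, _, _, h1, h2⟩⟩ := h
  · simp [h1]
  · rw [h1, h2]; ring

theorem NS.Pr.nonneg {i j p q : ℕ} (h : B.Pr i j p q) : 0 ≤ B.φ i := by
  obtain ⟨_, _, _, _, _, _, _, ⟨rfl, h1, rfl, rfl⟩ | ⟨_, h1, _, _, _⟩⟩ := h <;> omega

theorem NS.Pr.le {i j p q : ℕ} (h : B.Pr i j p q) : i ≤ j := by
  obtain ⟨_, _, _, _, _, _, _, ⟨rfl, h1, rfl, rfl⟩ | ⟨_, h1, _, _, _⟩⟩ := h <;> omega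

/-- A balanced change changes heights only between its blocks. -/
theorem NS.Pr.hg_md {i j p q : ℕ} (h : B.Pr i j p q) (m : ℕ) (k : ℕ → ℕ) (v : ℤ) (l : ℕ) :
    hg B.φ v (md k i j (m * p) (m * q)) l =
      hg B.φ v k l + if i < l ∧ l ≤ j then (m * p : ℤ) * B.φ i else 0 := by
  have h1 := h.bal
  have h2 := h.le
  rw [TVASSpaper.hg_md]
  push_cast
  by_cases h3 : i < l <;> by_cases h4 : j < l
  · rw [if_pos h3, if_pos h4, if_neg (by omega)]; linear_combination (m : ℤ) * h1
  · rw [if_pos h3, if_neg h4, if_pos (by omega)]; ring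
  · omega
  · rw [if_neg h3, if_neg h4, if_neg (by omega)]; ring

theorem NS.Pr.hg_le_md {i j p q : ℕ} (h : B.Pr i j p q) (m : ℕ) (k : ℕ → ℕ) (v : ℤ) (l : ℕ) :
    hg B.φ v k l ≤ hg B.φ v (md k i j (m * p) (m * q)) l := by
  rw [h.hg_md]
  have := h.nonneg
  split_ifs
  · have : (0 : ℤ) ≤ (m * p : ℤ) * B.φ i := by positivity
    omega
  · omega

theorem NS.Pr.hg_md_K {i j p q : ℕ} (h : B.Pr i j p q) (γ : ℕ → ℤ) (m : ℕ) (k : ℕ → ℕ) (v : ℤ) :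
    hg γ v (md k i j (m * p) (m * q)) B.K = hg γ v k B.K + m * (p * γ i + q * γ j) := by
  rw [TVASSpaper.hg_md, if_pos h.1, if_pos h.2.1]
  push_cast; ring

theorem NS.Val.md {k : ℕ → ℕ} (hk : B.Val k) {i j p q : ℕ} (h : B.Pr i j p q) (m : ℕ) :
    B.Val (md k i j (m * p) (m * q)) := by
  refine ⟨fun l hl => ⟨?_, fun hl' => ?_⟩, ?_, ?_⟩
  · have := (hk.1 l hl).1
    simp only [TVASSpaper.md]; omega
  · have := (hk.1 l hl).2 hl'
    have h1 : l ≠ i := by rintro rfl; exact hl' h.2.2.1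
    have h2 : l ≠ j := by rintro rfl; exact hl' h.2.2.2.1
    simpa [TVASSpaper.md, h1, h2] using this
  · exact B.fe_of hk.2.1 fun l _ => .inl (h.hg_le_md m k 0 l)
  · rw [h.hg_md_K, h.bal, hk.2.2]; ring

/-- Threshold for the exponents. -/
def NS.H (B : NS) (M D : ℕ) : ℕ := (B.K * B.K + 1) * (D + B.N * (M * B.N + B.T + 3)) + M + B.T

/-- Large exponents admit removing a balanced change, at large heights. -/
theorem NS.Val.exists_remove {k : ℕ → ℕ} (hk : B.Val k) {M D : ℕ} (hM : 1 ≤ M)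
    (hbig : ¬ ∀ l < B.K, k l ≤ B.H M D) :
    ∃ k' i j p q, B.Pr i j p q ∧ k = TVASSpaper.md k' i j (M * p) (M * q) ∧ B.Val k' ∧
      ∀ l, i < l → l ≤ j → (D : ℤ) ≤ hg B.φ 0 k' l := by
  obtain ⟨W, hW⟩ : ∃ W, W = D + B.N * (M * B.N + B.T + 3) := ⟨_, rfl⟩
  have hH : B.H M D = (B.K * B.K + 1) * W + M + B.T := by rw [hW]; rfl
  have hone := B.one
  have hWN : B.N * (M * B.N + B.T + 3) ≤ W := by omega
  have hW1 : 1 ≤ W := by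
    have : 0 < B.N * (M * B.N + B.T + 3) := by positivity
    omega
  push Not at hbig
  obtain ⟨l₀, hl₀, hbig⟩ := hbig
  have hact : B.act l₀ := by
    by_contra h
    have := ((hk.1 l₀ hl₀).2 h).trans (B.cap_le l₀)
    omega
  by_cases hz : B.φ l₀ = 0
  · -- remove copies of a block of weight zero
    have hMk : M + 1 ≤ k l₀ := by nlinarith
    refine ⟨fun l => k l - (if l = l₀ then M else 0), l₀, l₀, 1, 0,
      ⟨hl₀, hl₀, hact, hact, hone, Nat.zero_le _, le_rfl, .inl ⟨rfl, hz, rfl, rfl⟩⟩, ?_, ?_,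
      fun l h1 h2 => by omega⟩
    · funext l
      simp only [TVASSpaper.md]
      split_ifs with h
      · subst h; omega
      · omega
    · have heq : ∀ v l, hg B.φ v (fun l => k l - (if l = l₀ then M else 0)) l = hg B.φ v k l := by
        intro v l
        simp only [hg]
        congr 1
        refine Finset.sum_congr rfl fun t _ => ?_
        split_ifs with h
        · simp [h, hz]
        · simp
      refine ⟨fun l hl => ⟨?_, fun h => ?_⟩, B.fe_of hk.2.1 fun l _ => .inl (heq 0 l).ge, ?_⟩
      · have := (hk.1 l hl).1
        dsimp only
        split_ifs with h
        · subst h; omega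
        · omega
      · have := (hk.1 l hl).2 h
        dsimp only; omega
      · rw [heq, hk.2.2]
  · obtain ⟨P, hP, hpeak⟩ : ∃ P ≤ B.K, (((B.K * B.K + 1) * W : ℕ) : ℤ) < hg B.φ 0 k P := by
      by_contra! hcon
      have h1 := hcon (l₀ + 1) hl₀
      have h2 := hcon l₀ hl₀.le
      have h3 := hk.2.1.1 (l₀ + 1) hl₀
      have h4 := hk.2.1.1 l₀ hl₀.le
      rw [hg_succ] at h1 h3
      have h5 : (((B.K * B.K + 1) * W : ℕ) : ℤ) < k l₀ := by
        have : (B.K * B.K + 1) * W < k l₀ := by omega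
        exact_mod_cast this
      rcases lt_or_gt_of_ne hz with h6 | h6 <;> nlinarith
    obtain ⟨a, i, j, ha, hij, hj, h1, h2, h3⟩ := exists_crossing hP (by simp)
      hk.2.2.le hpeak
    have hiK : i < B.K := hij.trans hj
    have hbi := abs_le.1 (B.bd i hiK)
    have hbj := abs_le.1 (B.bd j hj)
    have hup := h3 (i + 1) (by omega) (by omega)
    have hdn := h3 j hij le_rfl
    rw [hg_succ] at hup h2
    have hW' : (B.N : ℤ) * (M * B.N + B.T + 3) ≤ W := by exact_mod_cast hWN
    have hone' : (1 : ℤ) ≤ B.N := by exact_mod_cast hone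
    have hki : (W : ℤ) ≤ k i * B.φ i := by linarith
    have hkj : (W : ℤ) ≤ k j * (-B.φ j) := by linarith
    have hW0 : (0 : ℤ) < W := by exact_mod_cast hW1
    have hφi : 0 < B.φ i := by
      by_contra h
      have : (k i : ℤ) * B.φ i ≤ 0 := mul_nonpos_of_nonneg_of_nonpos (by positivity) (by omega)
      linarith
    have hφj : B.φ j < 0 := by
      by_contra h
      have : (k j : ℤ) * (-B.φ j) ≤ 0 := mul_nonpos_of_nonneg_of_nonpos (by positivity) (by omega)
      linarith
    have hki' : M * B.N + B.T + 3 ≤ k i := by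
      have : (B.N : ℤ) * (M * B.N + B.T + 3) ≤ B.N * k i := by nlinarith
      exact_mod_cast le_of_mul_le_mul_left this (by linarith)
    have hkj' : M * B.N + B.T + 3 ≤ k j := by
      have : (B.N : ℤ) * (M * B.N + B.T + 3) ≤ B.N * k j := by nlinarith
      exact_mod_cast le_of_mul_le_mul_left this (by linarith)
    obtain ⟨p, hp⟩ : ∃ p : ℕ, (p : ℤ) = -B.φ j := ⟨(-B.φ j).toNat, by omega⟩
    obtain ⟨q, hq⟩ : ∃ q : ℕ, (q : ℤ) = B.φ i := ⟨(B.φ i).toNat, by omega⟩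
    have hpN : p ≤ B.N := by omega
    have hqN : q ≤ B.N := by omega
    have hMp : M * p ≤ M * B.N := Nat.mul_le_mul_left _ hpN
    have hMq : M * q ≤ M * B.N := Nat.mul_le_mul_left _ hqN
    have hacti : B.act i := by
      by_contra h
      have := ((hk.1 i hiK).2 h).trans (B.cap_le i)
      omega
    have hactj : B.act j := by
      by_contra h
      have := ((hk.1 j hj).2 h).trans (B.cap_le j)
      omega
    have hPr : B.Pr i j p q :=
      ⟨hiK, hj, hacti, hactj, hpN, hqN, by omega, .inr ⟨hij, hφi, hφj, hp, hq⟩⟩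
    obtain ⟨k', hk'⟩ : ∃ k', k' = lw k i j (M * p) (M * q) := ⟨_, rfl⟩
    have hmd : k = TVASSpaper.md k' i j (M * p) (M * q) := by
      rw [hk', md_lw hij.ne (by omega) (by omega)]
    have hhg : ∀ l, hg B.φ 0 k l =
        hg B.φ 0 k' l + if i < l ∧ l ≤ j then (M * p : ℤ) * B.φ i else 0 := by
      intro l
      conv_lhs => rw [hmd]
      exact hPr.hg_md M k' 0 l
    have hMpi : (M * p : ℤ) * B.φ i ≤ M * B.N * B.N := by
      have h1 : (M * p : ℤ) ≤ M * B.N := by exact_mod_cast hMp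
      exact mul_le_mul h1 hbi.2 hφi.le (by positivity)
    have hmid : ∀ l, i < l → l ≤ j → (D + 2 * B.N : ℤ) ≤ hg B.φ 0 k' l := by
      intro l h4 h5
      have h6 := h3 l h4 h5
      rw [hhg, if_pos ⟨h4, h5⟩] at h6
      have h7 : (W : ℤ) = D + B.N * (M * B.N + B.T + 3) := by exact_mod_cast hW
      have h8 : (0 : ℤ) ≤ B.N * B.T := by positivity
      linarith
    refine ⟨k', i, j, p, q, hPr, hmd, ⟨fun l hl => ⟨?_, fun h => ?_⟩, ?_, ?_⟩, fun l h4 h5 => ?_⟩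
    · rw [hk']
      exact le_lw hij.ne (hk.1 l hl).1 (by omega) (by omega)
    · rw [hk']
      exact (Nat.sub_le _ _).trans ((hk.1 l hl).2 h)
    · refine B.fe_of hk.2.1 fun l hl => ?_
      by_cases h4 : i < l ∧ l ≤ j
      · have := hmid l h4.1 h4.2
        right; push_cast; linarith
      · left
        rw [hhg, if_neg h4, add_zero]
    · have := hhg B.K
      rw [if_neg (by omega), add_zero] at this
      rw [← this, hk.2.2]
    · have := hmid l h4 h5
      linarith

end Exponents

section Reduce

open Finset

variable {B : NS}

/-- No balanced change increases the weight `γ`. -/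
def NS.NV (B : NS) (γ : ℕ → ℤ) : Prop :=
  ∀ i j p q, B.Pr i j p q → (p : ℤ) * γ i + q * γ j ≤ 0

theorem NS.Pr.sum_lt {i j p q M : ℕ} (h : B.Pr i j p q) (hM : 1 ≤ M) (k : ℕ → ℕ) :
    ∑ l ∈ range B.K, k l < ∑ l ∈ range B.K, md k i j (M * p) (M * q) l := by
  refine Finset.sum_lt_sum (fun l _ => by simp only [md]; omega)
    ⟨i, Finset.mem_range.2 h.1, ?_⟩
  have : 0 < M * p := Nat.mul_pos hM h.2.2.2.2.2.2.1
  simp only [md, if_true]; omega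

theorem exists_md_of_le {k k' : ℕ → ℕ} {i j p q : ℕ} (h : ∀ l, md k' i j p q l ≤ k l) :
    ∃ k'', k = md k'' i j p q ∧ ∀ l, k' l ≤ k'' l := by
  refine ⟨lw k i j p q, funext fun l => ?_, fun l => ?_⟩ <;>
  · have := h l
    simp only [md, lw] at *
    omega

/-- Reduce the exponents modulo `M`. -/
theorem NS.Val.reduce {k : ℕ → ℕ} (hk : B.Val k) {M : ℕ} (hM : 1 ≤ M) :
    ∃ k', B.Val k' ∧ (∀ l < B.K, k' l ≤ B.H M 0) ∧ ∀ γ : ℕ → ℤ,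
      (M : ℤ) ∣ hg γ 0 k B.K - hg γ 0 k' B.K ∧ (B.NV γ → hg γ 0 k B.K ≤ hg γ 0 k' B.K) := by
  induction hs : ∑ l ∈ range B.K, k l using Nat.strong_induction_on generalizing k with
  | _ s ih =>
  by_cases hb : ∀ l < B.K, k l ≤ B.H M 0
  · exact ⟨k, hk, hb, fun γ => by simp⟩
  obtain ⟨k', i, j, p, q, hp, rfl, hk', -⟩ := hk.exists_remove hM hb
  obtain ⟨k'', h1, h2, h3⟩ := ih _ (hs ▸ hp.sum_lt hM k') hk' rfl
  refine ⟨k'', h1, h2, fun γ => ?_⟩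
  obtain ⟨h4, h5⟩ := h3 γ
  rw [hp.hg_md_K]
  constructor
  · rw [add_sub_right_comm]
    exact dvd_add h4 (dvd_mul_right _ _)
  · intro h
    have h6 := mul_nonpos_of_nonneg_of_nonpos (Int.natCast_nonneg M) (h i j p q hp)
    linarith [h5 h]

/-- Short exponents with weight at least `min C W`. -/
theorem NS.Val.exists_min {k : ℕ → ℕ} (hk : B.Val k) {γ : ℕ → ℤ} (hγ : ∀ l < B.K, |γ l| ≤ B.N)
    (C : ℕ) :
    ∃ k', B.Val k' ∧ (∀ l < B.K, k' l ≤ B.H 1 0 + 2 * ((C + B.K * (B.H 1 0 * B.N)) * B.N)) ∧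
      min (hg γ 0 k B.K) C ≤ hg γ 0 k' B.K := by
  obtain ⟨k', h1, h2, h3⟩ := hk.reduce le_rfl
  by_cases hv : B.NV γ
  · exact ⟨k', h1, fun l hl => (h2 l hl).trans (Nat.le_add_right _ _),
      (min_le_left _ _).trans ((h3 γ).2 hv)⟩
  · simp only [NS.NV, not_forall, not_le] at hv
    obtain ⟨i, j, p, q, hp, hw⟩ := hv
    refine ⟨_, h1.md hp (C + B.K * (B.H 1 0 * B.N)), fun l hl => ?_, ?_⟩
    · have h4 := h2 l hl
      have h5 := Nat.mul_le_mul_left (C + B.K * (B.H 1 0 * B.N)) hp.2.2.2.2.1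
      have h6 := Nat.mul_le_mul_left (C + B.K * (B.H 1 0 * B.N)) hp.2.2.2.2.2.1
      simp only [TVASSpaper.md]
      split_ifs <;> omega
    · refine (min_le_right _ _).trans ?_
      rw [hp.hg_md_K]
      have h4 := neg_le_of_abs_le (abs_hg_le hγ h2)
      have h5 : (C + B.K * (B.H 1 0 * B.N) : ℕ) ≤
          ((C + B.K * (B.H 1 0 * B.N) : ℕ) : ℤ) * (p * γ i + q * γ j) :=
        le_mul_of_one_le_right (by positivity) (by omega)
      push_cast at *
      linarith

/-- Short exponents with the same weight, if no change increases the weight. -/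
theorem NS.Val.exists_exact {k : ℕ → ℕ} (hk : B.Val k) {γ : ℕ → ℤ} (hγ : ∀ l < B.K, |γ l| ≤ B.N)
    (hv : B.NV γ) {A D : ℕ} (hD : 2 * B.N ≤ D) (hA : -(A : ℤ) ≤ hg γ 0 k B.K)
    {P : (ℕ → ℕ) → Prop} (hP : P k)
    (hrem : ∀ k' i j p q, B.Pr i j p q → (p : ℤ) * γ i + q * γ j = 0 → B.Val k' →
      (∀ l, i < l → l ≤ j → (D : ℤ) ≤ hg B.φ 0 k' l) → P (TVASSpaper.md k' i j p q) → P k') :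
    ∃ k', B.Val k' ∧ P k' ∧ hg γ 0 k' B.K = hg γ 0 k B.K ∧
      ∀ l < B.K, k' l ≤ B.H 1 D + (B.K * (B.H 1 D * B.N) + A) * B.N := by
  obtain ⟨W, hW⟩ : ∃ W, W = hg γ 0 k B.K := ⟨_, rfl⟩
  rw [← hW] at hA ⊢
  induction hs : ∑ l ∈ range B.K, k l using Nat.strong_induction_on generalizing k with
  | _ s ih =>
  suffices h : ∀ kk r, B.Val kk → (∀ l, kk l ≤ k l) → (∀ l, hg B.φ 0 kk l ≤ hg B.φ 0 k l) →
      W + (r : ℕ) ≤ hg γ 0 kk B.K → (∀ l, k l ≤ kk l + r * B.N) →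
      ∃ k', B.Val k' ∧ P k' ∧ hg γ 0 k' B.K = W ∧
        ∀ l < B.K, k' l ≤ B.H 1 D + (B.K * (B.H 1 D * B.N) + A) * B.N from
    h k 0 hk (fun _ => le_rfl) (fun _ => le_rfl) (by simp [hW]) (by simp)
  intro kk
  induction ht : ∑ l ∈ range B.K, kk l using Nat.strong_induction_on generalizing kk with
  | _ t ih' =>
  intro r h1 h2 h3 h4 h5
  by_cases hb : ∀ l < B.K, kk l ≤ B.H 1 D
  · refine ⟨k, hk, hP, hW.symm, fun l hl => (h5 l).trans (Nat.add_le_add (hb l hl) ?_)⟩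
    have h6 := le_of_abs_le (abs_hg_le hγ hb)
    refine Nat.mul_le_mul_right _ ?_
    zify
    push_cast at h6
    linarith
  obtain ⟨kk', i, j, p, q, hp, rfl, hk', hh⟩ := h1.exists_remove le_rfl hb
  rw [one_mul, one_mul] at *
  have hlt := hp.sum_lt le_rfl kk'
  rw [one_mul, one_mul] at hlt
  have hm := hp.hg_md 1
  have hmK := hp.hg_md_K γ 1
  simp only [one_mul] at hm hmK
  rcases (hv i j p q hp).lt_or_eq with h6 | h6
  · refine ih' _ (ht ▸ hlt) kk' rfl (r + 1) hk' (fun l => le_trans ?_ (h2 l)) (fun l => ?_) ?_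
      fun l => (h5 l).trans ?_
    · simp only [TVASSpaper.md]; omega
    · have h7 := hp.hg_le_md 1 kk' 0 l
      rw [one_mul, one_mul] at h7
      exact h7.trans (h3 l)
    · rw [hmK] at h4
      push_cast at *
      linarith
    · have h7 := hp.2.2.2.2.1
      have h8 := hp.2.2.2.2.2.1
      have h9 : i = j → q = 0 := by
        obtain ⟨_, _, _, _, _, _, _, h | h⟩ := hp
        · exact fun _ => h.2.2.2
        · omega
      rw [add_mul, one_mul]
      simp only [TVASSpaper.md]
      split_ifs with h10 h11
      · have := h9 (h10.symm.trans h11); omega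
      all_goals omega
  · obtain ⟨k'', rfl, h7⟩ := exists_md_of_le h2
    have hkv : B.Val k'' := by
      refine ⟨fun l hl => ⟨(hk'.1 l hl).1.trans (h7 l), fun ha => le_trans ?_ ((hk.1 l hl).2 ha)⟩,
        NS.fe_of hk.2.1 fun l hl => ?_, ?_⟩
      · simp only [TVASSpaper.md]; omega
      · by_cases h8 : i < l ∧ l ≤ j
        · right
          have h9 := h3 l
          have h10 := hh l h8.1 h8.2
          rw [hm, hm] at h9
          have : ((2 * B.N : ℕ) : ℤ) ≤ D := by exact_mod_cast hD
          linarith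
        · left
          rw [hm, if_neg h8, add_zero]
      · have := hp.hg_md_K B.φ 1 k'' 0
        rw [hp.bal, one_mul, one_mul, hk.2.2] at this
        linarith
    have hlt' := hp.sum_lt le_rfl k''
    rw [one_mul, one_mul] at hlt'
    refine ih _ (hs ▸ hlt') hkv (hrem k'' i j p q hp h6 hkv (fun l h8 h9 => ?_) hP) ?_ rfl
    · have h10 := h3 l
      rw [hm, hm] at h10
      linarith [hh l h8 h9]
    · rw [hW, hmK, h6, mul_zero, add_zero]

end Reduce

section Schemes

open Finset

variable {Q E : Type} {A : Sys Q E}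

/-- The word `w₀^{k₀} ⋯ w_{K-1}^{k_{K-1}}`. -/
def fl (w : ℕ → List E) (k : ℕ → ℕ) : ℕ → List E
  | 0 => []
  | K + 1 => fl w k K ++ pw (w K) (k K)

theorem fl_congr {w w' : ℕ → List E} {k k' : ℕ → ℕ} {K : ℕ}
    (h : ∀ l < K, w l = w' l ∧ k l = k' l) : fl w k K = fl w' k' K := by
  induction K with
  | zero => rfl
  | succ K ih =>
    rw [fl, fl, ih fun l hl => h l (by omega), (h K (by omega)).1, (h K (by omega)).2]

theorem sm_fl (f : E → ℤ) (w : ℕ → List E) (k : ℕ → ℕ) (v : ℤ) (K : ℕ) :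
    hg (fun l => sm f (w l)) v k K = v + sm f (fl w k K) := by
  induction K with
  | zero => simp [fl]
  | succ K ih => rw [hg_succ, ih, fl, sm_append, sm_pw, add_assoc]

theorem length_pw (l : List E) (n : ℕ) : (pw l n).length = n * l.length := by
  simp [pw]

theorem length_fl_le {w : ℕ → List E} {k : ℕ → ℕ} {K H L : ℕ} (hw : ∀ l < K, (w l).length ≤ L)
    (hk : ∀ l < K, k l ≤ H) : (fl w k K).length ≤ K * (H * L) := by
  induction K with
  | zero => simp [fl]
  | succ K ih =>
    have h1 := ih (fun l hl => hw l (by omega)) fun l hl => hk l (by omega)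
    have h2 := Nat.mul_le_mul (hk K (by omega)) (hw K (by omega))
    rw [fl, List.length_append, length_pw, add_mul, one_mul]
    omega

theorem Nn_fl {f : E → ℤ} {w : ℕ → List E} {k : ℕ → ℕ} {v : ℤ} (hv : 0 ≤ v) {K : ℕ}
    (hk : ∀ l < K, 1 ≤ k l) :
    Nn f v (fl w k K) ↔ Fe K (fun l v => Nn f v (w l)) (fun l => sm f (w l)) v k := by
  induction K with
  | zero => simp [fl, Fe, hv]
  | succ K ih =>
    have ih := ih fun l hl => hk l (by omega)
    obtain ⟨n, hn⟩ : ∃ n, k K = n + 1 := ⟨k K - 1, by have := hk K (by omega); omega⟩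
    rw [fl, Nn_append, ih, ← sm_fl]
    constructor
    · rintro ⟨⟨h1, h2⟩, h3⟩
      have h4 : 0 ≤ hg (fun l => sm f (w l)) v k (K + 1) := by
        rw [hg_succ, ← sm_pw]
        exact h3.right (h1 K le_rfl)
      refine ⟨fun l hl => ?_, fun l hl => ?_⟩
      · rcases (by omega : l ≤ K ∨ l = K + 1) with h | rfl
        · exact h1 l h
        · exact h4
      · rcases (by omega : l < K ∨ l = K) with h | rfl
        · exact h2 l h
        · constructor
          · rw [hn, pw_succ, Nn_append] at h3
            exact h3.1
          · rw [hn, pw_succ', Nn_append, sm_pw] at h3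
            convert h3.2 using 1
            rw [hg_succ, hn]; push_cast; ring
    · rintro ⟨h1, h2⟩
      refine ⟨⟨fun l hl => h1 l (by omega), fun l hl => h2 l (by omega)⟩, Nn_pw fun _ => ?_⟩
      obtain ⟨h3, h4⟩ := h2 K (by omega)
      refine ⟨h3, ?_⟩
      convert h4 using 1
      rw [hg_succ]; ring

/-- A sequence of `K` walks of length at most `L` through the states `st`. -/
structure Sys.Sch (A : Sys Q E) (L K : ℕ) (w : ℕ → List E) (st : ℕ → Q) : Prop where
  walk : ∀ l < K, A.Walk (st l) (w l) (st (l + 1))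
  len : ∀ l < K, (w l).length ≤ L

/-- Admissible exponents of a scheme. -/
def Adm (K : ℕ) (st : ℕ → Q) (k : ℕ → ℕ) : Prop :=
  ∀ l < K, 1 ≤ k l ∧ (k l = 1 ∨ st l = st (l + 1))

theorem Sys.Sch.walk_fl {L K : ℕ} {w : ℕ → List E} {st : ℕ → Q} (h : A.Sch L K w st) {k : ℕ → ℕ}
    (hk : Adm K st k) {m : ℕ} (hm : m ≤ K) : A.Walk (st 0) (fl w k m) (st m) := by
  induction m with
  | zero => rfl
  | succ m ih =>
    refine (ih (by omega)).append ?_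
    have h1 := h.walk m hm
    rcases (hk m hm).2 with h2 | h2
    · rwa [h2, pw_one]
    · rw [← h2] at h1 ⊢
      exact h1.pw _

theorem fl_eq_flat (w : ℕ → List E) (k : ℕ → ℕ) (K : ℕ) :
    fl w k K = flat ((List.range K).map fun l => (w l, k l)) := by
  induction K with
  | zero => rfl
  | succ K ih => simp [fl, ih, List.range_succ, flat]

theorem Sys.Sch.lp {L K : ℕ} {w : ℕ → List E} {st : ℕ → Q} (h : A.Sch L K w st) {k : ℕ → ℕ}
    (hk : Adm K st k) {m : ℕ} (hm : m ≤ K) {a b : Cfg Q} (hr : A.Run a (fl w k m) b) :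
    A.LP m a (m * L) b := by
  refine ⟨(List.range m).map fun l => (w l, k l), fun b hb => ?_, by simp, ?_, fl_eq_flat w k m ▸ hr⟩
  · obtain ⟨l, hl, rfl⟩ := List.mem_map.1 hb
    have hl := List.mem_range.1 hl
    refine (hk l (by omega)).2.imp id fun h2 => ⟨st l, ?_⟩
    have := h.walk l (by omega)
    rwa [← h2] at this
  · clear hr
    induction m with
    | zero => simp [bsz]
    | succ m ih =>
      have h1 := ih (by omega)
      have h2 := h.len m (by omega)
      simp only [bsz, List.range_succ, List.map_append, List.sum_append, List.map_cons,
        List.map_nil, List.sum_cons, List.sum_nil] at h1 ⊢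
      rw [add_mul]
      omega

theorem Sys.Walk.sch {p q : Q} {bs : List (List E × ℕ)} (hb : A.Blk bs) (h : A.Walk p (flat bs) q) :
    ∃ (K : ℕ) (w : ℕ → List E) (st : ℕ → Q) (k : ℕ → ℕ), K ≤ bs.length ∧ A.Sch (bsz bs) K w st ∧
      Adm K st k ∧ st 0 = p ∧ st K = q ∧ fl w k K = flat bs := by
  induction bs using List.reverseRecOn generalizing q with
  | nil =>
    exact ⟨0, fun _ => [], fun _ => p, fun _ => 0, le_rfl, ⟨by simp, by simp⟩, by simp [Adm], rfl, h,
      rfl⟩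
  | append_singleton bs b ih =>
    have hfl : flat (bs ++ [b]) = flat bs ++ TVASSpaper.pw b.1 b.2 := by simp [flat]
    have hsz : bsz (bs ++ [b]) = bsz bs + b.1.length := by simp [bsz]
    rw [hfl] at h ⊢
    rw [hsz]
    obtain ⟨r, h1, h2⟩ := Sys.walk_append.1 h
    obtain ⟨K, w, st, k, hK, hs, hk, e1, e2, e3⟩ := ih (fun b hb' => hb b (by simp [hb'])) h1
    by_cases hz : TVASSpaper.pw b.1 b.2 = []
    · rw [hz] at h2 ⊢
      exact ⟨K, w, st, k, by simp; omega,
        ⟨hs.walk, fun l hl => (hs.len l hl).trans (Nat.le_add_right _ _)⟩, hk, e1, e2.trans h2,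
        by simpa⟩
    have hb0 : b.2 ≠ 0 := fun h => hz (by rw [h, pw_zero])
    have key : A.Walk r b.1 q ∧ (b.2 = 1 ∨ r = q) := by
      rcases hb b (by simp) with h3 | ⟨s, h3⟩
      · rw [h3, pw_one] at h2
        exact ⟨h2, .inl h3⟩
      · have hrs : r = s := by
          obtain ⟨n, hn⟩ : ∃ n, b.2 = n + 1 := ⟨b.2 - 1, by omega⟩
          rw [hn, pw_succ] at h2
          rcases b with ⟨_ | ⟨e, l⟩, m⟩
          · exact absurd (by simp [TVASSpaper.pw]) hz
          · exact h2.2.1.symm.trans h3.2.1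
        subst hrs
        have := (h3.pw b.2).right_unique h2
        subst this
        exact ⟨h3, .inr rfl⟩
    refine ⟨K + 1, fun l => if l = K then b.1 else w l, fun l => if l ≤ K then st l else q,
      fun l => if l = K then b.2 else k l, by simp; omega, ⟨fun l hl => ?_, fun l hl => ?_⟩,
      fun l hl => ?_, by simp [e1], by simp, ?_⟩
    · rcases (by omega : l < K ∨ l = K) with h | rfl
      · rw [if_pos h.le, if_neg h.ne, if_pos (by omega)]
        exact hs.walk l h
      · rw [if_pos le_rfl, if_pos rfl, if_neg (by omega), e2]
        exact key.1
    · rcases (by omega : l < K ∨ l = K) with h | rfl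
      · rw [if_neg h.ne]
        exact (hs.len l h).trans (Nat.le_add_right _ _)
      · rw [if_pos rfl]; omega
    · dsimp only
      rcases (by omega : l < K ∨ l = K) with h | rfl
      · rw [if_neg h.ne, if_pos h.le, if_pos (by omega)]
        exact hk l h
      · rw [if_pos rfl, if_pos le_rfl, if_neg (by omega), e2]
        exact ⟨by omega, key.2⟩
    · rw [fl, if_pos rfl, if_pos rfl, ← e3]
      congr 1
      exact fl_congr fun l hl => by simp [hl.ne]

theorem Sys.Sch.abs_sm_le {X L K : ℕ} {w : ℕ → List E} {st : ℕ → Q} (h : A.Sch L K w st)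
    {f : E → ℤ} (hf : ∀ e ∈ A.T, |f e| ≤ X) {l : ℕ} (hl : l < K) :
    |sm f (w l)| ≤ (L * X + 1 : ℕ) := by
  have h1 := TVASSpaper.abs_sm_le fun e he => hf e ((h.walk l hl).mem e he)
  have h2 : (w l).length * X ≤ L * X := Nat.mul_le_mul_right _ (h.len l hl)
  push_cast
  zify at h2
  linarith

/-- Numerical data of a scheme. -/
def Sys.Sch.ns {X L K : ℕ} {w : ℕ → List E} {st : ℕ → Q} (h : A.Sch L K w st)
    (hf : ∀ e ∈ A.T, |A.f e| ≤ X) (act : ℕ → Prop) {T : ℕ} {cap : ℕ → ℕ} (hcap : ∀ l, cap l ≤ T) :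
    NS where
  K := K
  N := L * X + 1
  T := T
  φ := fun l => sm A.f (w l)
  ok := fun l v => Nn A.f v (w l)
  act := act
  cap := cap
  one := by omega
  cap_le := hcap
  bd := fun l hl => h.abs_sm_le hf hl
  mono := fun l v w h1 h2 => h1.mono h2
  high := fun l v hl hv => by
    have h2 : (w l).length * X ≤ L * X := Nat.mul_le_mul_right _ (h.len l hl)
    refine Nn_of_len (fun e he => hf e ((h.walk l hl).mem e he)) (le_trans ?_ hv)
    exact_mod_cast h2.trans (Nat.le_succ _)

/-- A walk between two configurations on the axis, feasible in the first counter. -/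
def Sys.OP (A : Sys Q E) (s : Q) (l : List E) (t : Q) : Prop :=
  A.Walk s l t ∧ Nn A.f 0 l ∧ sm A.f l = 0

theorem Sys.Sch.op {X L K T : ℕ} {w : ℕ → List E} {st : ℕ → Q} (h : A.Sch L K w st)
    (hf : ∀ e ∈ A.T, |A.f e| ≤ X) {act : ℕ → Prop} {cap : ℕ → ℕ} (hcap : ∀ l, cap l ≤ T)
    (hc : ∀ l, st l ≠ st (l + 1) → ¬ act l ∧ cap l ≤ 1) {k : ℕ → ℕ}
    (hk : (h.ns hf act hcap).Val k) : Adm K st k ∧ A.OP (st 0) (fl w k K) (st K) := by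
  have hadm : Adm K st k := by
    intro l hl
    obtain ⟨h1, h2⟩ := hk.1 l hl
    refine ⟨h1, or_iff_not_imp_right.2 fun h3 => ?_⟩
    have := (h2 (hc l h3).1).trans (hc l h3).2
    omega
  refine ⟨hadm, h.walk_fl hadm le_rfl, (Nn_fl le_rfl fun l hl => (hk.1 l hl).1).2 hk.2.1, ?_⟩
  have := sm_fl A.f w k 0 K
  rw [zero_add] at this
  exact this.symm.trans hk.2.2

end Schemes

section AxisRuns

open Finset

theorem Sys.Sch.mono {Q E : Type} {A : Sys Q E} {L L' K : ℕ} {w : ℕ → List E} {st : ℕ → Q}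
    (h : A.Sch L K w st) (hL : L ≤ L') : A.Sch L' K w st :=
  ⟨h.walk, fun l hl => (h.len l hl).trans hL⟩

/-- Runs between configurations on the axis follow short schemes. -/
theorem axis_sch : ∃ F, PB F ∧ ∀ {Q E : Type} [Fintype Q] (A : Sys Q E) {X : ℕ}, A.Bdd X →
    ∀ {s t : Q} {a b : ℤ} {l : List E}, 0 ≤ a → A.Run (s, 0, a) l (t, 0, b) →
    ∃ (K : ℕ) (w : ℕ → List E) (st : ℕ → Q) (k : ℕ → ℕ), A.Sch (F X) K w st ∧
      K ≤ 14 * Fintype.card Q + 7 ∧ Adm K st k ∧ st 0 = s ∧ st K = t ∧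
      A.Run (s, 0, a) (fl w k K) (t, 0, b) := by
  obtain ⟨F, hF, h⟩ := plain_lp
  refine ⟨F, hF, ?_⟩
  intro Q E _ A X hA s t a b l ha hl
  obtain ⟨bs, h1, h2, h3, h4⟩ := h A hA (a := (s, 0, a)) ⟨le_rfl, ha⟩ hl
  obtain ⟨K, w, st, k, h5, h6, h7, h8, h9, h10⟩ := h4.1.sch h1
  exact ⟨K, w, st, k, h6.mono h3, h5.trans h2, h7, h8, h9, h10 ▸ h4⟩

/-- A bound for `NS.H`. -/
def hB (K N T M D : ℕ) : ℕ := (K * K + 1) * (D + N * (M * N + T + 3)) + M + T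

/-- Runs between configurations on the axis follow short schemes with adjustable exponents. -/
theorem axis_ns : ∃ F, PB F ∧ ∀ {Q E : Type} [Fintype Q] (A : Sys Q E) {X : ℕ}, A.Bdd X →
    ∀ {s t : Q} {a b : ℤ} {l : List E}, 0 ≤ a → A.Run (s, 0, a) l (t, 0, b) →
    ∃ (B : NS) (γ : ℕ → ℤ) (k : ℕ → ℕ), B.K ≤ F X ∧ B.N ≤ F X ∧ B.T = 1 ∧
      (∀ l < B.K, |γ l| ≤ B.N) ∧ B.Val k ∧ hg γ 0 k B.K = b - a ∧
      ∀ k' H, B.Val k' → (∀ l < B.K, k' l ≤ H) →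
        ∃ l', A.OP s l' t ∧ sm A.g l' = hg γ 0 k' B.K ∧ l'.length ≤ F X * (H * F X) := by
  obtain ⟨F, hF, h⟩ := axis_sch
  refine ⟨fun X => 14 * X + 7 + (F X * X + 1) + F X, by fun_prop, ?_⟩
  intro Q E _ A X hA s t a b l ha hl
  obtain ⟨K, w, st, k, h1, h2, h3, rfl, rfl, h4⟩ := h A hA ha hl
  have hcard := hA.card
  have hK : K ≤ 14 * X + 7 := by omega
  have hFG : F X ≤ 14 * X + 7 + (F X * X + 1) + F X := Nat.le_add_left _ _
  have hKG : K ≤ 14 * X + 7 + (F X * X + 1) + F X := by omega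
  refine ⟨h1.ns hA.f (fun l => st l = st (l + 1)) (T := 1) (cap := fun _ => 1) fun _ => le_rfl,
    fun l => sm A.g (w l), k, ?_, ?_, rfl, fun l hl => h1.abs_sm_le hA.g hl, ⟨fun l hl => ⟨(h3 l hl).1, fun hc => ?_⟩, ?_, ?_⟩, ?_,
      fun k' H hk' hH => ?_⟩
  · exact hKG
  · exact (by omega : F X * X + 1 ≤ 14 * X + 7 + (F X * X + 1) + F X)
  · exact ((h3 l hl).2.resolve_right hc).le
  · exact (Nn_fl le_rfl fun l hl => (h3 l hl).1).1 h4.2.1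
  · refine (sm_fl A.f w k 0 K).trans ?_
    have := h4.2.2.2.1
    simp only at this
    omega
  · refine (sm_fl A.g w k 0 K).trans ?_
    have := h4.2.2.2.2
    simp only at this
    omega
  · obtain ⟨h5, h6⟩ := h1.op hA.f (fun _ => le_rfl) (fun l hl => ⟨hl, le_rfl⟩) hk'
    refine ⟨_, h6, ?_, (length_fl_le h1.len hH).trans ?_⟩
    · have := sm_fl A.g w k' 0 K
      rw [zero_add] at this
      exact this.symm
    · exact Nat.mul_le_mul hKG (Nat.mul_le_mul_left _ hFG)

/-- Short walks on the axis of large weight. -/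
theorem axis_min : ∃ F, PB F ∧ ∀ {Q E : Type} [Fintype Q] (A : Sys Q E) {X : ℕ}, A.Bdd X →
    ∀ {s t : Q} {a b : ℤ} {l : List E}, 0 ≤ a → A.Run (s, 0, a) l (t, 0, b) →
    ∃ l', A.OP s l' t ∧ l'.length ≤ F X ∧ min (b - a) X ≤ sm A.g l' := by
  obtain ⟨F, hF, h⟩ := axis_ns
  refine ⟨fun X => F X * ((hB (F X) (F X) 1 1 0 +
    2 * ((X + F X * (hB (F X) (F X) 1 1 0 * F X)) * F X)) * F X), by unfold hB; fun_prop, ?_⟩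
  intro Q E _ A X hA s t a b l ha hl
  obtain ⟨B, γ, k, h1, h2, h3, h4, h5, h6, h7⟩ := h A hA ha hl
  obtain ⟨k', h8, h9, h10⟩ := h5.exists_min h4 X
  obtain ⟨l', h11, h12, h13⟩ := h7 k' _ h8 h9
  refine ⟨l', h11, h13.trans ?_, by rwa [h12, ← h6]⟩
  have hH : B.H 1 0 ≤ hB (F X) (F X) 1 1 0 := by unfold NS.H hB; rw [h3]; gcongr
  beta_reduce
  gcongr

/-- Short walks on the axis of given weight modulo `M`. -/
theorem axis_mod : ∃ F, PB F ∧ ∀ {Q E : Type} [Fintype Q] (A : Sys Q E) {X : ℕ}, A.Bdd X →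
    ∀ {M : ℕ}, 1 ≤ M → M ≤ X →
    ∀ {s t : Q} {a b : ℤ} {l : List E}, 0 ≤ a → A.Run (s, 0, a) l (t, 0, b) →
    ∃ l', A.OP s l' t ∧ l'.length ≤ F X ∧ (M : ℤ) ∣ (b - a) - sm A.g l' := by
  obtain ⟨F, hF, h⟩ := axis_ns
  refine ⟨fun X => F X * (hB (F X) (F X) 1 X 0 * F X), by unfold hB; fun_prop, ?_⟩
  intro Q E _ A X hA M hM hMX s t a b l ha hl
  obtain ⟨B, γ, k, h1, h2, h3, h4, h5, h6, h7⟩ := h A hA ha hl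
  obtain ⟨k', h8, h9, h10⟩ := h5.reduce hM
  obtain ⟨l', h11, h12, h13⟩ := h7 k' _ h8 h9
  refine ⟨l', h11, h13.trans ?_, by rw [h12, ← h6]; exact (h10 γ).1⟩
  have hH : B.H M 0 ≤ hB (F X) (F X) 1 X 0 := by unfold NS.H hB; rw [h3]; gcongr
  beta_reduce
  gcongr

/-- Short walks on the axis of given weight, if there are no walks of arbitrarily large weight. -/
theorem axis_exact : ∃ F, PB F ∧ ∀ {Q E : Type} [Fintype Q] (A : Sys Q E) {X : ℕ}, A.Bdd X →
    ∀ {s t : Q} {a b : ℤ} {l : List E}, 0 ≤ a → A.Run (s, 0, a) l (t, 0, b) → a - b ≤ X →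
    (∃ l', A.OP s l' t ∧ l'.length ≤ F X ∧ sm A.g l' = b - a) ∨
      ∀ W : ℤ, ∃ l', A.OP s l' t ∧ W ≤ sm A.g l' := by
  obtain ⟨F, hF, h⟩ := axis_ns
  refine ⟨fun X => F X * ((hB (F X) (F X) 1 1 (2 * F X) + (F X *
    (hB (F X) (F X) 1 1 (2 * F X) * F X) + X) * F X) * F X), by unfold hB; fun_prop, ?_⟩
  intro Q E _ A X hA s t a b l ha hl hab
  obtain ⟨B, γ, k, h1, h2, h3, h4, h5, h6, h7⟩ := h A hA ha hl
  by_cases hv : B.NV γ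
  · left
    obtain ⟨k', h8, -, h9, h10⟩ := h5.exists_exact h4 hv (A := X) (D := 2 * B.N) le_rfl (by omega)
      (P := fun _ => True) trivial fun _ _ _ _ _ _ _ _ _ _ => trivial
    obtain ⟨l', h11, h12, h13⟩ := h7 k' _ h8 h10
    refine ⟨l', h11, h13.trans ?_, by rw [h12, h9, h6]⟩
    have hH : B.H 1 (2 * B.N) ≤ hB (F X) (F X) 1 1 (2 * F X) := by
      unfold NS.H hB; rw [h3]; gcongr
    beta_reduce
    gcongr
  · right
    simp only [NS.NV, not_forall, not_le] at hv
    obtain ⟨i, j, p, q, hp, hw⟩ := hv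
    intro W
    have h8 := h5.md hp (W - (b - a)).toNat
    obtain ⟨l', h11, h12, -⟩ := h7 _ _ h8 fun l hl => Finset.le_sup (Finset.mem_range.2 hl)
    refine ⟨l', h11, ?_⟩
    rw [h12, hp.hg_md_K, h6]
    have : ((W - (b - a)).toNat : ℤ) ≤ (W - (b - a)).toNat * (p * γ i + q * γ j) :=
      le_mul_of_one_le_right (by positivity) (by omega)
    omega

end AxisRuns

section OneCounterWords

variable {Q E : Type} {A : Sys Q E}

/-- The one-counter system of the first counter. -/
def fR (A : Sys Q E) (s : Q) (δ : ℤ) (t : Q) : Prop :=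
  ∃ e ∈ A.T, A.src e = s ∧ A.tgt e = t ∧ δ = A.f e

theorem cr_of_walk {s t : Q} {l : List E} {v : ℤ} (hv : 0 ≤ v) (h : A.Walk s l t)
    (hn : Nn A.f v l) : CR (fR A) {v | 0 ≤ v} l.length s v t (v + sm A.f l) := by
  induction l generalizing s v with
  | nil => rw [h]; simpa using CR.nil (R := fR A) (I := {v : ℤ | 0 ≤ v}) hv
  | cons e l ih =>
    have := ih hn.1 h.2.2 hn.2
    rw [sm_cons, ← add_assoc]
    exact .cons hv ⟨e, h.1, h.2.1, rfl, rfl⟩ this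

theorem walk_of_cr {s t : Q} {v u : ℤ} {n : ℕ} (h : CR (fR A) {v | 0 ≤ v} n s v t u) :
    ∃ l, l.length = n ∧ A.Walk s l t ∧ Nn A.f v l ∧ u = v + sm A.f l := by
  induction h with
  | nil => exact ⟨[], rfl, rfl, trivial, by simp⟩
  | @cons s s' t v w δ n hv hr h ih =>
    obtain ⟨e, h1, h2, h3, rfl⟩ := hr
    obtain ⟨l, h4, h5, h6, h7⟩ := ih
    exact ⟨e :: l, by simp [h4], ⟨h1, h2, h3 ▸ h5⟩, ⟨h.left_mem, h6⟩, by simp [h7, add_assoc]⟩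

/-- From the states of a walk that returns the first counter to zero, there are short such walks
from small values of the counter. -/
theorem exists_short_return [Fintype Q] {X : ℕ} (hA : A.Bdd X) {s t : Q} {l : List E} {v : ℤ}
    (hv : 0 ≤ v) (h : A.Walk s l t) (hn : Nn A.f v l) (h0 : v + sm A.f l = 0) {N g : ℕ}
    (hg : 0 < g) (hgN : g ≤ N) :
    ∃ (v' : ℤ) (r : ℕ) (l' : List E), v = v' + r * g ∧ (r = 0 ∨ (N : ℤ) ≤ v') ∧ 0 ≤ v' ∧
      A.Walk s l' t ∧ Nn A.f v' l' ∧ v' + sm A.f l' = 0 ∧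
      l'.length ≤ X * (N + X * X * N + 2 * (X * X) ^ 2 + 1) := by
  have hR : ∀ s δ t, fR A s δ t → |δ| ≤ X := by
    rintro s δ t ⟨e, h1, _, _, rfl⟩
    exact hA.f e h1
  have hcr := cr_of_walk hv h hn
  rw [h0] at hcr
  have hcard := hA.card
  have key : ∃ (v' : ℤ) (r : ℕ) (m : ℕ), v = v' + r * g ∧ (r = 0 ∨ (N : ℤ) ≤ v') ∧ 0 ≤ v' ∧
      v' ≤ (N + X * X * N : ℕ) ∧ CR (fR A) {v | 0 ≤ v} m s v' t 0 := by
    by_cases hvN : v ≤ N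
    · refine ⟨v, 0, _, by simp, .inl rfl, hv, ?_, hcr⟩
      have : ((N : ℕ) : ℤ) ≤ (N + X * X * N : ℕ) := by exact_mod_cast Nat.le_add_right _ _
      exact hvN.trans this
    · obtain ⟨a', m, ⟨r, hr⟩, h2, h3, h4, h5⟩ :=
        hcr.lower hR hg (c := N) (by positivity) (by omega)
      have hr0 : 0 ≤ r := by
        by_contra hneg
        have : (g : ℤ) * r < 0 := mul_neg_of_pos_of_neg (by exact_mod_cast hg) (by omega)
        omega
      refine ⟨a', r.toNat, m, ?_, .inr h2, le_trans (by positivity) h2, h4.trans ?_, h5⟩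
      · rw [Int.toNat_of_nonneg hr0]; linarith
      · have : Fintype.card Q * X * g ≤ X * X * N := by gcongr
        exact_mod_cast Nat.add_le_add_left this N
  obtain ⟨v', r, m, h1, h2, h3, h4, h5⟩ := key
  obtain ⟨m', h6, h7⟩ := h5.short hR (A := N + X * X * N) (by rw [sub_zero, abs_of_nonneg h3]; exact h4)
  obtain ⟨l', h8, h9, h10, h11⟩ := walk_of_cr h7
  refine ⟨v', r, l', h1, h2, h3, h9, h10, h11.symm, ?_⟩
  rw [h8]
  refine h6.trans ?_
  gcongr

theorem fl_split {w : ℕ → List E} {k : ℕ → ℕ} {m K : ℕ} (h : m ≤ K) :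
    ∃ r, fl w k K = fl w k m ++ r := by
  induction K with
  | zero => exact ⟨[], by simp [Nat.le_zero.1 h]⟩
  | succ K ih =>
    rcases (by omega : m ≤ K ∨ m = K + 1) with h | rfl
    · obtain ⟨r, hr⟩ := ih h
      exact ⟨r ++ pw (w K) (k K), by rw [fl, hr, List.append_assoc]⟩
    · exact ⟨[], by simp⟩

/-- A long iterated cycle trading the first counter for the second leads to high altitude. -/
theorem trade_high [Fintype Q] {X : ℕ} (hA : A.Bdd X) {L K : ℕ} {w : ℕ → List E} {st : ℕ → Q}
    (hs : A.Sch L K w st) {k : ℕ → ℕ} (hk : Adm K st k) {a b : ℤ} (ha : 0 ≤ a)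
    (hr : A.Run (st 0, 0, a) (fl w k K) (st K, 0, b)) {j : ℕ} (hj : j < K)
    (hst : st j = st (j + 1)) (hf : sm A.f (w j) < 0) (hg : 0 < sm A.g (w j)) {R H : ℕ}
    (hR : R = X * ((L * X + 1) + X * X * (L * X + 1) + 2 * (X * X) ^ 2 + 1))
    (hT : R * X + H ≤ k j) :
    ∃ h : ℤ, H ≤ h ∧ A.LP (K + 1) (st 0, 0, a) (K * L + (L + R)) (st K, 0, h) := by
  obtain ⟨r, hr'⟩ := fl_split (w := w) (k := k) hj
  rw [hr', fl] at hr
  obtain ⟨h1, h2, h3, h4, h5⟩ := hr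
  simp only at h1 h2 h3 h4 h5
  rw [Nn_append, Nn_append] at h2 h3
  obtain ⟨⟨f1, f2⟩, f3⟩ := h2
  obtain ⟨⟨g1, g2⟩, g3⟩ := h3
  have hwalk : A.Walk (st j) r (st K) := by
    obtain ⟨r', h6, h7⟩ := Sys.walk_append.1 h1
    have := (hs.walk_fl hk (m := j + 1) hj).right_unique h6
    rw [hst, this]; exact h7
  obtain ⟨x, hx⟩ : ∃ x, x = sm A.f (fl w k j) := ⟨_, rfl⟩
  obtain ⟨y, hy⟩ : ∃ y, y = a + sm A.g (fl w k j) := ⟨_, rfl⟩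
  have hx0 : 0 ≤ x := by rw [hx]; simpa using f1.right le_rfl
  have hy0 : 0 ≤ y := by rw [hy]; exact g1.right ha
  obtain ⟨n, hn⟩ : ∃ n, k j = n + 1 := ⟨k j - 1, by have := (hk j hj).1; omega⟩
  rw [zero_add, ← hx] at f2
  rw [sm_append, zero_add, ← hx] at f3
  rw [← hy] at g2
  have hv0 := f2.right hx0
  obtain ⟨c, hc⟩ : ∃ c : ℕ, (c : ℤ) = -sm A.f (w j) := ⟨(-sm A.f (w j)).toNat, by omega⟩
  have hcN : c ≤ L * X + 1 := by
    have := (abs_le.1 (hs.abs_sm_le hA.f hj)).1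
    omega
  obtain ⟨v', r', l', e1, e2, e3, e4, e5, e6, e7⟩ := exists_short_return hA hv0 hwalk f3
    (by rw [sm_append, sm_append, ← hx] at h4; linarith) (g := c) (by omega) hcN
  have hwj : A.Walk (st j) (w j) (st j) := by
    have := hs.walk j hj
    rwa [← hst] at this
  have hfw : Nn A.f x (w j) := by
    rw [hn, pw_succ, Nn_append] at f2
    exact f2.1
  have hgw : Nn A.g y (w j) := by
    rw [hn, pw_succ, Nn_append] at g2
    exact g2.1
  have hlast : Nn A.f (v' - sm A.f (w j)) (w j) := by
    rcases e2 with rfl | e2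
    · rw [hn, pw_succ', Nn_append] at f2
      convert f2.2 using 1
      rw [sm_pw] at e1 ⊢
      rw [hn] at e1
      push_cast at e1
      linarith
    · refine Nn_of_len (fun e he => hA.f e (hwj.mem e he)) (X := X) ?_
      have h6 := Nat.mul_le_mul_right X (hs.len j hj)
      zify at h6
      push_cast at e2 ⊢
      linarith
  have hv' : v' = x + ((k j + r' : ℕ) : ℤ) * sm A.f (w j) := by
    rw [sm_pw] at e1
    have h7 : sm A.f (w j) = - c := by omega
    rw [h7] at e1 ⊢
    push_cast
    linarith
  have hbig : ((R * X + H : ℕ) : ℤ) ≤ y + ((k j + r' : ℕ) : ℤ) * sm A.g (w j) := by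
    have h6 : ((R * X + H : ℕ) : ℤ) ≤ (k j + r' : ℕ) := by exact_mod_cast hT.trans (Nat.le_add_right _ _)
    have h7 : ((k j + r' : ℕ) : ℤ) ≤ ((k j + r' : ℕ) : ℤ) * sm A.g (w j) :=
      le_mul_of_one_le_right (by positivity) (by omega)
    linarith
  have hgl := abs_le.1 (abs_sm_le fun e he => hA.g e (e4.mem e he))
  have hlR : l'.length * X ≤ R * X := Nat.mul_le_mul_right _ (by rw [hR]; exact e7)
  have hlR' : ((l'.length * X : ℕ) : ℤ) ≤ (R * X : ℕ) := by exact_mod_cast hlR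
  have hrun1 : A.Run (st 0, 0, a) (fl w k j) (st j, x, y) :=
    ⟨hs.walk_fl hk hj.le, f1, g1, by simp [hx], by simp [hy]⟩
  have hrun2 : A.Run (st j, x, y) (pw (w j) (k j + r'))
      (st j, v', y + ((k j + r' : ℕ) : ℤ) * sm A.g (w j)) := by
    refine ⟨hwj.pw _, Nn_pw fun _ => ⟨hfw, ?_⟩, Nn_pw fun h => ⟨hgw, hgw.mono ?_⟩, by simp [hv'],
      by simp⟩
    · convert hlast using 1
      rw [hv']; push_cast; ring
    · have h6 : (0 : ℤ) ≤ ((k j + r' : ℕ) : ℤ) - 1 := by omega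
      have := mul_nonneg h6 hg.le
      simp only at this ⊢
      linarith
  have hrun3 : A.Run (st j, v', y + ((k j + r' : ℕ) : ℤ) * sm A.g (w j)) l'
      (st K, 0, y + ((k j + r' : ℕ) : ℤ) * sm A.g (w j) + sm A.g l') := by
    refine ⟨e4, e5, Nn_of_len (fun e he => hA.g e (e4.mem e he)) (X := X) ?_, by simp [e6], rfl⟩
    push_cast at *
    have : (0 : ℤ) ≤ H := by positivity
    linarith
  refine ⟨_, ?_, (((hs.lp hk hj.le hrun1).trans ((Sys.lp_pw hwj hrun2).trans
    (Sys.SF.lp ⟨l', le_rfl, hrun3⟩))).mono ?_ ?_)⟩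
  · push_cast at *
    linarith
  · omega
  · have h6 : l'.length ≤ R := by rw [hR]; exact e7
    have h7 := hs.len j hj
    have h8 : j * L ≤ K * L := Nat.mul_le_mul_right _ hj.le
    omega

end OneCounterWords

section LowRuns

open Finset

theorem hg_eq_add (φ : ℕ → ℤ) (v : ℤ) (k : ℕ → ℕ) (l : ℕ) : hg φ v k l = v + hg φ 0 k l := by
  simp [hg]

theorem hg_ite_lt {φ γ : ℕ → ℤ} {c d : ℤ} {l : ℕ} (k : ℕ → ℕ) {K : ℕ} (hl : l ≤ K) :
    hg (fun t => if t < l then 0 else c * γ t - d * φ t) 0 k K =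
      c * (hg γ 0 k K - hg γ 0 k l) - d * (hg φ 0 k K - hg φ 0 k l) := by
  induction K, hl using Nat.le_induction with
  | base =>
    simp only [hg, zero_add, sub_self, mul_zero]
    exact Finset.sum_eq_zero fun t ht => by simp [Finset.mem_range.1 ht]
  | succ K hl ih =>
    rw [hg_succ, hg_succ, hg_succ, ih, if_neg (by omega)]
    ring

variable {B : NS}

/-- If no change increases the weight `γ`, then `γ` is high after an upward block for both
weights, wherever `φ` is high. -/
theorem NS.NV.height_ge {γ : ℕ → ℤ} (hv : B.NV γ) (hγ : ∀ l < B.K, |γ l| ≤ B.N) {k : ℕ → ℕ}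
    (hk : B.Val k) {i l D : ℕ} (ha : B.act i) (hφ : 0 < B.φ i) (hγi : 0 < γ i)
    (hil : i < l) (hl : l ≤ B.K) (hD : (D : ℤ) ≤ hg B.φ 0 k l) :
    B.φ i * hg γ 0 k B.K + D - (B.K * (B.H 1 0 * (2 * (B.N * B.N))) : ℕ) ≤
      B.φ i * hg γ 0 k l := by
  have hiK : i < B.K := by omega
  obtain ⟨δ, hδ⟩ : ∃ δ : ℕ → ℤ, δ = fun t => if t < l then 0 else B.φ i * γ t - γ i * B.φ t :=
    ⟨_, rfl⟩
  have hδv : B.NV δ := by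
    intro i' j' p q hp
    have hle := hp.le
    have hbal := hp.bal
    have hw := hv i' j' p q hp
    by_cases h1 : i' < l
    · by_cases h2 : j' < l
      · simp [hδ, h1, h2]
      · have h3 : 0 < B.φ i' ∧ B.φ j' < 0 := by
          obtain ⟨_, _, _, _, _, _, _, h | h⟩ := hp
          · omega
          · exact ⟨h.2.1, h.2.2.1⟩
        have h4 := abs_le.1 (B.bd i hiK)
        have h5 := abs_le.1 (B.bd j' hp.2.1)
        have h6 := hv i j' (-B.φ j').toNat (B.φ i).toNat ⟨hiK, hp.2.1, ha, hp.2.2.2.1, by omega,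
          by omega, by omega, .inr ⟨by omega, hφ, h3.2, by omega, by omega⟩⟩
        rw [Int.toNat_of_nonneg (by omega), Int.toNat_of_nonneg (by omega)] at h6
        have h7 : δ j' ≤ 0 := by
          simp only [hδ, if_neg h2]
          linarith
        have h8 : δ i' = 0 := by simp [hδ, h1]
        rw [h8, mul_zero, zero_add]
        exact mul_nonpos_of_nonneg_of_nonpos (by positivity) h7
    · have h2 : ¬ j' < l := by omega
      simp only [hδ, if_neg h1, if_neg h2]
      have h3 := mul_nonpos_of_nonneg_of_nonpos hφ.le hw
      have h4 : γ i * ((p : ℤ) * B.φ i' + q * B.φ j') = 0 := by rw [hbal, mul_zero]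
      linarith
  have hδb : ∀ t < B.K, |δ t| ≤ (2 * (B.N * B.N) : ℕ) := by
    intro t ht
    simp only [hδ]
    split_ifs
    · rw [abs_zero]; positivity
    · have h1 : |B.φ i * γ t| ≤ (B.N : ℤ) * B.N := by
        rw [abs_mul]; exact mul_le_mul (B.bd i hiK) (hγ t ht) (abs_nonneg _) (by positivity)
      have h2 : |γ i * B.φ t| ≤ (B.N : ℤ) * B.N := by
        rw [abs_mul]; exact mul_le_mul (hγ i hiK) (B.bd t ht) (abs_nonneg _) (by positivity)
      have h3 := abs_sub (B.φ i * γ t) (γ i * B.φ t)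
      push_cast
      linarith
  obtain ⟨k'', h1, h2, h3⟩ := hk.reduce le_rfl
  have h4 := ((h3 δ).2 hδv).trans (le_of_abs_le (abs_hg_le hδb h2))
  rw [hδ, hg_ite_lt k hl, hk.2.2] at h4
  have h5 : (D : ℤ) ≤ γ i * hg B.φ 0 k l :=
    hD.trans (le_mul_of_one_le_left (le_trans (by positivity) hD) (by omega))
  linarith

/-- Removing a balanced change preserves feasibility for the second weight. -/
theorem NS.NV.fe_of_md {B' : NS} (hK : B'.K = B.K) (hN : B'.N = B.N) (hv : B.NV B'.φ) {a : ℤ}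
    {k : ℕ → ℕ} (hk : B.Val k) {i j p q : ℕ} (hp : B.Pr i j p q)
    (h0 : (p : ℤ) * B'.φ i + q * B'.φ j = 0) (hw : 0 ≤ hg B'.φ a k B.K)
    (hh : ∀ l, i < l → l ≤ j →
      ((B.K * (B.H 1 0 * (2 * (B.N * B.N))) + 2 * (B.N * B.N) : ℕ) : ℤ) ≤ hg B.φ 0 k l)
    (h : Fe B'.K B'.ok B'.φ a (TVASSpaper.md k i j p q)) : Fe B'.K B'.ok B'.φ a k := by
  refine NS.fe_of h fun l hl => ?_
  have hij := hp.le
  rw [TVASSpaper.hg_md]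
  by_cases hil : i < l
  · by_cases hlj : l ≤ j
    · rw [if_pos hil, if_neg (by omega), add_zero]
      rcases le_or_gt (B'.φ i) 0 with h1 | h1
      · left
        have := mul_nonpos_of_nonneg_of_nonpos (Int.natCast_nonneg p) h1
        linarith
      · right
        have h2 : 0 < B.φ i := by
          obtain ⟨_, _, _, _, _, _, _, h | h⟩ := hp
          · omega
          · exact h.2.1
        have h3 := hv.height_ge (fun l hl => hN ▸ B'.bd l (hK ▸ hl)) hk hp.2.2.1 h2 h1 hil
          (hK ▸ hl) (hh l hil hlj)
        have h4 := le_of_abs_le (B.bd i hp.1)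
        rw [hg_eq_add] at hw ⊢
        rw [hN]
        by_contra! h5
        have h6 : B.φ i * (2 * B.N : ℕ) ≤ (B.N : ℤ) * (2 * B.N : ℕ) := by gcongr
        have h7 := mul_lt_mul_of_pos_left h5 h2
        have h8 := mul_nonneg h2.le hw
        push_cast at *
        linarith
    · left
      rw [if_pos hil, if_pos (by omega)]
      linarith
  · left
    rw [if_neg hil, if_neg (by omega)]
    linarith

end LowRuns

section AxisLow

variable {Q E : Type} {A : Sys Q E}

theorem Sys.Sch.swap {L K : ℕ} {w : ℕ → List E} {st : ℕ → Q} (h : A.Sch L K w st) :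
    A.swap.Sch L K w st :=
  ⟨fun l hl => Sys.walk_swap.2 (h.walk l hl), h.len⟩

open Classical in
/-- A run between low configurations on the axis can be shortened, or be changed to end at a high
configuration. -/
theorem Sys.Sch.short_or_high [Fintype Q] {X : ℕ} (hA : A.Bdd X) {L K : ℕ} {w : ℕ → List E}
    {st : ℕ → Q} (hs : A.Sch L K w st) {k : ℕ → ℕ} (hk : Adm K st k) {a b : ℤ} (ha : 0 ≤ a)
    (haX : a ≤ X) (hr : A.Run (st 0, 0, a) (fl w k K) (st K, 0, b)) {N R T D Z : ℕ}
    (hN : N = L * X + 1) (hR : R = X * (N + X * X * N + 2 * (X * X) ^ 2 + 1)) (hT : T = R * X + X)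
    (hD : D = K * (hB K N T 1 0 * (2 * (N * N))) + 2 * (N * N))
    (hZ : Z = hB K N T 1 D) :
    A.SF (st 0, 0, a) (K * ((Z + (K * (Z * N) + X) * N) * L)) (st K, 0, b) ∨
      ∃ h : ℤ, X ≤ h ∧ A.LP (K + 1) (st 0, 0, a) (K * L + (L + R)) (st K, 0, h) := by
  have hX := hA.two
  by_cases hc : ∃ j < K, (st j = st (j + 1) ∧ sm A.f (w j) < 0 ∧ 0 < sm A.g (w j)) ∧ T ≤ k j
  · obtain ⟨j, h1, ⟨h2, h3, h4⟩, h5⟩ := hc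
    right
    exact trade_high hA hs hk ha hr h1 h2 h3 h4 (hN ▸ hR) (hT ▸ h5)
  push Not at hc
  have hcap : ∀ l, (if st l = st (l + 1) then T else 1) ≤ T := by
    intro l; split_ifs <;> omega
  have hcap0 : ∀ l : ℕ, (fun _ => T : ℕ → ℕ) l ≤ T := fun _ => le_rfl
  obtain ⟨B, hBe⟩ : ∃ B, B = hs.ns hA.f
    (fun l => st l = st (l + 1) ∧ ¬ (sm A.f (w l) < 0 ∧ 0 < sm A.g (w l))) hcap := ⟨_, rfl⟩
  obtain ⟨B', hBe'⟩ : ∃ B', B' = hs.swap.ns hA.g (fun _ => True) hcap0 := ⟨_, rfl⟩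
  have hBK : B.K = K := by rw [hBe]; rfl
  have hBN : B.N = N := by rw [hBe, hN]; rfl
  have hBφ : B.φ = fun l => sm A.f (w l) := by rw [hBe]; rfl
  have hBT : B.T = T := by rw [hBe]; rfl
  have hBH : ∀ M D, B.H M D = hB K N T M D := by intro M D; simp only [NS.H, hB, hBK, hBN, hBT]
  have hBK' : B'.K = K := by rw [hBe']; rfl
  have hBN' : B'.N = N := by rw [hBe', hN]; rfl
  have hBφ' : B'.φ = fun l => sm A.g (w l) := by rw [hBe']; rfl
  have hBo' : B'.ok = fun l v => Nn A.g v (w l) := by rw [hBe']; rfl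
  obtain ⟨h1, h2, h3, h4, h5⟩ := hr
  simp only at h1 h2 h3 h4 h5
  have hb : 0 ≤ b := by rw [h5]; exact h3.right ha
  have hone : ∀ l < K, 1 ≤ k l := fun l hl => (hk l hl).1
  have hval : B.Val k := by
    rw [hBe]
    refine ⟨fun l hl => ⟨hone l hl, fun hac => ?_⟩, (Nn_fl le_rfl hone).1 h2, ?_⟩
    · have h6 := (hk l hl).2
      have h7 := hc l hl
      show k l ≤ if st l = st (l + 1) then T else 1
      have h8 : ¬ (st l = st (l + 1) ∧ ¬ (sm A.f (w l) < 0 ∧ 0 < sm A.g (w l))) := hac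
      split_ifs with h9
      · rw [not_and, not_not] at h8
        exact (h7 ⟨h9, h8 h9⟩).le
      · rcases h6 with h6 | h6
        · omega
        · exact absurd h6 h9
    · exact (sm_fl A.f w k 0 K).trans h4.symm
  have hfe : Fe B'.K B'.ok B'.φ a k := by
    rw [hBK', hBo', hBφ']
    exact (Nn_fl ha hone).1 h3
  have hw : hg B'.φ 0 k B.K = b - a := by
    rw [hBφ', hBK, sm_fl]; linarith
  have hγ : ∀ l < B.K, |B'.φ l| ≤ B.N := fun l hl => by
    have := B'.bd l (by rw [hBK', ← hBK]; exact hl)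
    rwa [hBN', ← hBN] at this
  have key : ∀ k', B.Val k' → Fe B'.K B'.ok B'.φ a k' → Adm K st k' ∧
      A.Run (st 0, 0, a) (fl w k' K) (st K, 0, a + hg B'.φ 0 k' B.K) := by
    intro k' hk' hfe'
    rw [hBe] at hk'
    obtain ⟨h6, h7, h8, h9⟩ := hs.op hA.f hcap (fun l hl => ⟨fun h => hl h.1, by simp [hl]⟩) hk'
    refine ⟨h6, h7, h8, ?_, by simp [h9], ?_⟩
    · rw [hBK', hBo', hBφ'] at hfe'
      exact (Nn_fl ha fun l hl => (h6 l hl).1).2 hfe'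
    · rw [hBφ', hBK, sm_fl, zero_add]
  by_cases hv : B.NV B'.φ
  · left
    obtain ⟨k', h6, ⟨h7, -⟩, h8, h9⟩ := hval.exists_exact hγ hv (A := X) (D := D)
      (by
        rw [hBN, hD]
        exact (Nat.mul_le_mul_left 2 (Nat.le_mul_self N)).trans (Nat.le_add_left _ _))
      (by rw [hw]; omega)
      (P := fun k' => Fe B'.K B'.ok B'.φ a k' ∧ hg B'.φ 0 k' B.K = b - a) ⟨hfe, hw⟩
      (fun k' i j p q hp h0 hk' hh hP => by
        have h10 := hp.hg_md_K B'.φ 1 k' 0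
        rw [h0, one_mul, one_mul, mul_zero, add_zero, hP.2] at h10
        refine ⟨NS.NV.fe_of_md (by rw [hBK', hBK]) (by rw [hBN', hBN]) hv hk' hp h0 ?_ ?_ hP.1,
          h10.symm⟩
        · rw [hg_eq_add, ← h10]; omega
        · intro l hl hl'
          rw [hBK, hBN, hBH, ← hD]
          exact hh l hl hl')
    obtain ⟨h10, h11⟩ := key k' h6 h7
    rw [h8, hw, add_sub_cancel] at h11
    refine ⟨_, length_fl_le hs.len (H := Z + (K * (Z * N) + X) * N) fun l hl => ?_, h11⟩
    have := h9 l (by rw [hBK]; exact hl)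
    rwa [hBH, ← hZ, hBK, hBN] at this
  · right
    simp only [NS.NV, not_forall, not_le] at hv
    obtain ⟨i, j, p, q, hp, hpos⟩ := hv
    have hi0 : 0 ≤ B'.φ i := by
      have h6 := hp.2.2.2.1
      obtain ⟨_, _, _, _, _, _, _, ⟨rfl, _, rfl, rfl⟩ | h⟩ := hp
      · simp only [Nat.cast_one, one_mul, Nat.cast_zero, zero_mul, add_zero] at hpos
        exact hpos.le
      · by_contra! hneg
        have h7 : st j = st (j + 1) ∧ ¬ (sm A.f (w j) < 0 ∧ 0 < sm A.g (w j)) := by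
          rw [hBe] at h6; exact h6
        have h8 := h.2.2.1
        rw [hBφ] at h8
        rw [hBφ'] at hpos hneg
        have h9 : sm A.g (w j) ≤ 0 := by
          by_contra! h9; exact h7.2 ⟨h8, h9⟩
        have h10 := mul_nonpos_of_nonneg_of_nonpos (Int.natCast_nonneg q) h9
        have h11 := mul_nonpos_of_nonneg_of_nonpos (Int.natCast_nonneg p) hneg.le
        simp only at h10 h11 hpos
        linarith
    have h6 := hval.md hp X
    have h7 : Fe B'.K B'.ok B'.φ a (TVASSpaper.md k i j (X * p) (X * q)) := by
      refine NS.fe_of hfe fun l hl => .inl ?_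
      rw [hg_md]
      push_cast
      have hij := hp.le
      have h8 : 0 ≤ (X : ℤ) * (p * B'.φ i + q * B'.φ j) := mul_nonneg (by positivity) hpos.le
      have h9 : 0 ≤ (X : ℤ) * p * B'.φ i := by positivity
      split_ifs
      · linarith
      · linarith
      · omega
      · linarith
    obtain ⟨h8, h9⟩ := key _ h6 h7
    refine ⟨_, ?_, (hs.lp h8 le_rfl h9).mono (by omega) (by omega)⟩
    rw [hp.hg_md_K, hw]
    have : (X : ℤ) ≤ X * (p * B'.φ i + q * B'.φ j) :=
      le_mul_of_one_le_right (by positivity) (by omega)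
    linarith

/-- A run between configurations on the axis that starts low can be shortened, or be changed to end
at a high configuration. -/
theorem axis_low : ∃ F, PB F ∧ ∀ {Q E : Type} [Fintype Q] (A : Sys Q E) {X : ℕ}, A.Bdd X →
    ∀ {s t : Q} {a b : ℤ} {l : List E}, 0 ≤ a → a ≤ X → A.Run (s, 0, a) l (t, 0, b) →
    A.SF (s, 0, a) (F X) (t, 0, b) ∨
      ∃ h : ℤ, X ≤ h ∧ A.LP (14 * Fintype.card Q + 8) (s, 0, a) (F X) (t, 0, h) := by
  obtain ⟨F, hF, h⟩ := axis_sch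
  obtain ⟨N, hN⟩ : ∃ N : ℕ → ℕ, N = fun X => F X * X + 1 := ⟨_, rfl⟩
  obtain ⟨R, hR⟩ : ∃ R : ℕ → ℕ, R = fun X => X * (N X + X * X * N X + 2 * (X * X) ^ 2 + 1) :=
    ⟨_, rfl⟩
  obtain ⟨T, hT⟩ : ∃ T : ℕ → ℕ, T = fun X => R X * X + X := ⟨_, rfl⟩
  obtain ⟨K, hK⟩ : ∃ K : ℕ → ℕ, K = fun X => 14 * X + 7 := ⟨_, rfl⟩
  obtain ⟨D, hD⟩ : ∃ D : ℕ → ℕ, D = fun X =>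
    K X * (hB (K X) (N X) (T X) 1 0 * (2 * (N X * N X))) + 2 * (N X * N X) := ⟨_, rfl⟩
  obtain ⟨Z, hZ⟩ : ∃ Z : ℕ → ℕ, Z = fun X => hB (K X) (N X) (T X) 1 (D X) := ⟨_, rfl⟩
  have pN : PB N := by rw [hN]; fun_prop
  have pR : PB R := by rw [hR]; fun_prop
  have pT : PB T := by rw [hT]; fun_prop
  have pK : PB K := by rw [hK]; fun_prop
  have pD : PB D := by rw [hD]; unfold hB; fun_prop
  have pZ : PB Z := by rw [hZ]; unfold hB; fun_prop
  refine ⟨fun X => K X * ((Z X + (K X * (Z X * N X) + X) * N X) * F X) + (K X * F X + (F X + R X)),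
    by fun_prop, ?_⟩
  intro Q E _ A X hA s t a b l ha haX hl
  obtain ⟨K', w, st, k, h1, h2, h3, rfl, rfl, h4⟩ := h A hA ha hl
  have hcard := hA.card
  have hK' : K' ≤ K X := by rw [hK]; show K' ≤ 14 * X + 7; omega
  rcases h1.short_or_high hA h3 ha haX h4 (congrFun hN X) (congrFun hR X) (congrFun hT X) rfl rfl
    with h5 | ⟨y, h5, h6⟩
  · left
    refine Sys.SF.comp.mono h5 (le_trans ?_ (Nat.le_add_right _ _))
    have hD' : K' * (hB K' (N X) (T X) 1 0 * (2 * (N X * N X))) + 2 * (N X * N X) ≤ D X := by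
      rw [hD]; unfold hB; beta_reduce; gcongr
    have hZ' : hB K' (N X) (T X) 1 (K' * (hB K' (N X) (T X) 1 0 * (2 * (N X * N X))) +
        2 * (N X * N X)) ≤ Z X := by
      rw [hZ]; unfold hB at hD' ⊢; beta_reduce; gcongr
    gcongr
  · right
    refine ⟨y, h5, h6.mono (by omega) ?_⟩
    have h7 : K' * F X ≤ K X * F X := Nat.mul_le_mul_right _ hK'
    beta_reduce
    omega

end AxisLow

section ZeroTests

variable {Q E : Type} {Z : Set E} {A : Sys Q E}

/-- Edges in `Z` are taken only at value `0`. -/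
def Zok (Z : Set E) (f : E → ℤ) : ℤ → List E → Prop
  | _, [] => True
  | v, e :: l => (e ∈ Z → v = 0) ∧ Zok Z f (v + f e) l

theorem Zok_append {f : E → ℤ} {v : ℤ} {l l' : List E} :
    Zok Z f v (l ++ l') ↔ Zok Z f v l ∧ Zok Z f (v + sm f l) l' := by
  induction l generalizing v with
  | nil => simp [Zok]
  | cons e l ih => simp [Zok, ih, and_assoc, add_assoc]

theorem Zok_of_notMem {f : E → ℤ} {l : List E} (h : ∀ e ∈ l, e ∉ Z) (v : ℤ) : Zok Z f v l := by
  induction l generalizing v with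
  | nil => trivial
  | cons e l ih =>
    exact ⟨fun he => absurd he (h e List.mem_cons_self),
      ih (fun e he => h e (List.mem_cons_of_mem _ he)) _⟩

/-- Edges in `Z` have weight `0`. -/
def Sys.ZT (A : Sys Q E) (Z : Set E) : Prop := ∀ e ∈ Z, A.f e = 0 ∧ A.g e = 0

theorem Sys.ZT.rev (hz : A.ZT Z) : A.rev.ZT Z := fun e he => by
  simp [Sys.rev, hz e he]

theorem Sys.ZT.zok_reverse (hz : A.ZT Z) {v : ℤ} {l : List E} (h : Zok Z A.f v l) :
    Zok Z A.rev.f (v + sm A.f l) l.reverse := by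
  induction l generalizing v with
  | nil => trivial
  | cons e l ih =>
    have := ih h.2
    rw [List.reverse_cons, Zok_append, sm_cons, ← add_assoc]
    refine ⟨this, fun he => ?_, trivial⟩
    have h1 := h.1 he
    have h2 := (hz e he).1
    simp [Sys.rev, h1, h2]

/-- Runs with zero-tests. -/
def Sys.ZR (A : Sys Q E) (Z : Set E) (c : Cfg Q) (l : List E) (c' : Cfg Q) : Prop :=
  A.Run c l c' ∧ Zok Z A.f c.2.1 l

theorem Sys.ZR.append {a b c : Cfg Q} {l l' : List E} (h : A.ZR Z a l b) (h' : A.ZR Z b l' c) :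
    A.ZR Z a (l ++ l') c :=
  ⟨h.1.append h'.1, Zok_append.2 ⟨h.2, h.1.2.2.2.1 ▸ h'.2⟩⟩

theorem Sys.ZT.run_reverse (hz : A.ZT Z) {a b : Cfg Q} {l : List E} (h : A.ZR Z a l b)
    (ha : Pos a) : A.rev.ZR Z b l.reverse a :=
  ⟨h.1.reverse ha, h.1.2.2.2.1 ▸ hz.zok_reverse h.2⟩

/-- Short runs with zero-tests. -/
def Sys.SFz (A : Sys Q E) (Z : Set E) (c : Cfg Q) (m : ℕ) (c' : Cfg Q) : Prop :=
  ∃ l, l.length ≤ m ∧ A.ZR Z c l c'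

theorem Sys.SFz.comp : Comp (A.SFz Z) where
  nil a := ⟨[], le_rfl, Sys.run_nil a, trivial⟩
  trans := fun ⟨l, h1, h2⟩ ⟨l', h3, h4⟩ => ⟨l ++ l', by simp; omega, h2.append h4⟩
  mono := fun ⟨l, h1, h2⟩ h => ⟨l, h1.trans h, h2⟩

/-- Runs with zero-tests along few blocks. -/
def Sys.LPz (A : Sys Q E) (Z : Set E) (k : ℕ) (c : Cfg Q) (N : ℕ) (c' : Cfg Q) : Prop :=
  ∃ bs, A.Blk bs ∧ bs.length ≤ k ∧ bsz bs ≤ N ∧ A.ZR Z c (flat bs) c'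

theorem Sys.LPz.trans {k k' m n : ℕ} {a b c : Cfg Q} (h : A.LPz Z k a m b)
    (h' : A.LPz Z k' b n c) : A.LPz Z (k + k') a (m + n) c := by
  obtain ⟨bs, h1, h2, h3, h4⟩ := h
  obtain ⟨bs', k1, k2, k3, k4⟩ := h'
  refine ⟨bs ++ bs', ?_, by simp; omega, by simp [bsz] at *; omega, ?_⟩
  · intro b hb
    rcases List.mem_append.1 hb with hb | hb
    · exact h1 b hb
    · exact k1 b hb
  · simpa [flat] using h4.append k4

theorem Sys.LPz.mono {k k' m n : ℕ} {a b : Cfg Q} (h : A.LPz Z k a m b) (hk : k ≤ k')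
    (hm : m ≤ n) : A.LPz Z k' a n b :=
  let ⟨bs, h1, h2, h3, h4⟩ := h; ⟨bs, h1, h2.trans hk, h3.trans hm, h4⟩

theorem Sys.SFz.lp {m : ℕ} {a b : Cfg Q} (h : A.SFz Z a m b) : A.LPz Z 1 a m b := by
  obtain ⟨l, h1, h2⟩ := h
  exact ⟨[(l, 1)], by simp [Sys.Blk], by simp, by simpa [bsz] using h1, by simpa [flat] using h2⟩

theorem Sys.LPz.rev (hz : A.ZT Z) {k m : ℕ} {a b : Cfg Q} (h : A.LPz Z k a m b) (ha : Pos a) :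
    A.rev.LPz Z k b m a := by
  obtain ⟨bs, h1, h2, h3, h4⟩ := h
  refine ⟨(bs.map fun b => (b.1.reverse, b.2)).reverse, ?_, by simpa, ?_, ?_⟩
  · intro b hb
    simp only [List.mem_reverse, List.mem_map] at hb
    obtain ⟨b', hb', rfl⟩ := hb
    exact (h1 b' hb').imp id fun ⟨s, hs⟩ => ⟨s, hs.reverse⟩
  · simpa [bsz, List.sum_reverse, Function.comp_def] using h3
  · rw [← flat_reverse]; exact hz.run_reverse h4 ha

/-- The system without the edges in `Z`. -/
def Sys.plain (A : Sys Q E) (Z : Set E) : Sys Q E := ⟨A.src, A.tgt, A.T \ Z, A.f, A.g⟩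

theorem Sys.Bdd.plain [Fintype Q] {X : ℕ} (h : A.Bdd X) : (A.plain Z).Bdd X :=
  ⟨h.two, h.card, fun e he => h.f e he.1, fun e he => h.g e he.1⟩

theorem Sys.Walk.of_plain {s t : Q} {l : List E} (h : (A.plain Z).Walk s l t) : A.Walk s l t := by
  induction l generalizing s with
  | nil => exact h
  | cons e l ih => exact ⟨h.1.1, h.2.1, ih h.2.2⟩

theorem Sys.Walk.zok {s t : Q} {l : List E} (h : (A.plain Z).Walk s l t) (v : ℤ) : Zok Z A.f v l :=
  Zok_of_notMem (fun e he => (h.mem e he).2) v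

theorem Sys.Run.of_plain {a b : Cfg Q} {l : List E} (h : (A.plain Z).Run a l b) : A.ZR Z a l b :=
  ⟨⟨h.1.of_plain, h.2⟩, h.1.zok _⟩

theorem Sys.SF.of_plain {a b : Cfg Q} {m : ℕ} (h : (A.plain Z).SF a m b) : A.SFz Z a m b :=
  let ⟨l, h1, h2⟩ := h; ⟨l, h1, h2.of_plain⟩

theorem Sys.LP.of_plain {a b : Cfg Q} {k m : ℕ} (h : (A.plain Z).LP k a m b) : A.LPz Z k a m b :=
  let ⟨bs, h1, h2, h3, h4⟩ := h
  ⟨bs, fun b hb => (h1 b hb).imp id fun ⟨s, hs⟩ => ⟨s, hs.of_plain⟩, h2, h3, h4.of_plain⟩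

/-- Walks between configurations on the axis, feasible in the first counter. -/
def Sys.OC (A : Sys Q E) (Z : Set E) (s : Q) (l : List E) (t : Q) : Prop :=
  A.Walk s l t ∧ Nn A.f 0 l ∧ sm A.f l = 0 ∧ Zok Z A.f 0 l

theorem Sys.OP.oc {s t : Q} {l : List E} (h : (A.plain Z).OP s l t) : A.OC Z s l t :=
  ⟨h.1.of_plain, h.2.1, h.2.2, h.1.zok 0⟩

theorem Sys.OC.nil (s : Q) : A.OC Z s [] s := ⟨rfl, trivial, rfl, trivial⟩

theorem Sys.OC.append {r s t : Q} {l l' : List E} (h : A.OC Z r l s) (h' : A.OC Z s l' t) :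
    A.OC Z r (l ++ l') t := by
  obtain ⟨h1, h2, h3, h4⟩ := h
  obtain ⟨k1, k2, k3, k4⟩ := h'
  refine ⟨h1.append k1, ?_, ?_, ?_⟩
  · rw [Nn_append, h3]; exact ⟨h2, k2⟩
  · rw [sm_append, h3, k3, add_zero]
  · rw [Zok_append, h3]; exact ⟨h4, k4⟩

theorem Sys.OC.pw {s : Q} {l : List E} (h : A.OC Z s l s) (n : ℕ) : A.OC Z s (pw l n) s := by
  induction n with
  | zero => exact .nil s
  | succ n ih => rw [pw_succ]; exact h.append ih

theorem Sys.OC.reverse (hz : A.ZT Z) {s t : Q} {l : List E} (h : A.OC Z s l t) :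
    A.rev.OC Z t l.reverse s := by
  obtain ⟨h1, h2, h3, h4⟩ := h
  have h5 := Nn_reverse h2 le_rfl
  have h6 := hz.zok_reverse h4
  rw [h3] at h5 h6
  refine ⟨h1.reverse, h5, ?_, h6⟩
  simp [Sys.rev, h3]

theorem Sys.OC.of_run {s t : Q} {a b : ℤ} {l : List E} (h : A.ZR Z (s, 0, a) l (t, 0, b)) :
    A.OC Z s l t ∧ sm A.g l = b - a := by
  obtain ⟨⟨h1, h2, h3, h4, h5⟩, h6⟩ := h
  simp only at h1 h2 h3 h4 h5
  exact ⟨⟨h1, h2, by linarith, h6⟩, by linarith⟩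

section Lift

variable [Fintype Q] {X : ℕ}

theorem Sys.OC.abs_sm_le (hA : A.Bdd X) {s t : Q} {l : List E}
    (h : A.OC Z s l t) {P : ℕ} (hl : l.length ≤ P) :
    |sm A.g l| ≤ (P * X : ℕ) := by
  refine (TVASSpaper.abs_sm_le fun e he => hA.g e (h.1.mem e he)).trans ?_
  exact_mod_cast Nat.mul_le_mul_right X hl

theorem Sys.OC.run (hA : A.Bdd X) {s t : Q} {l : List E}
    (h : A.OC Z s l t) {P : ℕ} (hl : l.length ≤ P) {a : ℤ}
    (ha : (P * X : ℕ) ≤ a) : A.ZR Z (s, 0, a) l (t, 0, a + sm A.g l) := by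
  refine ⟨⟨h.1, h.2.1, Nn_of_len (fun e he => hA.g e (h.1.mem e he)) (le_trans ?_ ha),
    by simp [h.2.2.1], rfl⟩, h.2.2.2⟩
  exact_mod_cast Nat.mul_le_mul_right X hl

theorem Sys.OC.lp (hA : A.Bdd X) {s t : Q} {l : List E}
    (h : A.OC Z s l t) {P : ℕ} (hl : l.length ≤ P) {a b : ℤ}
    (ha : (P * X : ℕ) ≤ a) (hb : b = a + sm A.g l) : A.LPz Z 1 (s, 0, a) P (t, 0, b) :=
  hb ▸ Sys.SFz.lp ⟨l, hl, h.run hA hl ha⟩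

theorem Sys.OC.lp_pw (hA : A.Bdd X) {s : Q} {l : List E}
    (h : A.OC Z s l s) {P : ℕ} (hl : l.length ≤ P) {a b : ℤ}
    {k : ℕ} (ha : (P * X : ℕ) ≤ a) (hb : b = a + k * sm A.g l) (hb' : (P * X : ℕ) ≤ b) :
    A.LPz Z 1 (s, 0, a) P (s, 0, b) := by
  refine ⟨[(l, k)], by simpa [Sys.Blk] using .inr ⟨_, h.1⟩, by simp, by simpa [bsz], ?_⟩
  have h1 := h.abs_sm_le hA hl
  rw [abs_le] at h1
  have h2 := h.pw k
  have h3 : Nn A.g a (TVASSpaper.pw l k) := by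
    refine Nn_pw fun hk => ⟨(h.run hA hl ha).1.2.2.1, ?_⟩
    have hlX : ((l.length * X : ℕ) : ℤ) ≤ (P * X : ℕ) := by
      exact_mod_cast Nat.mul_le_mul_right X hl
    rcases le_total 0 (sm A.g l) with h4 | h4
    · refine (h.run hA hl ha).1.2.2.1.mono ?_
      have : (0 : ℤ) ≤ (k - 1) * sm A.g l := mul_nonneg (by omega) h4
      simp only
      linarith
    · refine Nn_of_len (fun e he => hA.g e (h.1.mem e he)) (hlX.trans (hb'.trans ?_))
      rw [hb]; linarith
  simp only [flat, List.flatMap_cons, List.flatMap_nil, List.append_nil]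
  exact ⟨⟨h2.1, h2.2.1, h3, by simp [h.2.2.1], by simp [hb]⟩, h2.2.2.2⟩

end Lift

end ZeroTests

section Axis

variable {Q E : Type} {Z : Set E} {A : Sys Q E}

/-- Walks of weight `w` between configurations on the axis, feasible in the first counter. -/
def Sys.Ow (A : Sys Q E) (Z : Set E) (s : Q) (w : ℤ) (t : Q) : Prop :=
  ∃ l, A.OC Z s l t ∧ sm A.g l = w

/-- As `Sys.Ow`, for walks of bounded length. -/
def Sys.Ob (A : Sys Q E) (Z : Set E) (m : ℕ) (s : Q) (w : ℤ) (t : Q) : Prop :=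
  ∃ l, l.length ≤ m ∧ A.OC Z s l t ∧ sm A.g l = w

theorem Sys.Ob.ow {m : ℕ} {s t : Q} {w : ℤ} (h : A.Ob Z m s w t) : A.Ow Z s w t :=
  let ⟨l, _, h1, h2⟩ := h; ⟨l, h1, h2⟩

theorem Sys.Ob.mono {m m' : ℕ} {s t : Q} {w : ℤ} (h : A.Ob Z m s w t) (hm : m ≤ m') :
    A.Ob Z m' s w t :=
  let ⟨l, h0, h1⟩ := h; ⟨l, h0.trans hm, h1⟩

theorem Sys.Ob.nil (s : Q) : A.Ob Z 0 s 0 s := ⟨[], le_rfl, .nil s, rfl⟩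

theorem Sys.Ob.append {m m' : ℕ} {r s t : Q} {w w' : ℤ} (h : A.Ob Z m r w s)
    (h' : A.Ob Z m' s w' t) : A.Ob Z (m + m') r (w + w') t := by
  obtain ⟨l, h1, h2, rfl⟩ := h
  obtain ⟨l', h3, h4, rfl⟩ := h'
  exact ⟨l ++ l', by simp; omega, h2.append h4, by simp⟩

theorem Sys.Ow.nil (s : Q) : A.Ow Z s 0 s := (Sys.Ob.nil s).ow

theorem Sys.Ow.append {r s t : Q} {w w' : ℤ} (h : A.Ow Z r w s) (h' : A.Ow Z s w' t) :
    A.Ow Z r (w + w') t := by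
  obtain ⟨l, h2, rfl⟩ := h
  obtain ⟨l', h4, rfl⟩ := h'
  exact ⟨l ++ l', h2.append h4, by simp⟩

theorem Sys.Ow.pw {s : Q} {w : ℤ} (h : A.Ow Z s w s) (n : ℕ) : A.Ow Z s (n * w) s := by
  obtain ⟨l, h2, rfl⟩ := h
  exact ⟨_, h2.pw n, by simp⟩

theorem Sys.Ow.rev (hz : A.ZT Z) {s t : Q} {w : ℤ} (h : A.Ow Z s w t) : A.rev.Ow Z t (-w) s := by
  obtain ⟨l, h2, rfl⟩ := h
  exact ⟨_, h2.reverse hz, by simp [Sys.rev]⟩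

/-- Steps between configurations on the axis: runs without zero-tests, and zero-tests. -/
def Sys.AStep (A : Sys Q E) (Z : Set E) (a b : Q × ℤ) : Prop :=
  0 ≤ a.2 ∧ ((∃ l, (A.plain Z).Run (a.1, 0, a.2) l (b.1, 0, b.2)) ∨
    ∃ e ∈ Z, e ∈ A.T ∧ A.src e = a.1 ∧ A.tgt e = b.1 ∧ a.2 = b.2)

/-- Reachability between configurations on the axis. -/
def Sys.G (A : Sys Q E) (Z : Set E) : Q × ℤ → Q × ℤ → Prop := Relation.ReflTransGen (A.AStep Z)

theorem Sys.AStep.nonneg {a b : Q × ℤ} (h : A.AStep Z a b) : 0 ≤ b.2 := by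
  obtain ⟨h0, ⟨l, h⟩ | ⟨e, -, -, -, -, h⟩⟩ := h
  · exact (h.pos ⟨le_rfl, h0⟩).2
  · omega

theorem Sys.G.nonneg {a b : Q × ℤ} (h : A.G Z a b) (ha : 0 ≤ a.2) : 0 ≤ b.2 := by
  cases h with
  | refl => exact ha
  | tail _ h => exact h.nonneg

theorem Sys.AStep.rev {a b : Q × ℤ} (h : A.AStep Z a b) : A.rev.AStep Z b a := by
  refine ⟨h.nonneg, ?_⟩
  obtain ⟨h0, ⟨l, h⟩ | ⟨e, h1, h2, h3, h4, h5⟩⟩ := h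
  · exact .inl ⟨_, h.reverse ⟨le_rfl, h0⟩⟩
  · exact .inr ⟨e, h1, h2, h4, h3, h5.symm⟩

theorem Sys.G.rev {a b : Q × ℤ} (h : A.G Z a b) : A.rev.G Z b a := by
  induction h with
  | refl => exact .refl
  | tail _ h ih => exact .head h.rev ih

theorem Sys.ZT.test_run (hz : A.ZT Z) {e : E} (he : e ∈ Z) (hT : e ∈ A.T) {a : ℤ} (ha : 0 ≤ a) :
    A.ZR Z (A.src e, 0, a) [e] (A.tgt e, 0, a) := by
  obtain ⟨h1, h2⟩ := hz e he
  refine ⟨⟨⟨hT, rfl, rfl⟩, ?_, ?_, ?_, ?_⟩, fun _ => rfl, trivial⟩ <;> simp [h1, h2, ha]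

theorem Sys.AStep.run (hz : A.ZT Z) {a b : Q × ℤ} (h : A.AStep Z a b) :
    ∃ l, A.ZR Z (a.1, 0, a.2) l (b.1, 0, b.2) := by
  obtain ⟨h0, ⟨l, h⟩ | ⟨e, h1, h2, h3, h4, h5⟩⟩ := h
  · exact ⟨l, h.of_plain⟩
  · exact ⟨[e], by rw [← h3, ← h4, ← h5]; exact hz.test_run h1 h2 h0⟩

theorem Sys.G.run (hz : A.ZT Z) {a b : Q × ℤ} (h : A.G Z a b) :
    ∃ l, A.ZR Z (a.1, 0, a.2) l (b.1, 0, b.2) := by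
  induction h with
  | refl => exact ⟨[], Sys.run_nil _, trivial⟩
  | tail _ h ih =>
    obtain ⟨l, h1⟩ := ih
    obtain ⟨l', h2⟩ := h.run hz
    exact ⟨_, h1.append h2⟩

theorem Sys.G.ow (hz : A.ZT Z) {a b : Q × ℤ} (h : A.G Z a b) : A.Ow Z a.1 (b.2 - a.2) b.1 :=
  let ⟨_, h1⟩ := h.run hz; ⟨_, Sys.OC.of_run h1⟩

theorem Sys.ZT.g_of_run (hz : A.ZT Z) {s t : Q} {a b : ℤ} {l : List E}
    (h : A.ZR Z (s, 0, a) l (t, 0, b)) (ha : 0 ≤ a) : A.G Z (s, a) (t, b) := by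
  suffices H : ∀ (l : List E) (c : Cfg Q) (s : Q) (a : ℤ) (l₀ : List E), 0 ≤ a →
      (A.plain Z).Run (s, 0, a) l₀ c → A.ZR Z c l (t, 0, b) → A.G Z (s, a) (t, b) from
    H l _ s a [] ha (Sys.run_nil _) h
  clear h ha l s a
  intro l
  induction l with
  | nil =>
    rintro c s a l₀ ha h ⟨⟨h1, -, -, h2, h3⟩, -⟩
    have : c = (t, 0, b) := Prod.ext h1 (Prod.ext (by simpa using h2.symm) (by simpa using h3.symm))
    exact .single ⟨ha, .inl ⟨l₀, this ▸ h⟩⟩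
  | cons e l ih =>
    rintro ⟨p, x, y⟩ s a l₀ ha h ⟨⟨⟨hT, hp, h1⟩, h2, h3, h4, h5⟩, h6, h7⟩
    obtain rfl : A.src e = p := hp
    simp only [sm_cons] at h2 h3 h4 h5 h6 h7
    by_cases he : e ∈ Z
    · obtain ⟨hf, hg⟩ := hz e he
      obtain rfl : x = 0 := h6 he
      have hy : 0 ≤ y := (h.pos ⟨le_rfl, ha⟩).2
      refine .head (b := (A.src e, y)) ⟨ha, .inl ⟨_, h⟩⟩
        (.head (b := (A.tgt e, y)) ⟨hy, .inr ⟨e, he, hT, rfl, rfl, rfl⟩⟩ ?_)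
      refine ih (A.tgt e, 0, y) _ _ [] hy (Sys.run_nil _) ⟨⟨h1, ?_, ?_, ?_, ?_⟩, ?_⟩
      · simpa [hf] using h2.2
      · simpa [hg] using h3.2
      · simpa [hf] using h4
      · simpa [hg] using h5
      · simpa [hf] using h7
    · refine ih (A.tgt e, x + A.f e, y + A.g e) s a (l₀ ++ [e]) ha (h.append ?_)
        ⟨⟨h1, h2.2, h3.2, by simp only; linarith, by simp only; linarith⟩, h7⟩
      exact ⟨⟨⟨hT, he⟩, rfl, rfl⟩, ⟨h2.1, trivial⟩, ⟨h3.1, trivial⟩, by simp [Sys.plain],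
        by simp [Sys.plain]⟩

/-- Walks along the axis are feasible at a sufficient height. -/
theorem Sys.Ow.g [Fintype Q] {X : ℕ} (hA : A.Bdd X) (hz : A.ZT Z) {s t : Q} {w : ℤ}
    (h : A.Ow Z s w t) : ∃ a, 0 ≤ a ∧ A.G Z (s, a) (t, a + w) := by
  obtain ⟨l, h1, rfl⟩ := h
  exact ⟨(l.length * X : ℕ), by positivity,
    hz.g_of_run (h1.run hA le_rfl le_rfl) (by positivity)⟩

end Axis

section AxisSteps

theorem Sys.ZT.test_ob {Q E : Type} {Z : Set E} {A : Sys Q E} (hz : A.ZT Z) {e : E} (he : e ∈ Z)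
    (hT : e ∈ A.T) {m : ℕ} (hm : 1 ≤ m) : A.Ob Z m (A.src e) 0 (A.tgt e) := by
  obtain ⟨h1, h2⟩ := Sys.OC.of_run (hz.test_run he hT le_rfl)
  exact ⟨[e], hm, h1, by simpa using h2⟩

theorem step_mod : ∃ F, PB F ∧ ∀ {Q E : Type} [Fintype Q] (A : Sys Q E) {X : ℕ}, A.Bdd X →
    ∀ {Z : Set E}, A.ZT Z → ∀ {M : ℕ}, 1 ≤ M → M ≤ X → ∀ {u u' : Q × ℤ}, A.AStep Z u u' →
    ∃ w, A.Ob Z (F X) u.1 w u'.1 ∧ (M : ℤ) ∣ (u'.2 - u.2) - w := by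
  obtain ⟨F, hF, H⟩ := axis_mod
  refine ⟨fun X => F X + 1, by fun_prop, ?_⟩
  intro Q E _ A X hA Z hz M hM hMX u u' h
  beta_reduce
  obtain ⟨h0, ⟨l, h⟩ | ⟨e, h1, h2, h3, h4, h5⟩⟩ := h
  · obtain ⟨l', h1, h2, h3⟩ := H _ hA.plain hM hMX h0 h
    exact ⟨_, ⟨l', by omega, h1.oc, rfl⟩, h3⟩
  · exact ⟨0, h3 ▸ h4 ▸ hz.test_ob h1 h2 (by simp), by simp [h5]⟩

theorem step_min : ∃ F, PB F ∧ ∀ {Q E : Type} [Fintype Q] (A : Sys Q E) {X : ℕ}, A.Bdd X →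
    ∀ {Z : Set E}, A.ZT Z → ∀ {u u' : Q × ℤ}, A.AStep Z u u' →
    ∃ w, A.Ob Z (F X) u.1 w u'.1 ∧ min (u'.2 - u.2) X ≤ w := by
  obtain ⟨F, hF, H⟩ := axis_min
  refine ⟨fun X => F X + 1, by fun_prop, ?_⟩
  intro Q E _ A X hA Z hz u u' h
  beta_reduce
  obtain ⟨h0, ⟨l, h⟩ | ⟨e, h1, h2, h3, h4, h5⟩⟩ := h
  · obtain ⟨l', h1, h2, h3⟩ := H _ hA.plain h0 h
    exact ⟨_, ⟨l', by omega, h1.oc, rfl⟩, h3⟩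
  · exact ⟨0, h3 ▸ h4 ▸ hz.test_ob h1 h2 (by simp), by simp [h5]⟩

theorem step_exact : ∃ F, PB F ∧ ∀ {Q E : Type} [Fintype Q] (A : Sys Q E) {X : ℕ}, A.Bdd X →
    ∀ {Z : Set E}, A.ZT Z → ∀ {u u' : Q × ℤ}, A.AStep Z u u' → u.2 - u'.2 ≤ X →
    A.Ob Z (F X) u.1 (u'.2 - u.2) u'.1 ∨ ∀ W : ℤ, ∃ w, W ≤ w ∧ A.Ow Z u.1 w u'.1 := by
  obtain ⟨F, hF, H⟩ := axis_exact
  refine ⟨fun X => F X + 1, by fun_prop, ?_⟩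
  intro Q E _ A X hA Z hz u u' h hX
  beta_reduce
  obtain ⟨h0, ⟨l, h⟩ | ⟨e, h1, h2, h3, h4, h5⟩⟩ := h
  · refine (H _ hA.plain h0 h hX).imp ?_ ?_
    · rintro ⟨l', h1, h2, h3⟩
      exact ⟨l', by omega, h1.oc, h3⟩
    · intro h W
      obtain ⟨l', h1, h2⟩ := h W
      exact ⟨_, h2, l', h1.oc, rfl⟩
  · left
    rw [← h3, ← h4, h5, sub_self]
    exact hz.test_ob h1 h2 (by simp)

theorem step_low : ∃ F, PB F ∧ ∀ {Q E : Type} [Fintype Q] (A : Sys Q E) {X : ℕ}, A.Bdd X →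
    ∀ {Z : Set E}, A.ZT Z → ∀ {u u' : Q × ℤ}, A.AStep Z u u' → u.2 ≤ X →
    A.SFz Z (u.1, 0, u.2) (F X) (u'.1, 0, u'.2) ∨
      ∃ h : ℤ, X ≤ h ∧ A.LPz Z (14 * Fintype.card Q + 8) (u.1, 0, u.2) (F X) (u'.1, 0, h) := by
  obtain ⟨F, hF, H⟩ := axis_low
  refine ⟨fun X => F X + 1, by fun_prop, ?_⟩
  intro Q E _ A X hA Z hz u u' h hX
  beta_reduce
  obtain ⟨h0, ⟨l, h⟩ | ⟨e, h1, h2, h3, h4, h5⟩⟩ := h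
  · refine (H _ hA.plain h0 hX h).imp ?_ ?_
    · exact fun h => Sys.SFz.comp.mono h.of_plain (by omega)
    · rintro ⟨k, h1, h2⟩
      exact ⟨k, h1, h2.of_plain.mono le_rfl (by omega)⟩
  · left
    rw [← h3, ← h4, ← h5]
    exact ⟨[e], by simp, hz.test_run h1 h2 h0⟩

theorem step_lp : ∃ F, PB F ∧ ∀ {Q E : Type} [Fintype Q] (A : Sys Q E) {X : ℕ}, A.Bdd X →
    ∀ {Z : Set E}, A.ZT Z → ∀ {u u' : Q × ℤ}, A.AStep Z u u' →
    A.LPz Z (14 * Fintype.card Q + 8) (u.1, 0, u.2) (F X) (u'.1, 0, u'.2) := by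
  obtain ⟨F, hF, H⟩ := plain_lp
  refine ⟨fun X => F X + 1, by fun_prop, ?_⟩
  intro Q E _ A X hA Z hz u u' h
  beta_reduce
  obtain ⟨h0, ⟨l, h⟩ | ⟨e, h1, h2, h3, h4, h5⟩⟩ := h
  · exact (H _ hA.plain ⟨le_rfl, h0⟩ h).of_plain.mono (by omega) (by omega)
  · rw [← h3, ← h4, ← h5]
    exact (Sys.SFz.lp (m := 1) ⟨[e], le_rfl, hz.test_run h1 h2 h0⟩).mono (by omega) (by omega)

end AxisSteps

section Shorten

theorem Sys.rev_rev {Q E : Type} (A : Sys Q E) : A.rev.rev = A := by simp [Sys.rev]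

theorem Sys.Ob.rev {Q E : Type} {Z : Set E} {A : Sys Q E} (hz : A.ZT Z) {m : ℕ} {s t : Q} {w : ℤ}
    (h : A.Ob Z m s w t) : A.rev.Ob Z m t (-w) s := by
  obtain ⟨l, h1, h2, rfl⟩ := h
  exact ⟨_, by simpa, h2.reverse hz, by simp [Sys.rev]⟩

theorem Sys.Ob.abs_le {Q E : Type} [Fintype Q] {Z : Set E} {A : Sys Q E} {X : ℕ} (hA : A.Bdd X)
    {m : ℕ} {s t : Q} {w : ℤ} (h : A.Ob Z m s w t) : |w| ≤ (m * X : ℕ) := by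
  obtain ⟨l, h1, h2, rfl⟩ := h
  exact h2.abs_sm_le hA h1

/-- Walks along the axis can be shortened, preserving the weight modulo a given number. -/
theorem ow_mod : ∃ F, PB F ∧ ∀ {Q E : Type} [Fintype Q] (A : Sys Q E) {X : ℕ}, A.Bdd X →
    ∀ {Z : Set E}, A.ZT Z → ∀ {M : ℕ}, 1 ≤ M → M ≤ X → ∀ {s t : Q} {w : ℤ}, A.Ow Z s w t →
    ∃ w', A.Ob Z (F X) s w' t ∧ (M : ℤ) ∣ w - w' := by
  obtain ⟨F, hF, H⟩ := step_mod
  refine ⟨fun X => X * X * F X, by fun_prop, ?_⟩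
  intro Q E _ A X hA Z hz M hM hMX s t w h
  obtain ⟨a, ha, h⟩ := h.g hA hz
  have : NeZero M := ⟨by omega⟩
  let W : Q × ZMod M → ℕ → Q × ZMod M → Prop := fun x m y =>
    ∃ w, A.Ob Z m x.1 w y.1 ∧ (w : ZMod M) = y.2 - x.2
  have hW : Comp W :=
    { nil := fun a => ⟨0, .nil _, by simp⟩
      trans := fun ⟨w, h1, h2⟩ ⟨w', h3, h4⟩ => ⟨w + w', h1.append h3, by push_cast; rw [h2, h4]; ring⟩
      mono := fun ⟨w, h1, h2⟩ hm => ⟨w, h1.mono hm, h2⟩ }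
  have h1 := Relation.ReflTransGen.lift (p := fun x y => W x (F X) y)
    (fun u : Q × ℤ => (u.1, (u.2 : ZMod M))) (fun u u' hu => by
      obtain ⟨w, h1, h2⟩ := H A hA hz hM hMX hu
      refine ⟨w, h1, ?_⟩
      rw [← ZMod.intCast_zmod_eq_zero_iff_dvd] at h2
      push_cast at h2
      exact (sub_eq_zero.1 h2).symm) _ _ h
  obtain ⟨w', h2, h3⟩ := hW.fin Finset.univ (fun x y h => ⟨Finset.mem_univ _, h⟩)
    (Finset.mem_univ _) h1
  refine ⟨w', h2.mono ?_, ?_⟩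
  · rw [Finset.card_univ, Fintype.card_prod, ZMod.card]
    exact Nat.mul_le_mul_right _ (Nat.mul_le_mul hA.card hMX)
  · rw [← ZMod.intCast_zmod_eq_zero_iff_dvd]
    push_cast at h3 ⊢
    rw [h3]; ring

theorem Sys.Ob.comp {Q E : Type} {Z : Set E} {A : Sys Q E} :
    Comp fun (x : Q × ℤ) m y => A.Ob Z m x.1 (y.2 - x.2) y.1 where
  nil a := by simpa using .nil a.1
  trans h h' := by simpa [add_comm] using h.append h'
  mono h h' := h.mono h'

theorem ow_pos : ∃ F, PB F ∧ ∀ {Q E : Type} [Fintype Q] (A : Sys Q E) {X : ℕ}, A.Bdd X →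
    ∀ {Z : Set E}, A.ZT Z → ∀ {s : Q} {w : ℤ}, A.Ow Z s w s → 0 < w →
    ∃ w', 0 < w' ∧ A.Ob Z (F X) s w' s := by
  obtain ⟨F, hF, H⟩ := ow_mod
  obtain ⟨F', hF', H'⟩ := step_min
  obtain ⟨C, hC⟩ : ∃ C : ℕ → ℕ, C = fun X => 2 * (F X * X) + X + 1 := ⟨_, rfl⟩
  have pC : PB C := by rw [hC]; fun_prop
  obtain ⟨Y, hY⟩ : ∃ Y : ℕ → ℕ, Y = fun X => F' (C X) * X := ⟨_, rfl⟩
  have pY : PB Y := by rw [hY]; fun_prop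
  refine ⟨fun X => 2 * F X + F' (C X) +
    X * ((X * Y X + 1) + 2 * (X * Y X) ^ 2 + 1) * F' (C X), by fun_prop, ?_⟩
  intro Q E _ A X hA Z hz s w h hw
  have h2 := hA.two
  have hCX : C X = 2 * (F X * X) + X + 1 := by rw [hC]
  have hYX : Y X = F' (C X) * X := by rw [hY]
  obtain ⟨a, ha, h⟩ := h.g hA hz
  let R : Q → ℤ → Q → Prop := fun s δ t => A.Ob Z (F' (C X)) s δ t
  have key : ∀ v, A.G Z (s, a) v →
      (∃ u u', A.G Z (s, a) u ∧ A.AStep Z u u' ∧ A.G Z u' v ∧ C X ≤ u'.2 - u.2) ∨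
        ∃ n b, v.2 ≤ b ∧ CR R Set.univ n s a v.1 b := by
    intro v hv
    induction hv with
    | refl => exact .inr ⟨0, a, le_rfl, .nil trivial⟩
    | @tail v v' hv hvv ih =>
      rcases ih with ⟨u, u', h1, h2, h3, h4⟩ | ⟨n, b, h1, h2⟩
      · exact .inl ⟨u, u', h1, h2, h3.tail hvv, h4⟩
      · by_cases hc : C X ≤ v'.2 - v.2
        · exact .inl ⟨v, v', hv, hvv, .refl, hc⟩
        · obtain ⟨w, h3, h4⟩ := H' A (hA.mono (Y := C X) (by omega)) hz hvv
          rw [min_eq_left (by omega)] at h4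
          exact .inr ⟨_, b + w, by omega, h2.append (.cons trivial h3 (.nil trivial))⟩
  rcases key _ h with ⟨u, u', h1, h2, h3, h4⟩ | ⟨n, b, h1, h2⟩
  · obtain ⟨w₁, k1, -⟩ := H A hA hz le_rfl (by omega) (h1.ow hz)
    obtain ⟨w₂, k2, k2'⟩ := H' A (hA.mono (Y := C X) (by omega)) hz h2
    obtain ⟨w₃, k3, -⟩ := H A hA hz le_rfl (by omega) (h3.ow hz)
    rw [min_eq_right (by omega)] at k2'
    have e1 := abs_le.1 (k1.abs_le hA)
    have e3 := abs_le.1 (k3.abs_le hA)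
    rw [hCX] at k2'
    push_cast at e1 e3 k2'
    refine ⟨_, ?_, ((k1.append k2).append k3).mono ?_⟩
    · have : (2 : ℤ) ≤ X := by exact_mod_cast hA.two
      linarith [e1.1, e3.1]
    · beta_reduce
      omega
  · have hR : ∀ s δ t, R s δ t → |δ| ≤ Y X := fun s δ t h => by
      rw [hYX]; exact Sys.Ob.abs_le hA h
    obtain ⟨a', m, -, k2, -, k3, k4⟩ := h2.raise hR one_pos (c := b - 1) (by omega)
      (by simp only at h1; omega)
    have hcard : Fintype.card Q * Y X ≤ X * Y X := Nat.mul_le_mul_right _ hA.card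
    rw [mul_one] at k3
    obtain ⟨m', k5, k6⟩ := k4.short hR (A := X * Y X + 1) (by
      rw [abs_le]
      zify at hcard
      push_cast at k3 ⊢
      constructor <;> linarith)
    have k7 := k6.cost (enc := fun s v => (s, v)) Sys.Ob.comp (P := F' (C X))
      (fun s δ t v h _ _ => by simpa using h)
    refine ⟨b - a', by omega, k7.mono ?_⟩
    refine le_trans (Nat.mul_le_mul_right _ (k5.trans ?_)) (Nat.le_add_left _ _)
    have hc := hA.card
    gcongr

theorem ow_neg : ∃ F, PB F ∧ ∀ {Q E : Type} [Fintype Q] (A : Sys Q E) {X : ℕ}, A.Bdd X →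
    ∀ {Z : Set E}, A.ZT Z → ∀ {s : Q} {w : ℤ}, A.Ow Z s w s → w < 0 →
    ∃ w' < 0, A.Ob Z (F X) s w' s := by
  obtain ⟨F, hF, H⟩ := ow_pos
  refine ⟨F, hF, ?_⟩
  intro Q E _ A X hA Z hz s w h hw
  obtain ⟨w', h1, h2⟩ := H A.rev hA.rev hz.rev (h.rev hz) (by omega)
  refine ⟨-w', by omega, ?_⟩
  simpa [Sys.rev_rev] using h2.rev hz.rev

end Shorten

section Halves

variable {Q E : Type} {Z : Set E} {A : Sys Q E}

theorem Sys.SFz.rev (hz : A.ZT Z) {m : ℕ} {a b : Cfg Q} (h : A.SFz Z a m b) (ha : Pos a) :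
    A.rev.SFz Z b m a := by
  obtain ⟨l, h1, h2⟩ := h
  exact ⟨_, by simpa, hz.run_reverse h2 ha⟩

theorem Sys.LPz.nil (a : Cfg Q) : A.LPz Z 0 a 0 a :=
  ⟨[], by simp [Sys.Blk], by simp, by simp [bsz], Sys.run_nil a, trivial⟩

theorem Sys.LPz.ow {s t : Q} {a b : ℤ} {k m : ℕ} (h : A.LPz Z k (s, 0, a) m (t, 0, b)) :
    A.Ow Z s (b - a) t :=
  let ⟨_, _, _, _, h4⟩ := h; ⟨_, Sys.OC.of_run h4⟩

theorem Sys.SFz.comp_axis : Comp fun (x : Q × ℤ) m y => A.SFz Z (x.1, 0, x.2) m (y.1, 0, y.2) where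
  nil _ := Sys.SFz.comp.nil _
  trans := Sys.SFz.comp.trans
  mono := Sys.SFz.comp.mono

/-- A run along the axis stays low with short steps, unless it reaches a high configuration or has
a step that cannot be shortened. -/
theorem Sys.G.exists_low_initial [Fintype Q] (H m : ℕ) {v₀ v₁ : Q × ℤ} (h : A.G Z v₀ v₁)
    (h0 : 0 ≤ v₀.2) {N : ℕ} (hN : Fintype.card Q * H * m ≤ N) :
    A.SFz Z (v₀.1, 0, v₀.2) N (v₁.1, 0, v₁.2) ∨
    (∃ v : Q × ℤ, H ≤ v.2 ∧ A.G Z v₀ v ∧ A.G Z v v₁ ∧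
      (v = v₀ ∨ ∃ u, A.SFz Z (v₀.1, 0, v₀.2) N (u.1, 0, u.2) ∧ A.AStep Z u v)) ∨
    ∃ u u' : Q × ℤ, u.2 < H ∧ u'.2 < H ∧ A.AStep Z u u' ∧
      ¬ A.SFz Z (u.1, 0, u.2) m (u'.1, 0, u'.2) ∧ A.SFz Z (v₀.1, 0, v₀.2) N (u.1, 0, u.2) ∧
      A.G Z v₀ u ∧ A.G Z u' v₁ := by
  classical
  let low : Finset (Q × ℤ) := Finset.univ ×ˢ Finset.Ico 0 (H : ℤ)
  have hlow : ∀ v, v ∈ low ↔ 0 ≤ v.2 ∧ v.2 < H := fun v => by simp [low]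
  have hcard : low.card = Fintype.card Q * H := by simp [low]
  let R : Q × ℤ → Q × ℤ → Prop := fun x y =>
    y ∈ low ∧ A.SFz Z (x.1, 0, x.2) m (y.1, 0, y.2)
  have hfin : ∀ v, v₀ ∈ low → Relation.ReflTransGen R v₀ v →
      A.SFz Z (v₀.1, 0, v₀.2) N (v.1, 0, v.2) := fun v h1 h2 =>
    Sys.SFz.comp_axis.mono (Sys.SFz.comp_axis.fin low (fun x y h => h) h1 h2) (by rwa [hcard])
  by_cases hv₀ : v₀ ∈ low
  swap
  · exact .inr (.inl ⟨v₀, by rw [hlow] at hv₀; omega, .refl, h, .inl rfl⟩)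
  suffices hs : (v₁ ∈ low ∧ Relation.ReflTransGen R v₀ v₁) ∨ _ from
    hs.imp_left fun hs => hfin _ hv₀ hs.2
  induction h with
  | refl => exact .inl ⟨hv₀, .refl⟩
  | @tail v v' hv hvv ih =>
    rcases ih with ⟨h1, h2⟩ | ⟨x, h1, h2, h3, h4⟩ | ⟨u, u', h1, h2, h3, h4, h5, h6, h7⟩
    · by_cases hv' : v' ∈ low
      · by_cases hs : A.SFz Z (v.1, 0, v.2) m (v'.1, 0, v'.2)
        · exact .inl ⟨hv', h2.tail ⟨hv', hs⟩⟩
        · exact .inr (.inr ⟨v, v', ((hlow _).1 h1).2, ((hlow _).1 hv').2, hvv, hs,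
            hfin _ hv₀ h2, hv, .refl⟩)
      · have := hvv.nonneg
        exact .inr (.inl ⟨v', by rw [hlow] at hv'; omega, hv.tail hvv, .refl,
          .inr ⟨v, hfin _ hv₀ h2, hvv⟩⟩)
    · exact .inr (.inl ⟨x, h1, h2, h3.tail hvv, h4⟩)
    · exact .inr (.inr ⟨u, u', h1, h2, h3, h4, h5, h6, h7.tail hvv⟩)

end Halves

section Climb

/-- A run along the axis is short, or its beginning can be replaced by a run along few blocks to a
high configuration. -/
theorem climb {H : ℕ → ℕ} (pH : PB H) : ∃ F, PB F ∧
    ∀ {Q E : Type} [Fintype Q] (A : Sys Q E) {X : ℕ}, A.Bdd X → ∀ {Z : Set E}, A.ZT Z →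
    ∀ {v₀ v₁ : Q × ℤ}, 0 ≤ v₀.2 → A.G Z v₀ v₁ → ∀ {w : ℤ}, A.Ow Z v₁.1 w v₀.1 →
    A.SFz Z (v₀.1, 0, v₀.2) (F X) (v₁.1, 0, v₁.2) ∨
    (∃ v : Q × ℤ, H X ≤ v.2 ∧ A.G Z v₀ v ∧ A.G Z v v₁ ∧
      A.LPz Z (14 * Fintype.card Q + 9) (v₀.1, 0, v₀.2) (F X) (v.1, 0, v.2)) ∨
    ∃ v : Q × ℤ, H X ≤ v.2 ∧ (∃ w, A.Ow Z v₀.1 w v.1) ∧ (∃ w, A.Ow Z v.1 w v₁.1) ∧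
      A.LPz Z (14 * Fintype.card Q + 9) (v₀.1, 0, v₀.2) (F X) (v.1, 0, v.2) ∧
      (∃ w > 0, A.Ow Z v₀.1 w v₀.1) ∧ ∃ w < 0, A.Ow Z v₀.1 w v₀.1 := by
  obtain ⟨F₁, hF₁, H₁⟩ := ow_mod
  obtain ⟨F₂, hF₂, H₂⟩ := step_low
  obtain ⟨F₃, hF₃, H₃⟩ := step_lp
  obtain ⟨Y, hY⟩ : ∃ Y : ℕ → ℕ, Y = fun X => H X + 2 * (F₁ X * X) + X + 1 := ⟨_, rfl⟩
  have pY : PB Y := by rw [hY]; fun_prop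
  refine ⟨fun X => X * H X * F₂ (Y X) + F₂ (Y X) + F₃ X, by fun_prop, ?_⟩
  intro Q E _ A X hA Z hz v₀ v₁ h0 h w hw
  have hYX : Y X = H X + 2 * (F₁ X * X) + X + 1 := by rw [hY]
  have h2 := hA.two
  have hcard := hA.card
  have hAY := hA.mono (Y := Y X) (by omega)
  beta_reduce
  obtain ⟨N, hN⟩ : ∃ N, N = X * H X * F₂ (Y X) := ⟨_, rfl⟩
  rw [← hN]
  rcases h.exists_low_initial (H X) (F₂ (Y X)) h0 (N := N) (by rw [hN]; gcongr) with
    h1 | ⟨v, h1, h2, h3, h4⟩ | ⟨u, u', h1, h2, h3, h4, h5, h6, h7⟩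
  · exact .inl (Sys.SFz.comp.mono h1 (by omega))
  · refine .inr (.inl ⟨v, h1, h2, h3, ?_⟩)
    rcases h4 with rfl | ⟨u, h4, h5⟩
    · exact (Sys.LPz.nil _).mono (by omega) (by omega)
    · exact (h4.lp.trans (H₃ A hA hz h5)).mono (by omega) (by omega)
  · right; right
    rcases H₂ A hAY hz h3 (by omega) with h8 | ⟨k, h8, h9⟩
    · exact absurd h8 h4
    rcases H₂ A.rev hAY.rev hz.rev h3.rev (by omega) with h10 | ⟨k', h10, h11⟩
    · refine absurd ?_ h4
      simpa [Sys.rev_rev] using h10.rev hz.rev ⟨le_rfl, h3.nonneg⟩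
    obtain ⟨w₁, k1, -⟩ := H₁ A hA hz le_rfl (by omega) (h6.ow hz)
    obtain ⟨w₂, k2, -⟩ := H₁ A hA hz le_rfl (by omega) ((h7.ow hz).append hw)
    have e1 := abs_le.1 (k1.abs_le hA)
    have e2 := abs_le.1 (k2.abs_le hA)
    have h12 := h11.ow.rev hz.rev
    rw [Sys.rev_rev] at h12
    have hY' : (Y X : ℤ) = H X + 2 * (F₁ X * X) + X + 1 := by exact_mod_cast hYX
    push_cast at e1 e2
    refine ⟨(u'.1, k), by simp only; omega, ⟨_, k1.ow.append h9.ow⟩, ⟨_, h7.ow hz⟩,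
      (h5.lp.trans h9).mono (by omega) (by omega), ⟨_, ?_, (k1.ow.append h9.ow).append k2.ow⟩,
      ⟨_, ?_, (k1.ow.append h12).append k2.ow⟩⟩
    · linarith [e1.1, e2.1]
    · linarith [e1.2, e2.2]

end Climb

section Connect

theorem Sys.Ob.lp {Q E : Type} [Fintype Q] {Z : Set E} {A : Sys Q E} {X : ℕ} (hA : A.Bdd X)
    {m : ℕ} {s t : Q} {w a b : ℤ} (h : A.Ob Z m s w t) (ha : (m * X : ℕ) ≤ a) (hb : b = a + w) :
    A.LPz Z 1 (s, 0, a) m (t, 0, b) := by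
  obtain ⟨l, h1, h2, rfl⟩ := h
  exact h2.lp hA h1 ha hb

theorem Sys.Ob.lp_pw {Q E : Type} [Fintype Q] {Z : Set E} {A : Sys Q E} {X : ℕ} (hA : A.Bdd X)
    {m : ℕ} {s : Q} {w a b : ℤ} (h : A.Ob Z m s w s) (k : ℕ) (ha : (m * X : ℕ) ≤ a)
    (hb : b = a + k * w) (hb' : (m * X : ℕ) ≤ b) : A.LPz Z 1 (s, 0, a) m (s, 0, b) := by
  obtain ⟨l, h1, h2, rfl⟩ := h
  exact h2.lp_pw hA h1 ha hb hb'

theorem Sys.Ow.inv {Q E : Type} {Z : Set E} {A : Sys Q E} {s t : Q} {a b : ℤ} (h : A.Ow Z s a t)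
    (h' : A.Ow Z t b s) {N : ℕ} (hN : 1 ≤ N) : ∃ w, A.Ow Z t w s ∧ (N : ℤ) ∣ w + a := by
  refine ⟨_, h'.append ((h.append h').pw (N - 1)), a + b, ?_⟩
  push_cast [hN]
  ring

theorem Sys.Ow.conj {Q E : Type} {Z : Set E} {A : Sys Q E} {s t : Q} {a b w : ℤ}
    (h : A.Ow Z s a t) (hw : A.Ow Z t w t) (h' : A.Ow Z t b s) (K : ℕ) :
    A.Ow Z s (a + b + K * w) s := by
  convert (h.append (hw.pw K)).append h' using 1; ring

theorem Sys.Ow.conj_pos {Q E : Type} {Z : Set E} {A : Sys Q E} {s t : Q} {a b w : ℤ}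
    (h : A.Ow Z s a t) (hw : A.Ow Z t w t) (h' : A.Ow Z t b s) (h0 : 0 < w) :
    ∃ w > 0, A.Ow Z s w s := by
  refine ⟨_, ?_, h.conj hw h' ((a + b).natAbs + 1)⟩
  have h1 : -(a + b) ≤ (a + b).natAbs := by omega
  have h2 : 0 ≤ ((a + b).natAbs : ℤ) * (w - 1) := mul_nonneg (by omega) (by omega)
  push_cast at *
  linarith

theorem Sys.Ow.conj_neg {Q E : Type} {Z : Set E} {A : Sys Q E} {s t : Q} {a b w : ℤ}
    (h : A.Ow Z s a t) (hw : A.Ow Z t w t) (h' : A.Ow Z t b s) (h0 : w < 0) :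
    ∃ w < 0, A.Ow Z s w s := by
  refine ⟨_, ?_, h.conj hw h' ((a + b).natAbs + 1)⟩
  have h1 : (a + b) ≤ (a + b).natAbs := by omega
  have h2 : 0 ≤ ((a + b).natAbs : ℤ) * (-w - 1) := mul_nonneg (by omega) (by omega)
  push_cast at *
  linarith

/-- High configurations are connected along two blocks in the presence of closed walks of positive
and of negative weight. -/
theorem connect_both : ∃ H F, PB H ∧ PB F ∧ ∀ {Q E : Type} [Fintype Q] (A : Sys Q E) {X : ℕ},
    A.Bdd X → ∀ {Z : Set E}, A.ZT Z → ∀ {s t : Q} {a b : ℤ}, H X ≤ a → H X ≤ b →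
    (∃ w > 0, A.Ow Z s w s) → (∃ w < 0, A.Ow Z s w s) →
    (∀ N : ℕ, 1 ≤ N → ∃ w, A.Ow Z s w t ∧ (N : ℤ) ∣ (b - a) - w) →
    A.LPz Z 2 (s, 0, a) (F X) (t, 0, b) := by
  obtain ⟨F₁, hF₁, H₁⟩ := ow_mod
  obtain ⟨F₂, hF₂, H₂⟩ := ow_pos
  obtain ⟨F₃, hF₃, H₃⟩ := ow_neg
  obtain ⟨U, hU⟩ : ∃ U : ℕ → ℕ, U = fun X => (F₂ X + F₃ X) * X := ⟨_, rfl⟩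
  have pU : PB U := by rw [hU]; fun_prop
  obtain ⟨L, hL⟩ : ∃ L : ℕ → ℕ, L = fun X => F₁ (U X * U X + X) := ⟨_, rfl⟩
  have pL : PB L := by rw [hL]; fun_prop
  refine ⟨fun X => U X + 2 * (L X * X), fun X => F₂ X + F₃ X + L X, by fun_prop, by fun_prop, ?_⟩
  intro Q E _ A X hA Z hz s t a b ha hb hp hn hN
  obtain ⟨_, k1, k2⟩ := hp
  obtain ⟨e, e1, e2⟩ := H₂ A hA hz k2 k1
  obtain ⟨_, k3, k4⟩ := hn
  obtain ⟨f, f1, f2⟩ := H₃ A hA hz k4 k3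
  have hUX : U X = F₂ X * X + F₃ X * X := by rw [hU]; exact add_mul _ _ _
  have e3 := abs_le.1 (e2.abs_le hA)
  have f3 := abs_le.1 (f2.abs_le hA)
  obtain ⟨m, rfl⟩ : ∃ m : ℕ, e = m := ⟨e.toNat, by omega⟩
  obtain ⟨n, rfl⟩ : ∃ n : ℕ, f = -n := ⟨(-f).toNat, by omega⟩
  have hmn : 1 ≤ m * n := Nat.mul_pos (by omega) (by omega)
  have hmU : m ≤ U X := by omega
  have hnU : n ≤ U X := by omega
  obtain ⟨w, g1, g2⟩ := hN _ hmn
  have hAY := hA.mono (Y := U X * U X + X) (by omega)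
  obtain ⟨w', g3, g4⟩ := H₁ A hAY hz hmn ((Nat.mul_le_mul hmU hnU).trans (by omega)) g1
  have g5 : ((m * n : ℕ) : ℤ) ∣ (b - a) - w' := by
    have := dvd_add g2 g4; rwa [sub_add_sub_cancel] at this
  have g6 : A.Ob Z (L X) s w' t := by rw [hL]; exact g3
  have g7 := abs_le.1 (g6.abs_le hA)
  obtain ⟨k, hk⟩ := g5
  beta_reduce at ha hb
  have r1 : A.LPz Z 1 (s, 0, a) (F₂ X + F₃ X) (s, 0, b - w') := by
    rcases le_total 0 k with hk0 | hk0
    · obtain ⟨k, rfl⟩ : ∃ j : ℕ, k = j := ⟨k.toNat, by omega⟩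
      refine (e2.lp_pw hA (n * k) (by omega) ?_ (by omega)).mono le_rfl (by omega)
      push_cast at hk ⊢
      linarith
    · obtain ⟨k, rfl⟩ : ∃ j : ℕ, k = -j := ⟨(-k).toNat, by omega⟩
      refine (f2.lp_pw hA (m * k) (by omega) ?_ (by omega)).mono le_rfl (by omega)
      push_cast at hk ⊢
      linarith
  exact r1.trans (g6.lp hA (by omega) (by ring))

/-- High configurations are connected along few blocks in the absence of closed walks of negative
weight. -/
theorem connect_up : ∃ H F, PB H ∧ PB F ∧ ∀ {Q E : Type} [Fintype Q] (A : Sys Q E) {X : ℕ},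
    A.Bdd X → ∀ {Z : Set E}, A.ZT Z → ∀ {v v' : Q × ℤ}, H X ≤ v.2 → H X ≤ v'.2 →
    (∀ w, A.Ow Z v.1 w v.1 → 0 ≤ w) → A.G Z v v' → ∀ {c : ℤ}, A.Ow Z v'.1 c v.1 →
    A.LPz Z 2 (v.1, 0, v.2) (F X) (v'.1, 0, v'.2) := by
  obtain ⟨F₁, hF₁, H₁⟩ := ow_mod
  obtain ⟨F₂, hF₂, H₂⟩ := ow_pos
  obtain ⟨F₃, hF₃, H₃⟩ := step_exact
  obtain ⟨U, hU⟩ : ∃ U : ℕ → ℕ, U = fun X => F₁ X * X := ⟨_, rfl⟩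
  have pU : PB U := by rw [hU]; fun_prop
  obtain ⟨L, hL⟩ : ∃ L : ℕ → ℕ, L = fun X => F₁ (F₂ X * X + X) := ⟨_, rfl⟩
  have pL : PB L := by rw [hL]; fun_prop
  obtain ⟨B, hB⟩ : ∃ B : ℕ → ℕ, B = fun X => U X + L X * X + 3 * U X + X := ⟨_, rfl⟩
  have pB : PB B := by rw [hB]; fun_prop
  refine ⟨fun X => U X + 2 * (L X * X) + F₂ X * X + F₃ (B X) * X,
    fun X => F₂ X + L X + X * (B X + 1) * F₃ (B X), by fun_prop, by fun_prop, ?_⟩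
  intro Q E _ A X hA Z hz v v' ha hb hnn h c hc
  have two := hA.two
  have hBX : B X = U X + L X * X + 3 * U X + X := by rw [hB]
  beta_reduce at ha hb
  have short : ∀ {s t : Q} {w : ℤ}, A.Ow Z s w t → ∃ w', A.Ow Z s w' t ∧ -(U X) ≤ w' ∧ w' ≤ U X := by
    intro s t w hw
    obtain ⟨w', h1, -⟩ := H₁ A hA hz le_rfl (by omega) hw
    have := abs_le.1 (h1.abs_le hA)
    exact ⟨w', h1.ow, by rw [hU]; exact this.1, by rw [hU]; exact this.2⟩
  by_cases hd : (U X + L X * X : ℕ) < v'.2 - v.2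
  · obtain ⟨c', k1, k2, k3⟩ := short hc
    obtain ⟨e, e1, e2⟩ := H₂ A hA hz ((h.ow hz).append k1) (by omega)
    have e3 := abs_le.1 (e2.abs_le hA)
    obtain ⟨m, rfl⟩ : ∃ m : ℕ, e = m := ⟨e.toNat, by omega⟩
    have hAY := hA.mono (Y := F₂ X * X + X) (by omega)
    obtain ⟨w', g3, k, hk⟩ := H₁ A hAY hz (M := m) (by omega) (by omega) (h.ow hz)
    have g6 : A.Ob Z (L X) v.1 w' v'.1 := by rw [hL]; exact g3
    have g7 := abs_le.1 (g6.abs_le hA)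
    have hk0 : 0 ≤ k := by
      by_contra hk0
      have : (m : ℤ) * k < 0 := mul_neg_of_pos_of_neg e1 (by omega)
      omega
    obtain ⟨k, rfl⟩ : ∃ j : ℕ, k = j := ⟨k.toNat, by omega⟩
    have r1 := e2.lp_pw hA (a := v.2) (b := v'.2 - w') k (by omega) (by linarith) (by omega)
    exact (r1.trans (g6.lp hA (by omega) (by ring))).mono le_rfl (Nat.le_add_right _ _)
  · obtain ⟨N, hN⟩ : ∃ N : Finset (Q × ℤ),
      N = Finset.univ ×ˢ Finset.Icc (v.2 - U X) (v'.2 + 2 * U X) := ⟨_, rfl⟩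
    have hmem : ∀ z, A.G Z v z → A.G Z z v' → v.2 - U X ≤ z.2 ∧ z.2 ≤ v'.2 + 2 * U X := by
      intro z h1 h2
      obtain ⟨w₁, k1, k1', k1''⟩ := short (h1.ow hz)
      obtain ⟨w₂, k2, k2', k2''⟩ := short ((h2.ow hz).append hc)
      obtain ⟨w₃, k3, k3', k3''⟩ := short hc
      have e1 := hnn _ ((h1.ow hz).append k2)
      have e2 := hnn _ ((k1.append (h2.ow hz)).append k3)
      constructor <;> omega
    let R : Q × ℤ → Q × ℤ → Prop := fun x y =>
      y ∈ N ∧ A.SFz Z (x.1, 0, x.2) (F₃ (B X)) (y.1, 0, y.2)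
    have hR : ∀ z, A.G Z v z → A.G Z z v' → Relation.ReflTransGen R v z := by
      intro z h1
      induction h1 with
      | refl => exact fun _ => .refl
      | @tail u u' h1 h2 ih =>
        intro h3
        have m1 := hmem u h1 (.head h2 h3)
        have m2 := hmem u' (.tail h1 h2) h3
        refine (ih (.head h2 h3)).tail ⟨by rw [hN]; simpa using m2, ?_⟩
        rcases H₃ A.rev (hA.rev.mono (Y := B X) (by omega)) hz.rev h2.rev (by omega) with h4 | h4
        · have h5 := h4.rev hz.rev
          rw [Sys.rev_rev] at h5
          obtain ⟨l, h6, h7, h8⟩ := h5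
          have := h7.run hA h6 (a := u.2) (by omega)
          rw [h8] at this
          exact ⟨l, h6, by convert this using 3; ring⟩
        · exfalso
          have h1' : A.Ow Z v.1 (u.2 - v.2) u.1 := Sys.G.ow hz h1
          have h3' : A.Ow Z u'.1 (v'.2 - u'.2) v'.1 := Sys.G.ow hz h3
          obtain ⟨w, h5, h6⟩ := h4 (u.2 - v.2 + (v'.2 - u'.2) + c + 1)
          have h7 := h6.rev hz.rev
          rw [Sys.rev_rev] at h7
          have := hnn _ (((h1'.append h7).append h3').append hc)
          omega
    have hv := hmem v .refl h
    have := Sys.SFz.comp_axis.fin N (fun x y h => h) (by rw [hN]; simpa using hv)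
      (hR v' h .refl)
    refine this.lp.mono (by omega) (le_trans (Nat.mul_le_mul_right _ ?_) (Nat.le_add_left _ _))
    rw [hN, Finset.card_product, Finset.card_univ, Int.card_Icc]
    exact Nat.mul_le_mul hA.card (by omega)

end Connect

section Assembly

theorem Sys.LPz.of_rev {Q E : Type} {Z : Set E} {A : Sys Q E} (hz : A.ZT Z) {k m : ℕ} {a b : Cfg Q}
    (h : A.rev.LPz Z k b m a) (hb : Pos b) : A.LPz Z k a m b :=
  A.rev_rev ▸ h.rev hz.rev hb

theorem Sys.Ow.of_rev {Q E : Type} {Z : Set E} {A : Sys Q E} (hz : A.ZT Z) {s t : Q} {w : ℤ}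
    (h : A.rev.Ow Z t w s) : A.Ow Z s (-w) t :=
  A.rev_rev ▸ h.rev hz.rev

theorem Sys.G.of_rev {Q E : Type} {Z : Set E} {A : Sys Q E} {a b : Q × ℤ}
    (h : A.rev.G Z b a) : A.G Z a b :=
  A.rev_rev ▸ h.rev

theorem loop_nonneg : ∃ F, PB F ∧ ∀ {Q E : Type} [Fintype Q] (A : Sys Q E) {X : ℕ},
    A.Bdd X → ∀ {Z : Set E}, A.ZT Z → ∀ {q : Q} {x y : ℤ}, 0 ≤ x → A.G Z (q, x) (q, y) →
    (∀ w, A.Ow Z q w q → 0 ≤ w) →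
    A.LPz Z (28 * Fintype.card Q + 20) (q, 0, x) (F X) (q, 0, y) := by
  obtain ⟨H, F, pH, pF, connect⟩ := connect_up
  obtain ⟨C, pC, climb⟩ := climb pH
  refine ⟨fun X => C X + F X + C X, by fun_prop, ?_⟩
  intro Q E _ A X hA Z hz q x y hx h hq
  have hy : 0 ≤ y := h.nonneg hx
  beta_reduce
  rcases climb A hA hz (v₀ := (q, x)) (v₁ := (q, y)) hx h (.nil q) with
    h1 | ⟨v, hv, h1, h2, h3⟩ | ⟨v, -, -, -, -, -, w, hw, h1⟩
  · exact h1.lp.mono (by omega) (by omega)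
  · have hr : A.Ow Z q _ v.1 := Sys.G.ow hz h1
    have hr' : A.Ow Z v.1 _ q := Sys.G.ow hz h2
    rcases climb A.rev hA.rev hz.rev (v₀ := (q, y)) (v₁ := v) hy h2.rev (hr.rev hz) with
      k1 | ⟨v', hv', k1, k2, k3⟩ | ⟨v', -, -, -, -, ⟨w, hw, k1⟩, -⟩
    · exact (h3.trans (k1.lp.of_rev hz ⟨le_rfl, by dsimp only; omega⟩)).mono (by omega) (by omega)
    · have k4 : A.Ow Z v'.1 _ q := Sys.G.ow hz (Sys.G.of_rev k1)
      refine ((h3.trans (connect A hA hz hv hv' ?_ (Sys.G.of_rev k2) (k4.append hr))).trans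
        (k3.of_rev hz ⟨le_rfl, by dsimp only; omega⟩)).mono (by omega) (by omega)
      intro w hw
      by_contra! h0
      obtain ⟨w', h0, h'⟩ := hr.conj_neg hw hr' h0
      linarith [hq _ h']
    · linarith [hq _ (k1.of_rev hz)]
  · linarith [hq _ h1]

theorem loop_both : ∃ F, PB F ∧ ∀ {Q E : Type} [Fintype Q] (A : Sys Q E) {X : ℕ},
    A.Bdd X → ∀ {Z : Set E}, A.ZT Z → ∀ {q : Q} {x y : ℤ}, 0 ≤ x → A.G Z (q, x) (q, y) →
    (∃ w > 0, A.Ow Z q w q) → (∃ w < 0, A.Ow Z q w q) →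
    A.LPz Z (28 * Fintype.card Q + 20) (q, 0, x) (F X) (q, 0, y) := by
  obtain ⟨H, F, pH, pF, connect⟩ := connect_both
  obtain ⟨C, pC, climb⟩ := climb pH
  have climb' : ∀ {Q E : Type} [Fintype Q] (A : Sys Q E) {X : ℕ},
      A.Bdd X → ∀ {Z : Set E}, A.ZT Z → ∀ {q : Q} {x y : ℤ}, 0 ≤ x → A.G Z (q, x) (q, y) →
      A.LPz Z 1 (q, 0, x) (C X) (q, 0, y) ∨ ∃ v : Q × ℤ, H X ≤ v.2 ∧
        (∃ w, A.Ow Z q w v.1) ∧ (∃ w, A.Ow Z v.1 w q) ∧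
        A.LPz Z (14 * Fintype.card Q + 9) (q, 0, x) (C X) (v.1, 0, v.2) := by
    intro Q E _ A X hA Z hz q x y hx h
    rcases climb A hA hz (v₀ := (q, x)) (v₁ := (q, y)) hx h (.nil q) with
      h1 | ⟨v, hv, h1, h2, h3⟩ | ⟨v, h1, h2, h3, h4, -⟩
    · exact .inl h1.lp
    · exact .inr ⟨v, hv, ⟨_, Sys.G.ow hz h1⟩, ⟨_, Sys.G.ow hz h2⟩, h3⟩
    · exact .inr ⟨v, h1, h2, h3, h4⟩
  refine ⟨fun X => C X + F X + C X, by fun_prop, ?_⟩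
  rintro Q E _ A X hA Z hz q x y hx h ⟨w₁, hw₁, c₁⟩ ⟨w₂, hw₂, c₂⟩
  have hy : 0 ≤ y := h.nonneg hx
  beta_reduce
  rcases climb' A hA hz hx h with h1 | ⟨v, hv, ⟨a, ha⟩, ⟨b, hb⟩, h1⟩
  · exact h1.mono (by omega) (by omega)
  rcases climb' A.rev hA.rev hz.rev hy h.rev with k1 | ⟨v', hv', ⟨a', ha'⟩, ⟨b', hb'⟩, k1⟩
  · exact (k1.of_rev hz ⟨le_rfl, hy⟩).mono (by omega) (by omega)
  have k2 := k1.of_rev hz ⟨le_rfl, hy⟩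
  refine ((h1.trans (connect A hA hz hv hv' (hb.conj_pos c₁ ha hw₁) (hb.conj_neg c₂ ha hw₂) ?_)).trans
    k2).mono (by omega) (by omega)
  intro N hN
  obtain ⟨i, hi, di⟩ := h1.ow.inv hb hN
  obtain ⟨j, hj, dj⟩ := k2.ow.inv (hb'.of_rev hz) hN
  refine ⟨_, (hi.append (Sys.G.ow hz h)).append hj, ?_⟩
  obtain ⟨m, hm⟩ := di
  obtain ⟨m', hm'⟩ := dj
  exact ⟨-(m + m'), by dsimp only at *; linear_combination -hm - hm'⟩

theorem loop_lp : ∃ F, PB F ∧ ∀ {Q E : Type} [Fintype Q] (A : Sys Q E) {X : ℕ},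
    A.Bdd X → ∀ {Z : Set E}, A.ZT Z → ∀ {q : Q} {x y : ℤ}, 0 ≤ x → A.G Z (q, x) (q, y) →
    A.LPz Z (28 * Fintype.card Q + 20) (q, 0, x) (F X) (q, 0, y) := by
  obtain ⟨F, pF, hF⟩ := loop_nonneg
  obtain ⟨F', pF', hF'⟩ := loop_both
  refine ⟨fun X => F X + F' X, by fun_prop, ?_⟩
  intro Q E _ A X hA Z hz q x y hx h
  have hy : 0 ≤ y := h.nonneg hx
  beta_reduce
  by_cases hn : ∃ w < 0, A.Ow Z q w q
  · by_cases hp : ∃ w > 0, A.Ow Z q w q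
    · exact (hF' A hA hz hx h hp hn).mono le_rfl (by omega)
    · refine ((hF A.rev hA.rev hz.rev hy h.rev ?_).of_rev hz ⟨le_rfl, hy⟩).mono le_rfl (by omega)
      intro w hw
      by_contra! h0
      exact hp ⟨-w, by omega, hw.of_rev hz⟩
  · refine (hF A hA hz hx h ?_).mono le_rfl (by omega)
    intro w hw
    by_contra! h0
    exact hn ⟨w, h0, hw⟩

end Assembly

section Main

variable {Q : Type}

/-- The two-counter system of a 2-TVASS, in which zero-tests have weight zero. -/
def TVASS.sys (V : TVASS 2 Q) : Sys Q (Trans 2 Q) where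
  src t := t.1
  tgt t := t.2.2
  T := {t | t ∈ V.trans}
  f t := t.2.1.elim 0 fun a => a 0
  g t := t.2.1.elim 0 fun a => a 1

/-- The zero-tests of a 2-TVASS. -/
def tests (Q : Type) : Set (Trans 2 Q) := {t | t.2.1 = none}

variable {V : TVASS 2 Q}

theorem TVASS.sys_zt : V.sys.ZT (tests Q) := by
  rintro ⟨s, a, t⟩ (rfl : a = none)
  exact ⟨rfl, rfl⟩

theorem TVASS.sys_bdd [Fintype Q] (h : 2 ≤ Fintype.card Q + V.actNorm) :
    V.sys.Bdd (Fintype.card Q + V.actNorm) := by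
  have key : ∀ e ∈ V.trans, ∀ i, |(e.2.1.elim 0 fun a => a i : ℤ)| ≤ V.actNorm := by
    rintro ⟨s, _ | a, t⟩ he i
    · simp
    · have h1 : vnormZ a ≤ V.actNorm :=
        Finset.le_sup (f := fun a : Act 2 => a.elim 0 vnormZ) (V.mem_acts _ he)
      have h2 : (a i).natAbs ≤ vnormZ a :=
        Finset.le_sup (f := fun i => (a i).natAbs) (Finset.mem_univ i)
      rw [Int.abs_eq_natAbs]
      exact_mod_cast h2.trans h1
  exact ⟨h, by omega, fun e he => (key e he 0).trans (by push_cast; omega),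
    fun e he => (key e he 1).trans (by push_cast; omega)⟩

/-- Configurations as pairs of integer counters. -/
def toCfg (c : Config 2 Q) : Cfg Q := (c.1, c.2 0, c.2 1)

theorem stepBy_iff {t : Trans 2 Q} {c c' : Config 2 Q} :
    StepBy t c c' ↔ t.1 = c.1 ∧ t.2.2 = c'.1 ∧ (c'.2 0 : ℤ) = c.2 0 + V.sys.f t ∧
      (c'.2 1 : ℤ) = c.2 1 + V.sys.g t ∧ (t ∈ tests Q → (c.2 0 : ℤ) = 0) := by
  obtain ⟨s, _ | a, u⟩ := t
  · have : ((s, none, u) : Trans 2 Q) ∈ tests Q := rfl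
    simp only [StepBy, TVASS.sys, Option.elim, this, funext_iff, Fin.forall_fin_two]
    grind
  · simp [StepBy, TVASS.sys, tests, Fin.forall_fin_two]

theorem run_iff {c c' : Config 2 Q} {l : List (Trans 2 Q)} :
    Run V c l c' ↔ V.sys.ZR (tests Q) (toCfg c) l (toCfg c') := by
  induction l generalizing c with
  | nil =>
    constructor
    · rintro ⟨⟩
      exact ⟨Sys.run_nil _, trivial⟩
    · rintro ⟨⟨h1, -, -, h4, h5⟩, -⟩
      suffices c' = c by rw [this]; exact .nil c
      simp only [toCfg, sm_nil, add_zero, Nat.cast_inj] at h1 h4 h5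
      exact Prod.ext h1.symm (funext (Fin.forall_fin_two.2 ⟨h4, h5⟩))
  | cons t l ih =>
    constructor
    · rintro (_ | ⟨h1, h2, h3⟩)
      obtain ⟨⟨k1, k2, k3, k4, k5⟩, k6⟩ := ih.1 h3
      obtain ⟨j1, j2, j3, j4, j5⟩ := (stepBy_iff (V := V)).1 h2
      dsimp only [toCfg] at *
      rw [← j2] at k1
      rw [j3] at k2 k4 k6
      rw [j4] at k3 k5
      refine ⟨⟨⟨h1, j1, k1⟩, ⟨?_, k2⟩, ⟨?_, k3⟩, ?_, ?_⟩, j5, k6⟩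
      · dsimp only; omega
      · dsimp only; omega
      · simpa [add_assoc] using k4
      · simpa [add_assoc] using k5
    · rintro ⟨⟨⟨h1, h2, k1⟩, ⟨h3, k2⟩, ⟨h4, k3⟩, k4, k5⟩, j5, k6⟩
      dsimp only [toCfg] at *
      obtain ⟨m, e3⟩ := Int.eq_ofNat_of_zero_le h3
      obtain ⟨n, e4⟩ := Int.eq_ofNat_of_zero_le h4
      refine .cons (c' := (t.2.2, ![m, n])) h1
        ((stepBy_iff (V := V)).2 ⟨h2, rfl, e3.symm, e4.symm, j5⟩) (ih.2 ?_)
      rw [e3] at k2 k6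
      rw [e4] at k3
      refine ⟨⟨k1, k2, k3, ?_, ?_⟩, k6⟩
      · rw [sm_cons, ← add_assoc, e3] at k4
        exact k4
      · rw [sm_cons, ← add_assoc, e4] at k5
        exact k5

theorem isPathFrom_iff {s t : Q} {l : List (Trans 2 Q)} :
    IsPathFrom V s l t ↔ V.sys.Walk s l t := by
  induction l generalizing s with
  | nil =>
    constructor
    · rintro ⟨⟩
      rfl
    · rintro rfl
      exact .nil _
  | cons e l ih =>
    constructor
    · rintro (_ | ⟨h1, h2⟩)
      exact ⟨h1, rfl, ih.1 h2⟩
    · rintro ⟨h1, rfl, h2⟩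
      exact .cons h1 (ih.2 h2)

/-- The linear path scheme of a list of blocks. -/
def chain (bs : List (List (Trans 2 Q) × ℕ)) : List (List (Trans 2 Q) × List (Trans 2 Q)) :=
  bs.map fun b => if b.2 = 1 then ([], b.1) else (b.1, [])

theorem wordRest_chain (bs : List (List (Trans 2 Q) × ℕ)) :
    wordRest (chain bs) (bs.map Prod.snd) = flat bs := by
  induction bs with
  | nil => rfl
  | cons b bs ih =>
    simp only [chain, flat, List.map_cons, List.flatMap_cons] at ih ⊢
    split_ifs with h
    · simp [wordRest, ih, h, pw]
    · simp [wordRest, ih]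

theorem chainLPS_chain {s t : Q} {bs : List (List (Trans 2 Q) × ℕ)} (hb : V.sys.Blk bs)
    (h : V.sys.Walk s (flat bs) t) : ∃ bs' , ChainLPS V s (chain bs') t ∧ flat bs' = flat bs ∧
      bs'.length ≤ bs.length ∧ bsz bs' ≤ bsz bs := by
  induction bs generalizing s with
  | nil =>
    obtain rfl : s = t := h
    exact ⟨[], .nil s, rfl, le_rfl, le_rfl⟩
  | cons b bs ih =>
    have hfl : ∀ bs : List (List (Trans 2 Q) × ℕ), flat (b :: bs) = pw b.1 b.2 ++ flat bs :=
      fun bs => by simp [flat]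
    have hsz : ∀ bs : List (List (Trans 2 Q) × ℕ), bsz (b :: bs) = b.1.length + bsz bs :=
      fun bs => by simp [bsz]
    rw [hfl] at h
    obtain ⟨r, h1, h2⟩ := Sys.walk_append.1 h
    obtain ⟨bs', k1, k2, k3, k4⟩ := ih (fun b hb' => hb b (by simp [hb'])) h2
    by_cases hz : pw b.1 b.2 = []
    · rw [hz] at h1
      obtain rfl : s = r := h1
      exact ⟨bs', k1, by rw [hfl, hz, k2]; rfl, k3.trans (by simp), by rw [hsz]; omega⟩
    refine ⟨b :: bs', ?_, by rw [hfl, hfl, k2], by simpa, by rw [hsz, hsz]; omega⟩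
    rw [chain, List.map_cons]
    split_ifs with h3
    · rw [h3, pw_one] at h1
      exact .cons (.nil s) (isPathFrom_iff.2 h1) k1
    · obtain ⟨u, h4⟩ := (hb b (by simp)).resolve_left h3
      have hsu : s = u := by
        obtain ⟨n, hn⟩ : ∃ n, b.2 = n + 1 :=
          ⟨b.2 - 1, by have : b.2 ≠ 0 := fun h => hz (by rw [h, pw_zero]); omega⟩
        rw [hn, pw_succ] at h1
        rcases b with ⟨_ | ⟨e, l⟩, m⟩
        · exact absurd (by simp [pw]) hz
        · exact h1.2.1.symm.trans h4.2.1
      subst hsu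
      obtain rfl := (h4.pw b.2).right_unique h1
      exact .cons (isPathFrom_iff.2 h4) (.nil s) k1

theorem bsz_chain (bs : List (List (Trans 2 Q) × ℕ)) :
    ((chain bs).map fun p => p.1.length + p.2.length).sum = bsz bs := by
  simp only [chain, bsz, List.map_map]
  congr 2
  ext b
  dsimp only [Function.comp]
  split_ifs <;> simp

/-- Runs along blocks are runs along linear path schemes. -/
theorem Sys.LPz.exists_lps {k m : ℕ} {c c' : Config 2 Q}
    (h : V.sys.LPz (tests Q) k (toCfg c) m (toCfg c')) :
    ∃ L : LPS 2 Q, IsLPS V c.1 L c'.1 ∧ L.len ≤ m ∧ L.stars ≤ k ∧ ReachLPS V L c c' := by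
  obtain ⟨bs, h1, h2, h3, h4⟩ := h
  obtain ⟨bs', k1, k2, k3, k4⟩ := chainLPS_chain h1 h4.1.1
  refine ⟨⟨[], chain bs'⟩, ⟨_, .nil _, k1⟩, ?_, ?_, bs'.map Prod.snd, ?_⟩
  · simp only [LPS.len, bsz_chain, List.length_nil]
    omega
  · simp only [LPS.stars, chain, List.length_map]
    omega
  · rw [LPS.word, wordRest_chain, List.nil_append, k2]
    exact run_iff.2 h4

theorem eq_of_actNorm_eq_zero (h : V.actNorm = 0) {c c' : Config 2 Q} {l : List (Trans 2 Q)}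
    (hr : Run V c l c') : c.2 = c'.2 := by
  induction hr with
  | nil c => rfl
  | @cons t c c' c'' l h1 h2 _ ih =>
    rw [← ih]
    obtain ⟨s, _ | a, u⟩ := t
    · exact h2.2.2.2.symm
    · have h3 : vnormZ a ≤ V.actNorm :=
        Finset.le_sup (f := fun a : Act 2 => a.elim 0 vnormZ) (V.mem_acts _ h1)
      ext i
      have h4 : (a i).natAbs ≤ vnormZ a :=
        Finset.le_sup (f := fun i => (a i).natAbs) (Finset.mem_univ i)
      have := h2.2.2 i
      omega

end Main

/-- Lemma: vertical loops are captured by small linear path schemes. -/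
theorem vertical_loop_small_lps :
    ∃ c : ℕ, 1 ≤ c ∧
      ∀ (Q : Type) [Fintype Q] [Nonempty Q] (V : TVASS 2 Q)
        (q : Q) (x y : ℕ),
        Reach V (q, ![0, x]) (q, ![0, y]) →
        ∃ L : LPS 2 Q, IsLPS V q L q ∧
          L.len ≤ (Fintype.card Q + V.actNorm) ^ c ∧
          L.stars ≤ c * Fintype.card Q ^ 2 ∧
          ReachLPS V L (q, ![0, x]) (q, ![0, y]) := by
  obtain ⟨F, ⟨C, hC⟩, hF⟩ := loop_lp
  refine ⟨C + 48, by omega, ?_⟩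
  rintro Q _ _ V q x y ⟨l, hl⟩
  have hn : 1 ≤ Fintype.card Q := Fintype.card_pos
  by_cases h2 : 2 ≤ Fintype.card Q + V.actNorm
  · have hg := TVASS.sys_zt.g_of_run (run_iff.1 hl) (by simp)
    obtain ⟨L, h1, h3, h4, h5⟩ := Sys.LPz.exists_lps (V := V) (c := (q, ![0, x])) (c' := (q, ![0, y]))
      (hF V.sys (TVASS.sys_bdd h2) TVASS.sys_zt (Nat.cast_nonneg x) hg)
    refine ⟨L, h1, h3.trans ((hC _ h2).trans (Nat.pow_le_pow_right (by omega) (by omega))),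
      h4.trans ?_, h5⟩
    nlinarith [Nat.zero_le C, Nat.zero_le (C * Fintype.card Q ^ 2)]
  · have := eq_of_actNorm_eq_zero (by omega) hl
    dsimp only at this
    rw [this]
    exact ⟨⟨[], []⟩, ⟨q, .nil q, .nil q⟩, by simp [LPS.len], by simp [LPS.stars], [], .nil _⟩

end TVASSpaper
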